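/- Suppose L*(x) > V_k(x) at some point x ∈ ℝ^N. Then there exist a sequence x_n → x with L(x_n) → L*(x) and L(x_n) > V_k(x_n) for every n, and a number ε > 0, such that for every n with |x_n − x| ≤ ε and every t ∈ [0, ε], L(x_n) ≤ inf_{α∈𝒜_{x_n}} E_{x_n}[ e^{−λt} L*(X_t^α) + ∫₀^t l(X_s^α) e^{−λs} ds ]. -/

import Mathlib

open MeasureTheory Filter Set
open scoped InnerProductSpace ENNReal NNReal Topology

noncomputable section

/-- Euclidean space `ℝ^N`. -/
abbrev EN (N : ℕ) := EuclideanSpace ℝ (Fin N)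

/-- Frobenius norm of an `N × M` real matrix. -/
def mnorm {N M : ℕ} (σ : Matrix (Fin N) (Fin M) ℝ) : ℝ :=
  Real.sqrt (∑ i, ∑ j, (σ i j) ^ 2)

/-- Entry `(i,j)` of the Hessian `D²φ(x)`. -/
def hessEntry {N : ℕ} (φ : EN N → ℝ) (x : EN N) (i j : Fin N) : ℝ :=
  iteratedFDeriv ℝ 2 φ x ![EuclideanSpace.single i 1, EuclideanSpace.single j 1]

/-- `trace (a · D²φ(x))` for a square matrix `a`. -/
def traceTerm {N : ℕ} (a : Matrix (Fin N) (Fin N) ℝ) (φ : EN N → ℝ) (x : EN N) : ℝ :=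
  ∑ i, ∑ j, a i j * hessEntry φ x j i

/-- The generator `L^α φ(x) = f(x,α)·Dφ(x) + trace(a(x,α) D²φ(x))`. -/
def gen {N M : ℕ} (f : EN N → EN M → EN N)
    (a : EN N → EN M → Matrix (Fin N) (Fin N) ℝ)
    (φ : EN N → ℝ) (x : EN N) (α : EN M) : ℝ :=
  ⟪f x α, gradient φ x⟫_ℝ + traceTerm (a x α) φ x

/-- Lipschitz-in-`x` condition on the coefficients, uniformly over `α ∈ A`. -/
def LipCoeff {N M : ℕ} (A : Set (EN M)) (f : EN N → EN M → EN N)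
    (σ : EN N → EN M → Matrix (Fin N) (Fin M) ℝ) : Prop :=
  ∃ C : ℝ, ∀ α ∈ A, ∀ x y : EN N,
    ‖f x α - f y α‖ + mnorm (σ x α - σ y α) ≤ C * ‖x - y‖

/-- Convexity of the set `{(a(x,α), f(x,α)) : α ∈ A}` for every `x`. -/
def ConvexCoeff {N M : ℕ} (A : Set (EN M)) (f : EN N → EN M → EN N)
    (a : EN N → EN M → Matrix (Fin N) (Fin N) ℝ) : Prop :=
  ∀ x : EN N, Convex ℝ {p : Matrix (Fin N) (Fin N) ℝ × EN N | ∃ α ∈ A, p = (a x α, f x α)}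

/-- Viscosity supersolution of `max_{α∈A} { -f(x,α)·DV(x) - tr(a(x,α) D²V(x)) } = g(x)` on `O`:
at every local minimum point `x₀ ∈ O` of `V - φ` (relative to `O`), with `φ` of class `C²`,
one has `max_{α∈A} { -f(x₀,α)·Dφ(x₀) - tr(a(x₀,α) D²φ(x₀)) } ≥ g(x₀)` (the maximum over the
compact set `A` being attained, this is expressed by an existential quantifier). -/
def IsSupersolution {N M : ℕ} (A : Set (EN M)) (f : EN N → EN M → EN N)
    (a : EN N → EN M → Matrix (Fin N) (Fin N) ℝ)
    (O : Set (EN N)) (g : EN N → ℝ) (V : EN N → ℝ) : Prop :=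
  ∀ φ : EN N → ℝ, ContDiff ℝ 2 φ → ∀ x₀ ∈ O,
    IsLocalMinOn (fun y => V y - φ y) O x₀ →
    ∃ α ∈ A, g x₀ ≤ -gen f a φ x₀ α

/-- Viscosity subsolution of `max_{α∈A} { -f(x,α)·DU(x) - tr(a(x,α) D²U(x)) } = g(x)` on `O`. -/
def IsSubsolution {N M : ℕ} (A : Set (EN M)) (f : EN N → EN M → EN N)
    (a : EN N → EN M → Matrix (Fin N) (Fin N) ℝ)
    (O : Set (EN N)) (g : EN N → ℝ) (U : EN N → ℝ) : Prop :=
  ∀ φ : EN N → ℝ, ContDiff ℝ 2 φ → ∀ x₀ ∈ O,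
    IsLocalMaxOn (fun y => U y - φ y) O x₀ →
    ∀ α ∈ A, -gen f a φ x₀ α ≤ g x₀

/-- An admissible (weak) control for the initial point `x`: a filtered probability space,
a continuous progressively measurable process `X` with `X 0 = x` a.s., and a progressively
measurable `A`-valued control process `α`, such that for every bounded `C²` test function `φ`
the process `φ(X_t) - ∫₀ᵗ [f(X_s,α_s)·Dφ(X_s) + tr(a(X_s,α_s) D²φ(X_s))] ds` is a
`P`-martingale (integrable, adapted by progressive measurability of `X` and `α`, and
satisfying the conditional-expectation identity for all `0 ≤ s ≤ t`). -/
structure Control (N M : ℕ) (A : Set (EN M)) (f : EN N → EN M → EN N)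
    (a : EN N → EN M → Matrix (Fin N) (Fin N) ℝ) (x : EN N) where
  (Ω : Type)
  [mΩ : MeasurableSpace Ω]
  (P : Measure Ω)
  [isProb : IsProbabilityMeasure P]
  (F : Filtration ℝ mΩ)
  (X : ℝ → Ω → EN N)
  (α : ℝ → Ω → EN M)
  (X_cont : ∀ ω, Continuous fun t => X t ω)
  (X_prog : ProgMeasurable F X)
  (α_prog : ProgMeasurable F α)
  (α_mem : ∀ t ω, α t ω ∈ A)
  (init : ∀ᵐ ω ∂P, X 0 ω = x)
  (mart_int : ∀ φ : EN N → ℝ, ContDiff ℝ 2 φ → (∃ K, ∀ y, |φ y| ≤ K) →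
    ∀ t : ℝ, 0 ≤ t → Integrable
      (fun ω => φ (X t ω) - ∫ s in Ioc (0:ℝ) t, gen f a φ (X s ω) (α s ω)) P)
  (mart : ∀ φ : EN N → ℝ, ContDiff ℝ 2 φ → (∃ K, ∀ y, |φ y| ≤ K) →
    ∀ s t : ℝ, 0 ≤ s → s ≤ t →
      P[fun ω => φ (X t ω) - ∫ u in Ioc (0:ℝ) t, gen f a φ (X u ω) (α u ω) | F s]
        =ᵐ[P] fun ω => φ (X s ω) - ∫ u in Ioc (0:ℝ) s, gen f a φ (X u ω) (α u ω))

/-- Expected payoff `E_x[ V(X_t) + ∫₀ᵗ l(X_s) ds ]` for a control `c` at time `t ≥ 0`. -/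
def payoff {N M : ℕ} {A : Set (EN M)} {f : EN N → EN M → EN N}
    {a : EN N → EN M → Matrix (Fin N) (Fin N) ℝ} {x : EN N}
    (c : Control N M A f a x) (V l : EN N → ℝ) (t : ℝ) : ℝ :=
  ∫ ω, (V (c.X t ω) + ∫ s in Ioc (0:ℝ) t, l (c.X s ω)) ∂c.P


set_option linter.all false
set_option maxSynthPendingDepth 3


/-- Bundled standing hypotheses. -/
structure Hyp {N M : ℕ} (A : Set (EN M)) (f : EN N → EN M → EN N)
    (σ : EN N → EN M → Matrix (Fin N) (Fin M) ℝ)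
    (a : EN N → EN M → Matrix (Fin N) (Fin N) ℝ) : Prop where
  hA : IsCompact A
  hf : ContinuousOn (fun p : EN N × EN M => f p.1 p.2) (univ ×ˢ A)
  hσ : ContinuousOn (fun p : EN N × EN M => σ p.1 p.2) (univ ×ˢ A)
  hlip : LipCoeff A f σ
  ha : ∀ y β, a y β = (2⁻¹ : ℝ) • (σ y β * (σ y β).transpose)

/-- basis vector -/
abbrev bv {N : ℕ} (i : Fin N) : EN N := EuclideanSpace.single i (1:ℝ)

section calculus
variable {N M : ℕ} {A : Set (EN M)} {f : EN N → EN M → EN N}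
    {σ : EN N → EN M → Matrix (Fin N) (Fin M) ℝ}
    {a : EN N → EN M → Matrix (Fin N) (Fin N) ℝ}

lemma hessEntry_eq (φ : EN N → ℝ) (x : EN N) (i j : Fin N) :
    hessEntry φ x i j = fderiv ℝ (fderiv ℝ φ) x (bv i) (bv j) := by
  unfold hessEntry
  rw [iteratedFDeriv_two_apply]
  simp

lemma gen_eq (φ : EN N → ℝ) (x : EN N) (β : EN M) :
    gen f a φ x β = fderiv ℝ φ x (f x β)
      + ∑ i, ∑ j, a x β i j * fderiv ℝ (fderiv ℝ φ) x (bv j) (bv i) := by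
  unfold gen traceTerm
  simp only [hessEntry_eq]
  rw [inner_gradient_right]
  simp

lemma gen_congr {φ ψ : EN N → ℝ} {x : EN N} (h : φ =ᶠ[𝓝 x] ψ) (β : EN M) :
    gen f a φ x β = gen f a ψ x β := by
  rw [gen_eq, gen_eq, h.fderiv_eq, (h.fderiv).fderiv_eq]

lemma gen_zero (x : EN N) (β : EN M) : gen f a (fun _ => (0:ℝ)) x β = 0 := by
  rw [gen_eq]
  simp

lemma ContDiff.d1 {φ : EN N → ℝ} (h : ContDiff ℝ 2 φ) : Differentiable ℝ φ :=
  h.differentiable (by norm_num)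

lemma ContDiff.d2 {φ : EN N → ℝ} (h : ContDiff ℝ 2 φ) : ContDiff ℝ 1 (fderiv ℝ φ) :=
  h.fderiv_right (by norm_num)

lemma gen_add {φ ψ : EN N → ℝ} (h : ContDiff ℝ 2 φ) (h' : ContDiff ℝ 2 ψ) (x : EN N) (β : EN M) :
    gen f a (fun y => φ y + ψ y) x β = gen f a φ x β + gen f a ψ x β := by
  have e1 : fderiv ℝ (fun y => φ y + ψ y) = fun y => fderiv ℝ φ y + fderiv ℝ ψ y := by
    ext1 y
    exact fderiv_fun_add (h.d1 y) (h'.d1 y)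
  rw [gen_eq, gen_eq, gen_eq, e1,
    fderiv_fun_add ((h.d2.differentiable (by norm_num)) x) ((h'.d2.differentiable (by norm_num)) x)]
  simp only [ContinuousLinearMap.add_apply, mul_add, Finset.sum_add_distrib]
  ring

lemma gen_const_sub {φ : EN N → ℝ} (h : ContDiff ℝ 2 φ) (c : ℝ) (x : EN N) (β : EN M) :
    gen f a (fun y => c - φ y) x β = - gen f a φ x β := by
  have e1 : fderiv ℝ (fun y => c - φ y) = fun y => - fderiv ℝ φ y := by
    ext1 y
    exact fderiv_const_sub c
  rw [gen_eq, gen_eq, e1, fderiv_fun_neg]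
  simp [Finset.sum_neg_distrib]
  ring

/-- carré du champ -/
def Gam (σ : EN N → EN M → Matrix (Fin N) (Fin M) ℝ) (φ : EN N → ℝ) (x : EN N) (β : EN M) : ℝ :=
  ∑ k, (∑ i, σ x β i k * fderiv ℝ φ x (bv i)) ^ 2

lemma Gam_nonneg (φ : EN N → ℝ) (x : EN N) (β : EN M) : 0 ≤ Gam σ φ x β :=
  Finset.sum_nonneg fun _ _ => sq_nonneg _

lemma gen_sq (H : Hyp A f σ a) {φ : EN N → ℝ} (h : ContDiff ℝ 2 φ) (x : EN N) (β : EN M) :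
    gen f a (fun y => φ y * φ y) x β = 2 * φ x * gen f a φ x β + Gam σ φ x β := by
  have e1 : fderiv ℝ (fun y => φ y * φ y) = fun y => (2 * φ y) • fderiv ℝ φ y := by
    ext1 y
    rw [fderiv_fun_mul (h.d1 y) (h.d1 y), ← add_smul]
    ring_nf
  have d1 : DifferentiableAt ℝ φ x := h.d1 x
  have d2 : DifferentiableAt ℝ (fderiv ℝ φ) x := (h.d2.differentiable (by norm_num)) x
  have e2 : ∀ v w, fderiv ℝ (fun y => (2 * φ y) • fderiv ℝ φ y) x v w
      = 2 * φ x * fderiv ℝ (fderiv ℝ φ) x v w + 2 * (fderiv ℝ φ x v * fderiv ℝ φ x w) := by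
    intro v w
    rw [fderiv_fun_smul (d1.const_mul 2) d2, fderiv_const_mul d1]
    simp
    ring
  rw [gen_eq, gen_eq, e1]
  simp only [e2]
  have e3 : Gam σ φ x β = ∑ i, ∑ j, a x β i j * (2 * (fderiv ℝ φ x (bv j) * fderiv ℝ φ x (bv i))) := by
    unfold Gam
    simp only [H.ha, Matrix.smul_apply, Matrix.mul_apply, Matrix.transpose_apply, smul_eq_mul, sq,
      Finset.sum_mul_sum, Finset.mul_sum, Finset.sum_mul]
    rw [Finset.sum_comm]
    refine Finset.sum_congr rfl fun i _ => ?_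
    rw [Finset.sum_comm]
    refine Finset.sum_congr rfl fun j _ => Finset.sum_congr rfl fun k _ => ?_
    ring
  rw [e3]
  simp only [mul_add, Finset.sum_add_distrib, Finset.mul_sum, ContinuousLinearMap.smul_apply,
    smul_eq_mul]
  rw [add_assoc]
  congr 2
  refine Finset.sum_congr rfl fun i _ => Finset.sum_congr rfl fun j _ => ?_
  ring

lemma Gam_comp {ψ : EN N → ℝ} (h : ContDiff ℝ 2 ψ) {g : ℝ → ℝ} {g' : ℝ} {x : EN N}
    (hg : HasDerivAt g g' (ψ x)) (β : EN M) :
    Gam σ (fun y => g (ψ y)) x β = g' ^ 2 * Gam σ ψ x β := by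
  have : fderiv ℝ (fun y => g (ψ y)) x = g' • fderiv ℝ ψ x :=
    (hg.comp_hasFDerivAt x (h.d1 x).hasFDerivAt).fderiv
  unfold Gam
  rw [this, Finset.mul_sum]
  refine Finset.sum_congr rfl fun k _ => ?_
  rw [← mul_pow, Finset.mul_sum]
  congr 1
  refine Finset.sum_congr rfl fun i _ => ?_
  simp
  ring

lemma Hyp.closed (H : Hyp A f σ a) : IsClosed ((univ : Set (EN N)) ×ˢ A) :=
  isClosed_univ.prod H.hA.isClosed

lemma a_cont (H : Hyp A f σ a) (i j : Fin N) :
    ContinuousOn (fun p : EN N × EN M => a p.1 p.2 i j) (univ ×ˢ A) := by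
  have hs : ∀ i k, ContinuousOn (fun p : EN N × EN M => σ p.1 p.2 i k) (univ ×ˢ A) := by
    intro i k
    exact (continuous_apply_apply i k).comp_continuousOn H.hσ
  have : (fun p : EN N × EN M => a p.1 p.2 i j)
      = fun p => (2⁻¹:ℝ) * ∑ k, σ p.1 p.2 i k * σ p.1 p.2 j k := by
    ext p
    simp [H.ha, Matrix.mul_apply]
  rw [this]
  exact continuousOn_const.mul (continuousOn_finsetSum _ fun k _ => (hs i k).mul (hs j k))

lemma gen_cont (H : Hyp A f σ a) {φ : EN N → ℝ} (h : ContDiff ℝ 2 φ) :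
    ContinuousOn (fun p : EN N × EN M => gen f a φ p.1 p.2) (univ ×ˢ A) := by
  simp only [gen_eq]
  have c1 : Continuous (fun p : EN N × EN M => fderiv ℝ φ p.1) :=
    (h.continuous_fderiv (by norm_num)).comp continuous_fst
  have c2 : Continuous (fun p : EN N × EN M => fderiv ℝ (fderiv ℝ φ) p.1) :=
    (h.d2.continuous_fderiv (by norm_num)).comp continuous_fst
  refine (c1.continuousOn.clm_apply H.hf).add ?_
  refine continuousOn_finsetSum _ fun i _ => continuousOn_finsetSum _ fun j _ => ?_
  refine (a_cont H i j).mul ?_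
  exact ((c2.clm_apply continuous_const).clm_apply continuous_const).continuousOn

lemma Gam_cont (H : Hyp A f σ a) {φ : EN N → ℝ} (h : ContDiff ℝ 2 φ) :
    ContinuousOn (fun p : EN N × EN M => Gam σ φ p.1 p.2) (univ ×ˢ A) := by
  have : (fun p : EN N × EN M => Gam σ φ p.1 p.2) = fun p =>
      gen f a (fun y => φ y * φ y) p.1 p.2 - 2 * φ p.1 * gen f a φ p.1 p.2 := by
    ext p
    rw [gen_sq H h]
    ring
  rw [this]
  refine (gen_cont H (h.mul h)).sub (ContinuousOn.mul ?_ (gen_cont H h))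
  exact (continuous_const.mul (h.continuous.comp continuous_fst)).continuousOn

lemma bdd_of_cont (H : Hyp A f σ a) {g : EN N → EN M → ℝ}
    (hg : ContinuousOn (fun p : EN N × EN M => g p.1 p.2) (univ ×ˢ A)) (R : ℝ) :
    ∃ C, 0 ≤ C ∧ ∀ x, ‖x‖ ≤ R → ∀ β ∈ A, |g x β| ≤ C := by
  have hk : IsCompact (Metric.closedBall (0 : EN N) R ×ˢ A) :=
    (isCompact_closedBall _ _).prod H.hA
  obtain ⟨C, hC⟩ := hk.exists_bound_of_continuousOn (hg.mono (prod_mono (subset_univ _) le_rfl))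
  refine ⟨max C 0, le_max_right _ _, fun x hx β hβ => le_max_of_le_left ?_⟩
  exact hC (x, β) ⟨by simpa using hx, hβ⟩

/-- measurable extension by zero of a function continuous on `univ ×ˢ A` -/
lemma meas_of_cont (H : Hyp A f σ a) {g : EN N → EN M → ℝ}
    (hg : ContinuousOn (fun p : EN N × EN M => g p.1 p.2) (univ ×ˢ A)) :
    ∃ G : EN N × EN M → ℝ, Measurable G ∧ ∀ x, ∀ β ∈ A, G (x, β) = g x β := by
  classical
  refine ⟨(univ ×ˢ A).piecewise (fun p => g p.1 p.2) (fun _ => 0), ?_, ?_⟩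
  · exact hg.measurable_piecewise continuousOn_const H.closed.measurableSet
  · intro x β hβ
    simp [Set.piecewise, hβ]

lemma f_growth (H : Hyp A f σ a) : ∃ C, 0 ≤ C ∧ ∀ x, ∀ β ∈ A, ‖f x β‖ ≤ C * (1 + ‖x‖) := by
  obtain ⟨C, hC⟩ := H.hlip
  obtain ⟨D, hD0, hD⟩ := bdd_of_cont H (g := fun x β => ‖f x β‖) H.hf.norm 0
  refine ⟨|C| + D, by positivity, fun x β hβ => ?_⟩
  have h1 := hC β hβ x 0
  have h2 := hD 0 (by simp) β hβ
  rw [abs_of_nonneg (norm_nonneg _)] at h2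
  have h3 : 0 ≤ mnorm (σ x β - σ 0 β) := Real.sqrt_nonneg _
  have h4 : ‖f x β‖ ≤ ‖f x β - f 0 β‖ + ‖f 0 β‖ := by
    simpa using norm_add_le (f x β - f 0 β) (f 0 β)
  simp only [sub_zero] at h1
  have h5 : C * ‖x‖ ≤ |C| * ‖x‖ := mul_le_mul_of_nonneg_right (le_abs_self C) (norm_nonneg _)
  have h6 : 0 ≤ D * ‖x‖ := by positivity
  have h7 : 0 ≤ |C| := abs_nonneg _
  nlinarith

/-- if all the coordinate functions have vanishing carré du champ then `gen` is first order. -/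
lemma gen_first_order (H : Hyp A f σ a) {x : EN N} {β : EN M}
    (h : ∀ i, ∃ ψ : EN N → ℝ, ψ =ᶠ[𝓝 x] (fun y => y i) ∧ Gam σ ψ x β = 0) (φ : EN N → ℝ) :
    gen f a φ x β = fderiv ℝ φ x (f x β) := by
  have hz : ∀ i k, σ x β i k = 0 := by
    intro i k
    obtain ⟨ψ, h1, h2⟩ := h i
    have h3 : fderiv ℝ ψ x = (EuclideanSpace.proj i : EN N →L[ℝ] ℝ) := by
      rw [h1.fderiv_eq]
      exact (EuclideanSpace.proj i : EN N →L[ℝ] ℝ).fderiv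
    unfold Gam at h2
    rw [Finset.sum_eq_zero_iff_of_nonneg (fun _ _ => sq_nonneg _)] at h2
    have h4 := h2 k (Finset.mem_univ _)
    rw [h3] at h4
    have h5 : ∑ i', σ x β i' k * (EuclideanSpace.proj i : EN N →L[ℝ] ℝ) (bv i') = σ x β i k := by
      rw [Finset.sum_eq_single i]
      · simp
      · intro b _ hb
        simp [hb.symm]
      · simp
    rw [h5] at h4
    exact pow_eq_zero_iff (two_ne_zero) |>.1 h4
  rw [gen_eq]
  simp [H.ha, Matrix.mul_apply, hz]

/-- quantitative continuity of `gen` in the test function -/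
lemma gen_diff (H : Hyp A f σ a) (R : ℝ) : ∃ C, 0 ≤ C ∧ ∀ φ ψ : EN N → ℝ, ∀ x, ‖x‖ ≤ R → ∀ β ∈ A,
    |gen f a φ x β - gen f a ψ x β| ≤ C * (‖fderiv ℝ φ x - fderiv ℝ ψ x‖
      + ‖fderiv ℝ (fderiv ℝ φ) x - fderiv ℝ (fderiv ℝ ψ) x‖) := by
  obtain ⟨C1, h10, h1⟩ := bdd_of_cont H (g := fun x β => ‖f x β‖) H.hf.norm R
  obtain ⟨C2, h20, h2⟩ := bdd_of_cont H (g := fun x β => ∑ i, ∑ j, |a x β i j|)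
    (continuousOn_finsetSum _ fun i _ => continuousOn_finsetSum _ fun j _ => (a_cont H i j).abs) R
  refine ⟨C1 + C2, by positivity, fun φ ψ x hx β hβ => ?_⟩
  have e1 := h1 x hx β hβ
  have e2 := h2 x hx β hβ
  rw [abs_of_nonneg (norm_nonneg _)] at e1
  rw [abs_of_nonneg (Finset.sum_nonneg fun i _ => Finset.sum_nonneg fun j _ => abs_nonneg _)] at e2
  rw [gen_eq, gen_eq]
  set P := fderiv ℝ φ x - fderiv ℝ ψ x with hP
  set Q := fderiv ℝ (fderiv ℝ φ) x - fderiv ℝ (fderiv ℝ ψ) x with hQ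
  have key : (fderiv ℝ φ x (f x β) + ∑ i, ∑ j, a x β i j * fderiv ℝ (fderiv ℝ φ) x (bv j) (bv i))
      - (fderiv ℝ ψ x (f x β) + ∑ i, ∑ j, a x β i j * fderiv ℝ (fderiv ℝ ψ) x (bv j) (bv i))
      = P (f x β) + ∑ i, ∑ j, a x β i j * Q (bv j) (bv i) := by
    simp only [hP, hQ, ContinuousLinearMap.sub_apply, mul_sub, Finset.sum_sub_distrib]
    ring
  rw [key]
  have k1 : |P (f x β)| ≤ C1 * ‖P‖ := by
    have := P.le_opNorm (f x β)
    rw [Real.norm_eq_abs] at this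
    nlinarith [norm_nonneg P]
  have k2 : |∑ i, ∑ j, a x β i j * Q (bv j) (bv i)| ≤ C2 * ‖Q‖ := by
    calc |∑ i, ∑ j, a x β i j * Q (bv j) (bv i)|
        ≤ ∑ i, ∑ j, |a x β i j| * ‖Q‖ := by
          refine (Finset.abs_sum_le_sum_abs _ _).trans (Finset.sum_le_sum fun i _ => ?_)
          refine (Finset.abs_sum_le_sum_abs _ _).trans (Finset.sum_le_sum fun j _ => ?_)
          rw [abs_mul]
          refine mul_le_mul_of_nonneg_left ?_ (abs_nonneg _)
          have := Q.le_opNorm₂ (bv j) (bv i)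
          simpa using this
      _ = (∑ i, ∑ j, |a x β i j|) * ‖Q‖ := by simp only [Finset.sum_mul]
      _ ≤ C2 * ‖Q‖ := by
          have h0 : 0 ≤ ‖Q‖ := ContinuousLinearMap.opNorm_nonneg Q
          gcongr
  have := abs_add_le (P (f x β)) (∑ i, ∑ j, a x β i j * Q (bv j) (bv i))
  nlinarith [norm_nonneg P, norm_nonneg Q]


/-- generator of a function vanishing near a point -/
lemma gen_eq_zero {φ : EN N → ℝ} {x : EN N} (h : φ =ᶠ[𝓝 x] fun _ => 0) (β : EN M) :
    gen f a φ x β = 0 := by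
  rw [gen_congr h, gen_zero]

lemma gen_far {φ : EN N → ℝ} {k : ℝ} (h : ∀ x, k < ‖x‖ → φ x = 0) {x : EN N} (hx : k < ‖x‖)
    (β : EN M) : gen f a φ x β = 0 := by
  refine gen_eq_zero ?_ β
  have : {y : EN N | k < ‖y‖} ∈ 𝓝 x := (isOpen_lt continuous_const continuous_norm).mem_nhds hx
  filter_upwards [this] with y hy using h y hy

lemma compact_far {φ : EN N → ℝ} (h : HasCompactSupport φ) : ∃ k : ℕ, ∀ x, (k:ℝ) < ‖x‖ → φ x = 0 := by
  obtain ⟨r, hr⟩ := h.isCompact.isBounded.subset_closedBall 0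
  obtain ⟨k, hk⟩ := exists_nat_gt r
  refine ⟨k, fun x hx => ?_⟩
  by_contra h0
  have := hr (subset_tsupport _ h0)
  simp at this
  linarith

lemma far_compact {φ : EN N → ℝ} {k : ℝ} (h : ∀ x, k < ‖x‖ → φ x = 0) : HasCompactSupport φ := by
  refine HasCompactSupport.intro (isCompact_closedBall (0:EN N) k) ?_
  intro x hx
  apply h
  simpa using hx

lemma gen_bdd (H : Hyp A f σ a) {φ : EN N → ℝ} (h : ContDiff ℝ 2 φ) (hc : HasCompactSupport φ) :
    ∃ C, 0 ≤ C ∧ ∀ x, ∀ β ∈ A, |gen f a φ x β| ≤ C := by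
  obtain ⟨k, hk⟩ := compact_far hc
  obtain ⟨C, h0, hC⟩ := bdd_of_cont H (gen_cont H h) k
  refine ⟨C, h0, fun x β hβ => ?_⟩
  by_cases hx : ‖x‖ ≤ k
  · exact hC x hx β hβ
  · rw [gen_far hk (not_le.1 hx)]
    simpa using h0

/-- countable dense subfamily -/
lemma exists_dense (H : Hyp A f σ a) (T : Set (EN N → ℝ))
    (hT : ∀ φ ∈ T, ContDiff ℝ 2 φ ∧ HasCompactSupport φ) : ∃ D ⊆ T, D.Countable ∧
    ∀ φ ∈ T, ∀ ε > 0, ∃ ψ ∈ D, ∀ x : EN N,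
      |φ x - ψ x| ≤ ε ∧ ∀ β ∈ A, |gen f a φ x β - gen f a ψ x β| ≤ ε := by
  have main : ∀ R : ℕ, ∃ D ⊆ T, D.Countable ∧
    ∀ φ ∈ T, (∀ x, (R:ℝ) < ‖x‖ → φ x = 0) → ∀ ε > 0, ∃ ψ ∈ D, ∀ x : EN N,
      |φ x - ψ x| ≤ ε ∧ ∀ β ∈ A, |gen f a φ x β - gen f a ψ x β| ≤ ε := by
    intro R
    obtain ⟨C, hC0, hC⟩ := gen_diff H R
    let B := Metric.closedBall (0 : EN N) R
    let V := ℝ × (EN N →L[ℝ] ℝ) × (EN N →L[ℝ] EN N →L[ℝ] ℝ)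
    haveI : CompactSpace B := isCompact_iff_compactSpace.1 (isCompact_closedBall _ _)
    let T' := {φ : EN N → ℝ // φ ∈ T ∧ (∀ x, (R:ℝ) < ‖x‖ → φ x = 0)}
    by_cases hne : Nonempty T'
    swap
    · refine ⟨∅, empty_subset _, countable_empty, fun φ h1 h2 => ?_⟩
      exact absurd ⟨⟨φ, h1, h2⟩⟩ hne
    let J : T' → C(B, V) := fun φ => ⟨fun x => (φ.1 x, fderiv ℝ φ.1 x, fderiv ℝ (fderiv ℝ φ.1) x), by
      have hφ := (hT _ φ.2.1).1
      have c1 := (hφ.continuous_fderiv (by norm_num))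
      have c2 := (hφ.d2.continuous_fderiv (by norm_num))
      have c0 := hφ.continuous
      fun_prop⟩
    obtain ⟨S, hSsub, hSc, hSd⟩ := TopologicalSpace.IsSeparable.exists_countable_dense_subset
      (s := range J) (TopologicalSpace.IsSeparable.of_separableSpace _)
    have hS' : ∀ s ∈ S, ∃ t, J t = s := fun s hs => hSsub hs
    choose! F hF using hS'
    refine ⟨(fun s => (F s).1) '' S, ?_, hSc.image _, ?_⟩
    · rintro _ ⟨s, _, rfl⟩
      exact (F s).2.1
    · intro φ hφ hφR ε hε
      have hmem : J ⟨φ, hφ, hφR⟩ ∈ closure S := hSd ⟨_, rfl⟩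
      have hε' : 0 < ε / (1 + 2 * C) := by positivity
      obtain ⟨s, hs, hd⟩ := (Metric.mem_closure_iff (α := C(B, ℝ × (EN N →L[ℝ] ℝ) × (EN N →L[ℝ] EN N →L[ℝ] ℝ)))).1 hmem _ hε'
      have hle : ε / (1 + 2 * C) ≤ ε := div_le_self hε.le (by linarith)
      refine ⟨_, ⟨s, hs, rfl⟩, fun x => ?_⟩
      beta_reduce
      by_cases hx : ‖x‖ ≤ R
      · have hxB : x ∈ B := by simpa [B] using hx
        rw [← hF s hs] at hd
        have h1 := (ContinuousMap.dist_apply_le_dist (f := J ⟨φ, hφ, hφR⟩) (g := J (F s)) ⟨x, hxB⟩).trans hd.le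
        have h2 : dist (φ x, fderiv ℝ φ x, fderiv ℝ (fderiv ℝ φ) x)
          ((F s).1 x, fderiv ℝ (F s).1 x, fderiv ℝ (fderiv ℝ (F s).1) x) ≤ ε / (1 + 2 * C) := h1
        rw [Prod.dist_eq, Prod.dist_eq, max_le_iff, max_le_iff] at h2
        obtain ⟨q1, q2, q3⟩ := h2
        simp only [Real.dist_eq, dist_eq_norm] at q1 q2 q3
        refine ⟨q1.trans hle, fun β hβ => (hC φ (F s).1 x hx β hβ).trans ?_⟩
        calc _ ≤ C * (ε / (1 + 2 * C) + ε / (1 + 2 * C)) := by gcongr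
          _ = ε * (2 * C / (1 + 2 * C)) := by ring
          _ ≤ ε * 1 := by
            gcongr
            rw [div_le_one (by positivity)]
            linarith
          _ = ε := mul_one _
      · rw [not_le] at hx
        rw [hφR x hx, (F s).2.2 x hx]
        refine ⟨by simpa using hε.le, fun β _ => ?_⟩
        rw [gen_far hφR hx, gen_far (F s).2.2 hx]
        simpa using hε.le
  choose D hD0 hD1 hD3 using main
  refine ⟨⋃ R, D R, iUnion_subset hD0, countable_iUnion hD1, ?_⟩
  intro φ hφ ε hε
  obtain ⟨R, hR⟩ := compact_far (hT φ hφ).2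
  obtain ⟨ψ, h1, h2⟩ := hD3 R φ hφ hR ε hε
  exact ⟨ψ, mem_iUnion.2 ⟨R, h1⟩, h2⟩

/-- smooth cutoff: one on the ball of radius `k`, zero off the ball of radius `k + 1` -/
lemma exists_cut (N : ℕ) (k : ℝ) (hk : 0 ≤ k) : ∃ χ : EN N → ℝ, ContDiff ℝ 2 χ ∧ (∀ x, 0 ≤ χ x) ∧
    (∀ x, χ x ≤ 1) ∧ (∀ x, ‖x‖ ≤ k + 1/2 → χ x = 1) ∧ ∀ x, k + 1 < ‖x‖ → χ x = 0 := by
  let b : ContDiffBump (0 : EN N) := ⟨k + 1/2, k + 1, by linarith, by linarith⟩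
  refine ⟨b, b.contDiff, fun x => b.nonneg, fun x => b.le_one, fun x hx => ?_, fun x hx => ?_⟩
  · exact b.one_of_mem_closedBall (by simpa only [Metric.mem_closedBall, dist_zero_right] using hx)
  · exact b.zero_of_le_dist (by simpa only [dist_zero_right] using hx.le)

end calculus


/-- a continuous injection of Baire space into the reals -/
lemma exists_baire_inj : ∃ e : (ℕ → ℕ) → ℝ, Continuous e ∧ Function.Injective e := by
  let e0 : (ℕ → ℕ) → (ℕ → ℕ → Bool) := fun β i j => decide (β i = j)
  have c0 : Continuous e0 := by
    refine continuous_pi fun i => continuous_pi fun j => ?_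
    exact (continuous_of_discreteTopology (f := fun m : ℕ => decide (m = j))).comp (continuous_apply i)
  have i0 : Function.Injective e0 := by
    intro β β' h
    ext i
    have := congrFun (congrFun h i) (β' i)
    simpa [e0] using this
  refine ⟨fun β => (cantorSetHomeomorphNatToBool.symm (cantorSpaceHomeomorphNatToCantorSpace.symm (e0 β))).1,
    ?_, ?_⟩
  · exact continuous_subtype_val.comp ((Homeomorph.continuous _).comp ((Homeomorph.continuous _).comp c0))
  · exact Subtype.val_injective.comp ((Homeomorph.injective _).comp ((Homeomorph.injective _).comp i0))

/-- Measurable selection up to a small exceptional set, with values in a compact set. -/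
lemma selection {Y W : Type*} [TopologicalSpace Y] [PolishSpace Y] [MeasurableSpace Y] [BorelSpace Y]
    [TopologicalSpace W] [PolishSpace W] [MeasurableSpace W] [BorelSpace W] [Nonempty W]
    (μ : Measure Y) [IsFiniteMeasure μ] (E : Set (Y × W)) (hE : MeasurableSet E)
    (hfib : ∀ᵐ y ∂μ, ∃ w, (y, w) ∈ E) (δ : ℝ≥0∞) (hδ : 0 < δ) :
    ∃ S, MeasurableSet S ∧ μ Sᶜ ≤ δ ∧ ∃ g : Y → W, Measurable g ∧
      (∃ K, IsCompact K ∧ ∀ y ∈ S, g y ∈ K) ∧ ∀ y ∈ S, (y, g y) ∈ E := by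
  classical
  have han : AnalyticSet E := hE.analyticSet
  rw [AnalyticSet] at han
  rcases han with rfl | ⟨γ, hγc, hγ⟩
  · refine ⟨∅, MeasurableSet.empty, ?_, fun _ => Classical.arbitrary W, measurable_const,
      ⟨∅, isCompact_empty, by simp⟩, by simp⟩
    have : ∀ᵐ y ∂μ, False := by
      filter_upwards [hfib] with y hy
      simpa using hy
    rw [ae_iff] at this
    simp at this
    simp [this]
  by_cases hδt : δ = ⊤
  · refine ⟨∅, MeasurableSet.empty, by simp [hδt], fun _ => Classical.arbitrary W, measurable_const,
      ⟨∅, isCompact_empty, by simp⟩, by simp⟩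
  let h : (ℕ → ℕ) → Y := fun β => (γ β).1
  have hc : Continuous h := continuous_fst.comp hγc
  have hfull : μ univ ≤ μ (range h) := by
    have : μ (range h)ᶜ = 0 := by
      refine measure_mono_null ?_ (ae_iff.1 hfib)
      intro y hy hw
      obtain ⟨w, hw⟩ := hw
      rw [← hγ] at hw
      obtain ⟨β, hβ⟩ := hw
      exact hy ⟨β, by simp [h, hβ]⟩
    calc μ univ = μ (range h ∪ (range h)ᶜ) := by simp
      _ ≤ μ (range h) + μ (range h)ᶜ := measure_union_le _ _
      _ = μ (range h) := by rw [this, add_zero]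
  let U : ℕ → (ℕ → ℕ) → Set (ℕ → ℕ) := fun n b => {β | ∀ i < n, β i ≤ b i}
  let T : ℕ → Type := fun n => {b : ℕ → ℕ // μ univ < μ (h '' U n b) + δ}
  have step : ∀ n (b : ℕ → ℕ), μ univ < μ (h '' U n b) + δ →
      ∃ m, μ univ < μ (h '' U (n+1) (Function.update b n m)) + δ := by
    intro n b hb
    let Bm : ℕ → Set (ℕ → ℕ) := fun m => U n b ∩ {β | β n ≤ m}
    have hU : U n b = ⋃ m, Bm m := by
      ext β
      simp only [Bm, mem_iUnion, mem_inter_iff, mem_setOf_eq]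
      exact ⟨fun hh => ⟨β n, hh, le_rfl⟩, fun ⟨_, hh, _⟩ => hh⟩
    have hmono : Monotone fun m => h '' Bm m := by
      intro m m' hm
      exact image_mono fun β hβ => ⟨hβ.1, le_trans hβ.2 hm⟩
    rw [hU, image_iUnion, hmono.measure_iUnion, ENNReal.iSup_add] at hb
    obtain ⟨m, hm⟩ := lt_iSup_iff.1 hb
    refine ⟨m, hm.trans_le ?_⟩
    gcongr
    intro β hβ i hi
    rcases Nat.lt_succ_iff_lt_or_eq.1 hi with h1 | h1
    · rw [Function.update_of_ne h1.ne]
      exact hβ.1 i h1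
    · subst h1
      simpa using hβ.2
  choose nxt hnxt using step
  let bs : (n : ℕ) → T n := fun n => Nat.rec (motive := T)
    ⟨fun _ => 0, by
      have : U 0 (fun _ => 0) = univ := by ext; simp [U]
      rw [this, image_univ]
      exact lt_of_le_of_lt hfull (ENNReal.lt_add_right (measure_ne_top _ _) hδ.ne')⟩
    (fun n b => ⟨Function.update b.1 n (nxt n b.1 b.2), hnxt n b.1 b.2⟩) n
  have hbs : ∀ n, (bs (n+1)).1 = Function.update (bs n).1 n (nxt n (bs n).1 (bs n).2) := fun n => rfl
  let b : ℕ → ℕ := fun i => (bs (i+1)).1 i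
  have hagree : ∀ n, ∀ i < n, (bs n).1 i = b i := by
    intro n
    induction n with
    | zero => intro i hi; omega
    | succ n ih =>
      intro i hi
      rcases Nat.lt_succ_iff_lt_or_eq.1 hi with h1 | h1
      · rw [hbs, Function.update_of_ne h1.ne, ih i h1]
      · subst h1; rfl
  have hUb : ∀ n, U n (bs n).1 = U n b := by
    intro n
    ext β
    simp only [U, mem_setOf_eq]
    exact forall₂_congr fun i hi => by rw [hagree n i hi]
  let K0 : Set (ℕ → ℕ) := {β | ∀ i, β i ≤ b i}
  have hK0 : IsCompact K0 := by
    have : K0 = Set.pi univ (fun i => Iic (b i)) := by ext; simp [K0, Pi.le_def]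
    rw [this]
    exact isCompact_univ_pi fun i => (finite_Iic _).isCompact
  let S : Set Y := h '' K0
  have hScl : IsClosed S := (hK0.image hc).isClosed
  have hSm : μ univ ≤ μ S + δ := by
    refine ENNReal.le_of_forall_pos_le_add ?_
    intro η hη _
    obtain ⟨O, hSO, hO, hμO⟩ := S.exists_isOpen_lt_add (μ := μ) (measure_ne_top _ _)
      (show (η : ℝ≥0∞) ≠ 0 by exact_mod_cast hη.ne')
    have : ∃ n, h '' U n b ⊆ O := by
      by_contra hcon
      push Not at hcon
      have hcon' : ∀ n, ∃ β, β ∈ U n b ∧ h β ∉ O := by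
        intro n
        obtain ⟨y, ⟨β, hβ, rfl⟩, hy⟩ := not_subset.1 (hcon n)
        exact ⟨β, hβ, hy⟩
      choose β hβ1 hβ2 using hcon'
      let β' : ℕ → ℕ → ℕ := fun n i => if i < n then β n i else 0
      have hβ' : ∀ n, β' n ∈ K0 := by
        intro n i
        by_cases hi : i < n
        · simp [β', hi]; exact hβ1 n i hi
        · simp [β', hi]
      obtain ⟨z, hz, ρ, hρ, hlim⟩ := hK0.tendsto_subseq hβ'
      have hlim2 : Tendsto (β ∘ ρ) atTop (𝓝 z) := by
        rw [tendsto_pi_nhds] at hlim ⊢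
        intro i
        refine (hlim i).congr' ?_
        filter_upwards [eventually_gt_atTop i] with n hn
        have : i < ρ n := hn.trans_le (hρ.id_le n)
        simp [β', this]
      have hz2 : h z ∈ O := hSO ⟨z, hz, rfl⟩
      have := ((hc.tendsto z).comp hlim2).eventually (hO.mem_nhds hz2)
      obtain ⟨n, hn⟩ := this.exists
      exact hβ2 _ hn
    obtain ⟨n, hn⟩ := this
    have h1 := (bs n).2
    rw [hUb] at h1
    calc μ univ ≤ μ (h '' U n b) + δ := h1.le
      _ ≤ μ O + δ := by gcongr
      _ ≤ (μ S + η) + δ := by gcongr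
      _ = μ S + δ + η := by ring
  obtain ⟨e, he, hei⟩ := exists_baire_inj
  have hemb : MeasurableEmbedding e := he.measurableEmbedding hei
  obtain ⟨inv, hinv, hinve⟩ := hemb.exists_measurable_extend measurable_id (fun _ => inferInstance)
  let I : Y → ℝ := fun y => if y ∈ S then sInf (e '' (K0 ∩ h ⁻¹' {y})) else 0
  have hatt : ∀ y ∈ S, ∃ β ∈ K0, h β = y ∧ e β = I y ∧ ∀ β' ∈ K0, h β' = y → I y ≤ e β' := by
    intro y hy
    have hcomp : IsCompact (K0 ∩ h ⁻¹' {y}) := hK0.inter_right (isClosed_singleton.preimage hc)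
    have hne : (e '' (K0 ∩ h ⁻¹' {y})).Nonempty := by
      obtain ⟨β, h1, h2⟩ := hy
      exact ⟨_, β, ⟨h1, h2⟩, rfl⟩
    have hcomp2 := hcomp.image he
    obtain ⟨β, ⟨h1, h2⟩, h3⟩ := hcomp2.sInf_mem hne
    refine ⟨β, h1, h2, by simp [I, hy, h3], fun β' h4 h5 => ?_⟩
    simp only [I, hy, if_true]
    exact csInf_le hcomp2.bddBelow ⟨β', ⟨h4, h5⟩, rfl⟩
  have hI : Measurable I := by
    refine measurable_of_Iic fun r => ?_
    have : I ⁻¹' Iic r = (h '' (K0 ∩ e ⁻¹' Iic r)) ∪ (Sᶜ ∩ {y | (0:ℝ) ≤ r}) := by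
      ext y
      by_cases hy : y ∈ S
      · obtain ⟨β, h1, h2, h3, h4⟩ := hatt y hy
        simp only [mem_preimage, mem_Iic, mem_union, mem_image, mem_inter_iff, mem_compl_iff, hy,
          not_true_eq_false, false_and, or_false]
        constructor
        · intro hr
          exact ⟨β, ⟨h1, h3.trans_le hr⟩, h2⟩
        · rintro ⟨β', ⟨h5, h6⟩, h7⟩
          exact (h4 β' h5 h7).trans h6
      · have : ¬ ∃ β, (β ∈ K0 ∧ e β ≤ r) ∧ h β = y := by
          rintro ⟨β, ⟨h1, _⟩, h2⟩
          exact hy ⟨β, h1, h2⟩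
        simp [I, hy, this]
    rw [this]
    refine MeasurableSet.union ?_ ?_
    · exact ((hK0.inter_right (isClosed_Iic.preimage he)).image hc).isClosed.measurableSet
    · exact hScl.measurableSet.compl.inter (MeasurableSet.const _)
  refine ⟨S, hScl.measurableSet, ?_, fun y => (γ (inv (I y))).2, ?_,
    ⟨(fun β => (γ β).2) '' K0, hK0.image (continuous_snd.comp hγc), ?_⟩, ?_⟩
  · rw [measure_compl hScl.measurableSet (measure_ne_top _ _)]
    exact tsub_le_iff_left.2 hSm
  · exact (continuous_snd.comp hγc).measurable.comp (hinv.comp hI)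
  · intro y hy
    obtain ⟨β, h1, h2, h3, h4⟩ := hatt y hy
    refine ⟨β, h1, ?_⟩
    have : inv (I y) = β := by rw [← h3]; exact congrFun hinve β
    beta_reduce
    rw [this]
  · intro y hy
    obtain ⟨β, h1, h2, h3, h4⟩ := hatt y hy
    have : inv (I y) = β := by rw [← h3]; exact congrFun hinve β
    rw [← hγ]
    refine ⟨β, ?_⟩
    beta_reduce
    rw [this]
    exact Prod.ext h2 rfl


section pre
variable {N M : ℕ} {A : Set (EN M)} {f : EN N → EN M → EN N}
    {σ : EN N → EN M → Matrix (Fin N) (Fin M) ℝ}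
    {a : EN N → EN M → Matrix (Fin N) (Fin N) ℝ} {Ω : Type*}

/-- path integral -/
def Ip (g : EN N → EN M → ℝ) (X : ℝ → Ω → EN N) (α : ℝ → Ω → EN M) (s t : ℝ) (ω : Ω) : ℝ :=
  ∫ r in Ioc s t, g (X r ω) (α r ω)

/-- the martingale process attached to a test function -/
def Mp (f : EN N → EN M → EN N) (a : EN N → EN M → Matrix (Fin N) (Fin N) ℝ) (φ : EN N → ℝ)
    (X : ℝ → Ω → EN N) (α : ℝ → Ω → EN M) (t : ℝ) (ω : Ω) : ℝ :=
  φ (X t ω) - Ip (gen f a φ) X α 0 t ω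

/-- measurability part of a control -/
structure PathC [mΩ : MeasurableSpace Ω] (A : Set (EN M)) (F : Filtration ℝ mΩ)
    (X : ℝ → Ω → EN N) (α : ℝ → Ω → EN M) : Prop where
  X_cont : ∀ ω, Continuous fun t => X t ω
  X_prog : ProgMeasurable F X
  α_prog : ProgMeasurable F α
  α_mem : ∀ t ω, α t ω ∈ A

/-- martingale property for compactly supported test functions -/
def MartC [mΩ : MeasurableSpace Ω] (f : EN N → EN M → EN N)
    (a : EN N → EN M → Matrix (Fin N) (Fin N) ℝ) (P : Measure Ω) (F : Filtration ℝ mΩ)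
    (X : ℝ → Ω → EN N) (α : ℝ → Ω → EN M) : Prop :=
  ∀ φ : EN N → ℝ, ContDiff ℝ 2 φ → HasCompactSupport φ → ∀ s t : ℝ, 0 ≤ s → s ≤ t →
    ∀ G, MeasurableSet[F s] G → ∫ ω in G, Mp f a φ X α t ω ∂P = ∫ ω in G, Mp f a φ X α s ω ∂P

variable [mΩ : MeasurableSpace Ω] {P : Measure Ω} [IsProbabilityMeasure P] {F : Filtration ℝ mΩ}
    {X : ℝ → Ω → EN N} {α : ℝ → Ω → EN M}

lemma PathC.meas_min (hP : PathC A F X α) (H : Hyp A f σ a) {g : EN N → EN M → ℝ}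
    (hg : ContinuousOn (fun p : EN N × EN M => g p.1 p.2) (univ ×ˢ A)) (T : ℝ) :
    Measurable[(inferInstance : MeasurableSpace ℝ).prod (F T)]
      (fun p : ℝ × Ω => g (X (min p.1 T) p.2) (α (min p.1 T) p.2)) := by
  obtain ⟨G, hG, hGe⟩ := meas_of_cont H hg
  have e1 : Measurable[(inferInstance : MeasurableSpace (Iic T)).prod (F T)]
      (fun p : Iic T × Ω => X p.1 p.2) := (hP.X_prog T).measurable
  have e2 : Measurable[(inferInstance : MeasurableSpace (Iic T)).prod (F T)]
      (fun p : Iic T × Ω => α p.1 p.2) := (hP.α_prog T).measurable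
  have e3 : @Measurable _ _ ((inferInstance : MeasurableSpace (Iic T)).prod (F T)) _
      (fun p : Iic T × Ω => g (X p.1 p.2) (α p.1 p.2)) := by
    have : (fun p : Iic T × Ω => g (X p.1 p.2) (α p.1 p.2))
        = fun p => G (X p.1 p.2, α p.1 p.2) := by
      ext p
      rw [hGe _ _ (hP.α_mem _ _)]
    rw [this]
    exact hG.comp (e1.prodMk e2)
  have e4 : @Measurable _ _ ((inferInstance : MeasurableSpace ℝ).prod (F T))
      ((inferInstance : MeasurableSpace (Iic T)).prod (F T))
      (fun p : ℝ × Ω => ((⟨min p.1 T, mem_Iic.2 (min_le_right _ _)⟩ : Iic T), p.2)) := by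
    letI := F T
    refine Measurable.prodMk ?_ measurable_snd
    exact (measurable_fst.min measurable_const).subtype_mk
  exact e3.comp e4

lemma PathC.meas_joint (hP : PathC A F X α) (H : Hyp A f σ a) {g : EN N → EN M → ℝ}
    (hg : ContinuousOn (fun p : EN N × EN M => g p.1 p.2) (univ ×ˢ A)) :
    Measurable (fun p : ℝ × Ω => g (X p.1 p.2) (α p.1 p.2)) := by
  refine measurable_of_tendsto_metrizable (f := fun (n : ℕ) (p : ℝ × Ω) =>
    g (X (min p.1 n) p.2) (α (min p.1 n) p.2)) (fun n => ?_) ?_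
  · refine (hP.meas_min H hg n).mono ?_ le_rfl
    exact sup_le_sup le_rfl (MeasurableSpace.comap_mono (F.le _))
  · rw [tendsto_pi_nhds]
    intro p
    refine tendsto_const_nhds.congr' ?_
    obtain ⟨n0, hn0⟩ := exists_nat_gt p.1
    filter_upwards [eventually_ge_atTop n0] with n hn
    have : p.1 ≤ n := hn0.le.trans (by exact_mod_cast hn)
    rw [min_eq_left this]

lemma PathC.meas_path (hP : PathC A F X α) (H : Hyp A f σ a) {g : EN N → EN M → ℝ}
    (hg : ContinuousOn (fun p : EN N × EN M => g p.1 p.2) (univ ×ˢ A)) (ω : Ω) :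
    Measurable (fun r : ℝ => g (X r ω) (α r ω)) :=
  (hP.meas_joint H hg).comp (measurable_id.prodMk measurable_const)

/-- boundedness along a path on compact time intervals -/
lemma PathC.bdd_path (hP : PathC A F X α) (H : Hyp A f σ a) {g : EN N → EN M → ℝ}
    (hg : ContinuousOn (fun p : EN N × EN M => g p.1 p.2) (univ ×ˢ A)) (ω : Ω) (s t : ℝ) :
    ∃ C, 0 ≤ C ∧ ∀ r ∈ Icc s t, |g (X r ω) (α r ω)| ≤ C := by
  obtain ⟨R, hR⟩ := (isCompact_Icc (a := s) (b := t)).exists_bound_of_continuousOn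
    (hP.X_cont ω).continuousOn
  obtain ⟨C, h0, hC⟩ := bdd_of_cont H hg R
  exact ⟨C, h0, fun r hr => hC _ (hR r hr) _ (hP.α_mem _ _)⟩

lemma PathC.intOn (hP : PathC A F X α) (H : Hyp A f σ a) {g : EN N → EN M → ℝ}
    (hg : ContinuousOn (fun p : EN N × EN M => g p.1 p.2) (univ ×ˢ A)) (ω : Ω) (s t : ℝ) :
    IntegrableOn (fun r : ℝ => g (X r ω) (α r ω)) (Ioc s t) := by
  obtain ⟨C, h0, hC⟩ := hP.bdd_path H hg ω s t
  refine IntegrableOn.of_bound (C := C) (by simp) (hP.meas_path H hg ω).aestronglyMeasurable ?_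
  filter_upwards [ae_restrict_mem measurableSet_Ioc] with r hr
  exact hC r (Ioc_subset_Icc_self hr)

lemma PathC.Ip_add (hP : PathC A F X α) (H : Hyp A f σ a) {g : EN N → EN M → ℝ}
    (hg : ContinuousOn (fun p : EN N × EN M => g p.1 p.2) (univ ×ˢ A)) (ω : Ω) {s t u : ℝ}
    (h1 : s ≤ t) (h2 : t ≤ u) : Ip g X α s t ω + Ip g X α t u ω = Ip g X α s u ω := by
  unfold Ip
  rw [← Ioc_union_Ioc_eq_Ioc h1 h2]
  rw [setIntegral_union (Set.Ioc_disjoint_Ioc_of_le le_rfl) measurableSet_Ioc (hP.intOn H hg ω _ _) (hP.intOn H hg ω _ _)]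

lemma PathC.Ip_meas (hP : PathC A F X α) (H : Hyp A f σ a) {g : EN N → EN M → ℝ}
    (hg : ContinuousOn (fun p : EN N × EN M => g p.1 p.2) (univ ×ˢ A)) (s t : ℝ) :
    Measurable[F t] (Ip g X α s t) := by
  have h1 := (hP.meas_min H hg t)
  have h2 : Ip g X α s t = fun ω => ∫ r in Ioc s t, g (X (min r t) ω) (α (min r t) ω) := by
    ext ω
    unfold Ip
    refine setIntegral_congr_fun measurableSet_Ioc fun r hr => ?_
    simp only [min_eq_left hr.2]
  rw [h2]
  letI := F t
  exact (StronglyMeasurable.integral_prod_left' (μ := volume.restrict (Ioc s t)) h1.stronglyMeasurable).measurable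

lemma Ip_bdd {g : EN N → EN M → ℝ} {C : ℝ} (hα : ∀ t ω, α t ω ∈ A) (hC : ∀ x, ∀ β ∈ A, |g x β| ≤ C)
    (ω : Ω) {s t : ℝ} (hst : s ≤ t) : |Ip g X α s t ω| ≤ C * (t - s) := by
  have := norm_setIntegral_le_of_norm_le_const (μ := volume) (s := Ioc s t) (C := C)
    (f := fun r => g (X r ω) (α r ω)) (by simp) (fun r _ => hC _ _ (hα _ _))
  simpa [Ip, Measure.real, ENNReal.toReal_ofReal (sub_nonneg.2 hst)] using this

lemma PathC.X_meas (hP : PathC A F X α) (t : ℝ) : Measurable[F t] (X t) :=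
  ((ProgMeasurable.stronglyAdapted hP.X_prog) t).measurable

lemma PathC.Mp_meas (hP : PathC A F X α) (H : Hyp A f σ a) {φ : EN N → ℝ} (h : ContDiff ℝ 2 φ)
    (t : ℝ) : Measurable[F t] (Mp f a φ X α t) := by
  have h1 : Measurable[F t] (fun ω => φ (X t ω)) := h.continuous.measurable.comp (hP.X_meas t)
  have h2 := hP.Ip_meas H (gen_cont H h) 0 t
  letI := F t
  exact h1.sub h2

lemma PathC.Mp_bdd (hP : PathC A F X α) (H : Hyp A f σ a) {φ : EN N → ℝ} (h : ContDiff ℝ 2 φ)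
    (hc : HasCompactSupport φ) : ∃ C, 0 ≤ C ∧ ∀ t, 0 ≤ t → ∀ ω, |Mp f a φ X α t ω| ≤ C * (1 + t) := by
  obtain ⟨C, h0, hC⟩ := gen_bdd H h hc
  obtain ⟨D, hD⟩ := hc.exists_bound_of_continuous h.continuous
  have hD0 : 0 ≤ D := (norm_nonneg _).trans (hD 0)
  refine ⟨C + D, by positivity, fun t ht ω => ?_⟩
  have h1 := Ip_bdd (X := X) hP.α_mem hC ω ht
  have h2 := hD (X t ω)
  rw [Real.norm_eq_abs] at h2
  have h3 := abs_sub (φ (X t ω)) (Ip (gen f a φ) X α 0 t ω)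
  unfold Mp
  have : 0 ≤ D * t := by positivity
  nlinarith

lemma PathC.Mp_int (hP : PathC A F X α) (H : Hyp A f σ a) {φ : EN N → ℝ} (h : ContDiff ℝ 2 φ)
    (hc : HasCompactSupport φ) {t : ℝ} (ht : 0 ≤ t) : Integrable (Mp f a φ X α t) P := by
  obtain ⟨C, h0, hC⟩ := hP.Mp_bdd H h hc
  exact Integrable.of_bound ((hP.Mp_meas H h t).mono (F.le t) le_rfl).aestronglyMeasurable _
    (ae_of_all _ (hC t ht))

lemma PathC.mart_cond (hP : PathC A F X α) (H : Hyp A f σ a) {φ : EN N → ℝ} (h : ContDiff ℝ 2 φ)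
    {s t : ℝ} 
    (i1 : Integrable (Mp f a φ X α s) P) (i2 : Integrable (Mp f a φ X α t) P)
    (hm : ∀ G, MeasurableSet[F s] G → ∫ ω in G, Mp f a φ X α t ω ∂P = ∫ ω in G, Mp f a φ X α s ω ∂P) :
    P[Mp f a φ X α t | F s] =ᵐ[P] Mp f a φ X α s := by
  symm
  refine ae_eq_condExp_of_forall_setIntegral_eq (F.le s) i2
    (fun G _ _ => i1.integrableOn) (fun G hG _ => (hm G hG).symm) ?_
  exact (hP.Mp_meas H h s).stronglyMeasurable.aestronglyMeasurable

lemma PathC.mart_weight (hP : PathC A F X α) (H : Hyp A f σ a) (hM : MartC f a P F X α)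
    {φ : EN N → ℝ} (h : ContDiff ℝ 2 φ) (hc : HasCompactSupport φ) {s t : ℝ} (hs : 0 ≤ s)
    (hst : s ≤ t) {w : Ω → ℝ} (hw : Measurable[F s] w) {B : ℝ} (hB : ∀ ω, |w ω| ≤ B) :
    ∫ ω, w ω * (Mp f a φ X α t ω - Mp f a φ X α s ω) ∂P = 0 := by
  have i1 := hP.Mp_int (P := P) H h hc hs
  have i2 := hP.Mp_int (P := P) H h hc (hs.trans hst)
  have hce := hP.mart_cond H h i1 i2 (hM φ h hc s t hs hst)
  have hwm : AEStronglyMeasurable w P := (hw.mono (F.le s) le_rfl).aestronglyMeasurable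
  have j2 : Integrable (w * Mp f a φ X α t) P := i2.bdd_mul hwm (ae_of_all _ hB)
  have j1 : Integrable (w * Mp f a φ X α s) P := i1.bdd_mul hwm (ae_of_all _ hB)
  have k := condExp_mul_of_stronglyMeasurable_left (m := F s) hw.stronglyMeasurable j2 i2
  have e1 : ∫ ω, (w * Mp f a φ X α t) ω ∂P = ∫ ω, (w * Mp f a φ X α s) ω ∂P := by
    rw [← integral_condExp (F.le s)]
    refine integral_congr_ae ?_
    filter_upwards [k, hce] with ω h1 h2
    rw [h1]
    simp [h2]
  have e2 : (fun ω => w ω * (Mp f a φ X α t ω - Mp f a φ X α s ω))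
    = fun ω => (w * Mp f a φ X α t) ω - (w * Mp f a φ X α s) ω := by
    ext ω
    simp [mul_sub]
  rw [e2, integral_sub j2 j1, e1, sub_self]

end pre


section qv
variable {N M : ℕ} {A : Set (EN M)} {f : EN N → EN M → EN N}
    {σ : EN N → EN M → Matrix (Fin N) (Fin M) ℝ}
    {a : EN N → EN M → Matrix (Fin N) (Fin N) ℝ} {Ω : Type*}
    [mΩ : MeasurableSpace Ω] {P : Measure Ω} [IsProbabilityMeasure P] {F : Filtration ℝ mΩ}
    {X : ℝ → Ω → EN N} {α : ℝ → Ω → EN M}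

lemma PathC.Mp_sub (hP : PathC A F X α) (H : Hyp A f σ a) {φ : EN N → ℝ} (h : ContDiff ℝ 2 φ)
    {s u : ℝ} (hs : 0 ≤ s) (hsu : s ≤ u) (ω : Ω) :
    Mp f a φ X α u ω - Mp f a φ X α s ω = φ (X u ω) - φ (X s ω) - Ip (gen f a φ) X α s u ω := by
  unfold Mp
  rw [← hP.Ip_add H (gen_cont H h) ω hs hsu]
  ring

/-- approximate quadratic variation identity -/
lemma PathC.qv (hP : PathC A F X α) (H : Hyp A f σ a) (hM : MartC f a P F X α)
    {φ : EN N → ℝ} (h : ContDiff ℝ 2 φ) (hc : HasCompactSupport φ) {K : ℝ}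
    (hK : ∀ x, ∀ β ∈ A, |gen f a φ x β| ≤ K) {s u : ℝ} (hs : 0 ≤ s)
    (hsu : s ≤ u) {w : Ω → ℝ} (hw : Measurable[F s] w) {B : ℝ} (hw0 : ∀ ω, 0 ≤ w ω)
    (hB : ∀ ω, w ω ≤ B) :
    |∫ ω, w ω * (Mp f a φ X α u ω - Mp f a φ X α s ω) ^ 2 ∂P
      - ∫ ω, w ω * Ip (Gam σ φ) X α s u ω ∂P| ≤ 3 * K ^ 2 * (u - s) ^ 2 * ∫ ω, w ω ∂P := by
  have hu : 0 ≤ u := hs.trans hsu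
  have gc := gen_cont H h
  have Gc := Gam_cont H h
  have φgc : ContinuousOn (fun p : EN N × EN M => φ p.1 * gen f a φ p.1 p.2) (univ ×ˢ A) :=
    (h.continuous.comp continuous_fst).continuousOn.mul gc
  obtain ⟨D, hD⟩ := hc.exists_bound_of_continuous h.continuous
  simp only [Real.norm_eq_abs] at hD
  have hD0 : 0 ≤ D := (abs_nonneg _).trans (hD 0)
  obtain ⟨KG, hKG0, hKG⟩ : ∃ C, 0 ≤ C ∧ ∀ x, ∀ β ∈ A, |Gam σ φ x β| ≤ C := by
    obtain ⟨C1, h1, h2⟩ := gen_bdd H (h.mul h) hc.mul_right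
    obtain ⟨C2, h3, h4⟩ := gen_bdd H h hc
    refine ⟨C1 + 2 * D * C2, by positivity, fun x β hβ => ?_⟩
    have e := gen_sq H h x β
    have e1 := h2 x β hβ
    have e2 := h4 x β hβ
    have e3 : Gam σ φ x β = gen f a (fun y => φ y * φ y) x β - 2 * (φ x * gen f a φ x β) := by
      rw [e]; ring
    rw [e3]
    refine (abs_sub _ _).trans ?_
    rw [abs_mul 2, abs_mul (φ x)]
    have : |φ x| * |gen f a φ x β| ≤ D * C2 := mul_le_mul (hD x) e2 (abs_nonneg _) hD0
    have e5 : |(2:ℝ)| = 2 := by norm_num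
    rw [e5]
    have e6 : |gen f a (fun y => φ y * φ y) x β| ≤ C1 := e1
    nlinarith
  have hwB : ∀ ω, |w ω| ≤ B := fun ω => by rw [abs_of_nonneg (hw0 ω)]; exact hB ω
  have hwm : Measurable w := hw.mono (F.le s) le_rfl
  have hB0 : 0 ≤ B := by
    obtain ⟨ω⟩ : Nonempty Ω := P.nonempty_of_neZero
    exact (hw0 ω).trans (hB ω)
  have Xm : ∀ t, Measurable (X t) := fun t => (hP.X_meas t).mono (F.le t) le_rfl
  have φm : ∀ t, Measurable fun ω => φ (X t ω) := fun t => h.continuous.measurable.comp (Xm t)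
  have Im : ∀ {g : EN N → EN M → ℝ}, ContinuousOn (fun p : EN N × EN M => g p.1 p.2) (univ ×ˢ A) →
    ∀ s t, Measurable (Ip g X α s t) := fun hg s t => (hP.Ip_meas H hg s t).mono (F.le t) le_rfl
  -- boundedness
  have hgK : ∀ ω r t, r ≤ t → |Ip (gen f a φ) X α r t ω| ≤ K * (t - r) := fun ω r t hrt =>
    Ip_bdd hP.α_mem hK ω hrt
  -- names
  let G : Ω → ℝ := Ip (gen f a φ) X α s u
  let Q : Ω → ℝ := Ip (fun x β => φ x * gen f a φ x β) X α s u
  let Γ : Ω → ℝ := Ip (Gam σ φ) X α s u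
  have hΔ : ∀ ω, Mp f a φ X α u ω - Mp f a φ X α s ω = φ (X u ω) - φ (X s ω) - G ω :=
    fun ω => hP.Mp_sub H h hs hsu ω
  have K0 : 0 ≤ K := by
    obtain ⟨ω⟩ : Nonempty Ω := P.nonempty_of_neZero
    exact (abs_nonneg _).trans (hK (X 0 ω) _ (hP.α_mem 0 ω))
  have ib : ∀ {g : Ω → ℝ} (C : ℝ), Measurable g → (∀ ω, |g ω| ≤ C) → Integrable g P :=
    fun C hg hb => Integrable.of_bound hg.aestronglyMeasurable C (ae_of_all _ hb)
  have Gb : ∀ ω, |G ω| ≤ K * (u - s) := fun ω => hgK ω s u hsu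
  have Γb : ∀ ω, |Γ ω| ≤ KG * (u - s) := fun ω => Ip_bdd hP.α_mem hKG ω hsu
  have Qb : ∀ ω, |Q ω| ≤ (D * K) * (u - s) := fun ω => Ip_bdd hP.α_mem (fun x β hβ => by
    rw [abs_mul]; exact mul_le_mul (hD x) (hK x β hβ) (abs_nonneg _) hD0) ω hsu
  have wb : ∀ {g : Ω → ℝ} {C : ℝ}, (∀ ω, |g ω| ≤ C) → ∀ ω, |w ω * g ω| ≤ B * C := by
    intro g C hg ω
    rw [abs_mul]
    exact mul_le_mul (hwB ω) (hg ω) (abs_nonneg _) hB0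
  have fb : ∀ {g : Ω → ℝ} {C : ℝ} (t : ℝ), (∀ ω, |g ω| ≤ C) → ∀ ω, |φ (X t ω) * g ω| ≤ D * C := by
    intro g C t hg ω
    rw [abs_mul]
    exact mul_le_mul (hD _) (hg ω) (abs_nonneg _) hD0
  -- (i)
  have s1 : ∫ ω, w ω * (φ (X s ω) * (φ (X u ω) - φ (X s ω) - G ω)) ∂P = 0 := by
    have := hP.mart_weight H hM h hc hs hsu (w := fun ω => w ω * φ (X s ω))
      (by
        have h2 : Measurable[F s] (fun ω => φ (X s ω)) := h.continuous.measurable.comp (hP.X_meas s)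
        letI := F s
        exact hw.mul h2) (wb (fun ω => hD _))
    rw [← this]
    refine integral_congr_ae (ae_of_all _ fun ω => ?_)
    simp only [hΔ]
    ring
  -- (ii)
  have s2 : ∫ ω, w ω * (φ (X u ω) ^ 2 - φ (X s ω) ^ 2 - (2 * Q ω + Γ ω)) ∂P = 0 := by
    have := hP.mart_weight H hM (h.mul h) hc.mul_right hs hsu hw hwB
    rw [← this]
    refine integral_congr_ae (ae_of_all _ fun ω => ?_)
    beta_reduce
    rw [hP.Mp_sub H (h.mul h) hs hsu ω]
    have : Ip (gen f a (fun x => φ x * φ x)) X α s u ω = 2 * Q ω + Γ ω := by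
      simp only [Q, Γ, Ip]
      have j1 : IntegrableOn (fun r : ℝ => φ (X r ω) * gen f a φ (X r ω) (α r ω)) (Ioc s u) :=
        hP.intOn H (g := fun x β => φ x * gen f a φ x β) φgc ω s u
      rw [← integral_const_mul, ← integral_add (j1.const_mul 2) (hP.intOn H Gc ω s u)]
      refine integral_congr_ae (ae_of_all _ fun r => ?_)
      have := gen_sq H h (X r ω) (α r ω)
      beta_reduce
      rw [← mul_assoc, ← this]
    rw [this]
    ring
  -- (iii)
  have jm : Measurable (fun p : ℝ × Ω => gen f a φ (X p.1 p.2) (α p.1 p.2)) := hP.meas_joint H gc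
  have jφ : Measurable (fun p : ℝ × Ω => φ (X p.1 p.2)) :=
    hP.meas_joint H (g := fun x _ => φ x) (h.continuous.comp continuous_fst).continuousOn
  have s3 : |∫ ω, w ω * (φ (X u ω) * G ω - Q ω) ∂P| ≤ K ^ 2 * (u - s) ^ 2 * ∫ ω, w ω ∂P := by
    have e1 : ∀ ω, w ω * (φ (X u ω) * G ω - Q ω) = ∫ r in Ioc s u,
        w ω * (gen f a φ (X r ω) (α r ω) * (φ (X u ω) - φ (X r ω))) := by
      intro ω
      rw [integral_const_mul]
      congr 1
      simp only [G, Q, Ip]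
      have j1 : IntegrableOn (fun r : ℝ => φ (X r ω) * gen f a φ (X r ω) (α r ω)) (Ioc s u) :=
        hP.intOn H (g := fun x β => φ x * gen f a φ x β) φgc ω s u
      rw [← integral_const_mul, ← integral_sub ((hP.intOn H gc ω s u).const_mul _) j1]
      refine integral_congr_ae (ae_of_all _ fun r => ?_)
      beta_reduce
      ring
    simp_rw [e1]
    rw [integral_integral_swap]
    swap
    · refine Integrable.of_bound (C := B * (K * (D + D))) ?_ (ae_of_all _ ?_)
      · refine Measurable.aestronglyMeasurable ?_
        refine (hwm.comp measurable_fst).mul ?_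
        refine (jm.comp measurable_swap).mul (((φm u).comp measurable_fst).sub (jφ.comp measurable_swap))
      · rintro ⟨ω, r⟩
        simp only [Function.uncurry, Real.norm_eq_abs]
        rw [abs_mul, abs_mul]
        refine mul_le_mul (hwB ω) (mul_le_mul (hK _ _ (hP.α_mem _ _)) ?_ (abs_nonneg _) K0)
          (by positivity) hB0
        exact (abs_sub _ _).trans (add_le_add (hD _) (hD _))
    have e2 : ∀ r ∈ Ioc s u, ‖∫ ω, w ω * (gen f a φ (X r ω) (α r ω) * (φ (X u ω) - φ (X r ω))) ∂P‖
        ≤ K ^ 2 * (u - s) * ∫ ω, w ω ∂P := by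
      intro r hr
      have hr0 : 0 ≤ r := hs.trans hr.1.le
      have gm : Measurable[F r] (fun ω => gen f a φ (X r ω) (α r ω)) := by
        have h1 := hP.meas_min H gc r
        have h2 : Measurable[F r, (inferInstance : MeasurableSpace ℝ).prod (F r)]
            (fun ω : Ω => ((r : ℝ), ω)) := by
          letI := F r
          exact measurable_prodMk_left
        have h3 := h1.comp h2
        simpa [Function.comp_def] using h3
      have hwr : Measurable[F r] (fun ω => w ω * gen f a φ (X r ω) (α r ω)) := by
        have hw' := hw.mono (F.mono hr.1.le) le_rfl
        letI := F r
        exact hw'.mul gm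
      have := hP.mart_weight H hM h hc hr0 hr.2 hwr
        (wb (fun ω => hK _ _ (hP.α_mem _ _)))
      have e3 : ∫ ω, w ω * (gen f a φ (X r ω) (α r ω) * (φ (X u ω) - φ (X r ω))) ∂P
          = ∫ ω, w ω * gen f a φ (X r ω) (α r ω) * Ip (gen f a φ) X α r u ω ∂P := by
        rw [← sub_eq_zero, ← integral_sub, ← this]
        · refine integral_congr_ae (ae_of_all _ fun ω => ?_)
          beta_reduce
          rw [hP.Mp_sub H h hr0 hr.2 ω]
          ring
        · refine ib (B * (K * (D + D))) (hwm.mul ((gm.mono (F.le r) le_rfl).mul ((φm u).sub (φm r)))) ?_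
          refine wb fun ω => ?_
          rw [abs_mul]
          exact mul_le_mul (hK _ _ (hP.α_mem _ _)) ((abs_sub _ _).trans (add_le_add (hD _) (hD _)))
            (abs_nonneg _) K0
        · refine ib (B * K * (K * (u - r))) ((hwr.mono (F.le r) le_rfl).mul (Im gc r u)) ?_
          intro ω
          rw [abs_mul]
          exact mul_le_mul (wb (fun ω => hK _ _ (hP.α_mem r ω)) ω) (hgK ω r u hr.2) (abs_nonneg _) (by positivity)
      rw [e3, ← integral_const_mul]
      refine norm_integral_le_of_norm_le ((ib B hwm hwB).const_mul _) (ae_of_all _ fun ω => ?_)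
      rw [Real.norm_eq_abs, abs_mul, abs_mul, abs_of_nonneg (hw0 ω)]
      have q1 := hK (X r ω) _ (hP.α_mem r ω)
      have q2 : |Ip (gen f a φ) X α r u ω| ≤ K * (u - s) :=
        (hgK ω r u hr.2).trans (mul_le_mul_of_nonneg_left (by linarith [hr.1]) K0)
      calc w ω * |gen f a φ (X r ω) (α r ω)| * |Ip (gen f a φ) X α r u ω|
          ≤ w ω * K * (K * (u - s)) := by
            have := hw0 ω
            have := sub_nonneg.2 hsu
            gcongr
        _ = K ^ 2 * (u - s) * w ω := by ring
    have := norm_setIntegral_le_of_norm_le_const (μ := volume) (s := Ioc s u) (by simp) e2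
    rw [Real.norm_eq_abs] at this
    refine this.trans_eq ?_
    simp [Measure.real, ENNReal.toReal_ofReal (sub_nonneg.2 hsu)]
    ring
  -- (iv)
  have s4 : |∫ ω, w ω * G ω ^ 2 ∂P| ≤ K ^ 2 * (u - s) ^ 2 * ∫ ω, w ω ∂P := by
    rw [← integral_const_mul, ← Real.norm_eq_abs]
    refine norm_integral_le_of_norm_le ((ib B hwm hwB).const_mul _) (ae_of_all _ fun ω => ?_)
    rw [Real.norm_eq_abs, abs_mul, abs_of_nonneg (hw0 ω), abs_of_nonneg (sq_nonneg _), ← sq_abs]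
    have := Gb ω
    have h2 : |G ω| ^ 2 ≤ (K * (u - s)) ^ 2 := pow_le_pow_left₀ (abs_nonneg _) this 2
    have := hw0 ω
    nlinarith
  -- assemble
  have GM : Measurable G := Im gc s u
  have QM : Measurable Q := Im φgc s u
  have ΓM : Measurable Γ := Im Gc s u
  have b2 : ∀ {g g' : Ω → ℝ} {C C' : ℝ}, (∀ ω, |g ω| ≤ C) → (∀ ω, |g' ω| ≤ C') → ∀ ω, |g ω + g' ω| ≤ C + C' :=
    fun h1 h2 ω => (abs_add_le _ _).trans (add_le_add (h1 ω) (h2 ω))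
  have i1 : Integrable (fun ω => w ω * (φ (X s ω) * (φ (X u ω) - φ (X s ω) - G ω))) P := by
    refine ib (B * (D * (D + D + K * (u - s)))) (hwm.mul ((φm s).mul (((φm u).sub (φm s)).sub GM))) ?_
    refine wb (fb s fun ω => ?_)
    refine (abs_sub _ _).trans (add_le_add ((abs_sub _ _).trans (add_le_add (hD _) (hD _))) (Gb ω))
  have sqb : ∀ {g : Ω → ℝ} {C : ℝ}, (∀ ω, |g ω| ≤ C) → ∀ ω, |g ω ^ 2| ≤ C ^ 2 := by
    intro g C hg ω
    rw [abs_pow]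
    exact pow_le_pow_left₀ (abs_nonneg _) (hg ω) 2
  have i2 : Integrable (fun ω => w ω * (φ (X u ω) ^ 2 - φ (X s ω) ^ 2 - (2 * Q ω + Γ ω))) P := by
    refine ib _ (hwm.mul ((((φm u).pow_const 2).sub ((φm s).pow_const 2)).sub ((QM.const_mul 2).add ΓM)))
      (wb (C := D ^ 2 + D ^ 2 + (2 * ((D * K) * (u - s)) + KG * (u - s))) fun ω => ?_)
    refine (abs_sub _ _).trans (add_le_add ((abs_sub _ _).trans (add_le_add (sqb (fun ω => hD (X u ω)) ω)
      (sqb (fun ω => hD (X s ω)) ω))) ((abs_add_le _ _).trans (add_le_add ?_ (Γb ω))))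
    rw [abs_mul, abs_two]
    exact mul_le_mul_of_nonneg_left (Qb ω) (by norm_num)
  have i3 : Integrable (fun ω => w ω * (φ (X u ω) * G ω - Q ω)) P := by
    refine ib _ (hwm.mul (((φm u).mul GM).sub QM)) (wb (C := D * (K * (u - s)) + (D * K) * (u - s)) fun ω => ?_)
    exact (abs_sub _ _).trans (add_le_add (fb u Gb ω) (Qb ω))
  have i4 : Integrable (fun ω => w ω * G ω ^ 2) P :=
    ib _ (hwm.mul (GM.pow_const 2)) (wb (sqb Gb))
  have i5 : Integrable (fun ω => w ω * Γ ω) P := ib _ (hwm.mul ΓM) (wb Γb)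
  have key : ∫ ω, w ω * (Mp f a φ X α u ω - Mp f a φ X α s ω) ^ 2 ∂P
      = ∫ ω, w ω * (φ (X u ω) ^ 2 - φ (X s ω) ^ 2 - (2 * Q ω + Γ ω)) ∂P
        - 2 * ∫ ω, w ω * (φ (X s ω) * (φ (X u ω) - φ (X s ω) - G ω)) ∂P
        - 2 * ∫ ω, w ω * (φ (X u ω) * G ω - Q ω) ∂P
        + ∫ ω, w ω * G ω ^ 2 ∂P + ∫ ω, w ω * Γ ω ∂P := by
    rw [← integral_const_mul, ← integral_const_mul]
    have lin : ∀ {g1 g2 g3 g4 g5 : Ω → ℝ}, Integrable g1 P → Integrable g2 P → Integrable g3 P →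
        Integrable g4 P → Integrable g5 P →
        ∫ ω, g1 ω ∂P - ∫ ω, g2 ω ∂P - ∫ ω, g3 ω ∂P + ∫ ω, g4 ω ∂P + ∫ ω, g5 ω ∂P
          = ∫ ω, (g1 ω - g2 ω - g3 ω + g4 ω + g5 ω) ∂P := by
      intro g1 g2 g3 g4 g5 h1 h2 h3 h4 h5
      have a1 := integral_sub h1 h2
      have a2 := integral_sub (h1.sub h2) h3
      have a3 := integral_add ((h1.sub h2).sub h3) h4
      have a4 := integral_add (((h1.sub h2).sub h3).add h4) h5
      simp only [Pi.add_apply, Pi.sub_apply] at a1 a2 a3 a4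
      rw [a4, a3, a2, a1]
    rw [lin i2 (i1.const_mul 2) (i3.const_mul 2) i4 i5]
    refine integral_congr_ae (ae_of_all _ fun ω => ?_)
    simp only [hΔ, Pi.add_apply, Pi.sub_apply]
    ring
  rw [key, s1, s2]
  have fin : ∀ p q e : ℝ, |p| ≤ e → |q| ≤ e → |0 - 2 * 0 - 2 * p + q| ≤ 3 * e := by
    intro p q e h1 h2
    rw [abs_le] at *
    constructor <;> linarith
  have := fin _ _ _ s3 s4
  have e9 : ∀ z y: ℝ, 0 - 2 * 0 - 2 * z + y + ∫ ω, w ω * Γ ω ∂P - ∫ ω, w ω * Ip (Gam σ φ) X α s u ω ∂P = 0 - 2 * 0 - 2 * z + y := by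
    intro z y
    simp only [Γ]
    ring
  rw [e9]
  refine this.trans_eq ?_
  ring

end qv


section fourth
variable {N M : ℕ} {A : Set (EN M)} {f : EN N → EN M → EN N}
    {σ : EN N → EN M → Matrix (Fin N) (Fin M) ℝ}
    {a : EN N → EN M → Matrix (Fin N) (Fin N) ℝ} {Ω : Type*}
    [mΩ : MeasurableSpace Ω] {P : Measure Ω} [IsProbabilityMeasure P] {F : Filtration ℝ mΩ}
    {X : ℝ → Ω → EN N} {α : ℝ → Ω → EN M}

lemma PathC.Gam_bdd (H : Hyp A f σ a) {φ : EN N → ℝ} (h : ContDiff ℝ 2 φ) (hc : HasCompactSupport φ) :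
    ∃ C, 0 ≤ C ∧ ∀ x, ∀ β ∈ A, |Gam σ φ x β| ≤ C := by
  obtain ⟨D, hD⟩ := hc.exists_bound_of_continuous h.continuous
  simp only [Real.norm_eq_abs] at hD
  have hD0 : 0 ≤ D := (abs_nonneg _).trans (hD 0)
  obtain ⟨C1, h1, h2⟩ := gen_bdd H (h.mul h) hc.mul_right
  obtain ⟨C2, h3, h4⟩ := gen_bdd H h hc
  refine ⟨C1 + 2 * D * C2, by positivity, fun x β hβ => ?_⟩
  have e := gen_sq H h x β
  have e1 := h2 x β hβ
  have e2 := h4 x β hβ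
  have e3 : Gam σ φ x β = gen f a (fun y => φ y * φ y) x β - 2 * (φ x * gen f a φ x β) := by
    rw [e]; ring
  rw [e3]
  refine (abs_sub _ _).trans ?_
  rw [abs_mul 2, abs_mul (φ x)]
  have : |φ x| * |gen f a φ x β| ≤ D * C2 := mul_le_mul (hD x) e2 (abs_nonneg _) hD0
  have e5 : |(2:ℝ)| = 2 := by norm_num
  rw [e5]
  have e6 : |gen f a (fun y => φ y * φ y) x β| ≤ C1 := e1
  nlinarith

/-- increments of the martingale from time 0 -/
lemma PathC.D_meas (hP : PathC A F X α) (H : Hyp A f σ a)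
    {φ : EN N → ℝ} (h : ContDiff ℝ 2 φ) {t : ℝ} (ht : 0 ≤ t) :
    Measurable[F t] (fun ω => Mp f a φ X α t ω - Mp f a φ X α 0 ω) := by
  have h1 := hP.Mp_meas H h t
  have h2 := (hP.Mp_meas H h 0).mono (F.mono ht) le_rfl
  letI := F t
  exact h1.sub h2

lemma PathC.D_bdd (hP : PathC A F X α) (H : Hyp A f σ a)
    {φ : EN N → ℝ} (h : ContDiff ℝ 2 φ) (hc : HasCompactSupport φ) {t : ℝ} (ht : 0 ≤ t) :
    ∃ C, 0 ≤ C ∧ ∀ ω, |Mp f a φ X α t ω - Mp f a φ X α 0 ω| ≤ C := by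
  obtain ⟨C, h0, hC⟩ := hP.Mp_bdd H h hc
  refine ⟨C * (1 + t) + C * (1 + 0), by positivity, fun ω => ?_⟩
  exact (abs_sub _ _).trans (add_le_add (hC t ht ω) (hC 0 le_rfl ω))

/-- one step second moment -/
lemma PathC.step2 (hP : PathC A F X α) (H : Hyp A f σ a) (hM : MartC f a P F X α)
    {φ : EN N → ℝ} (h : ContDiff ℝ 2 φ) (hc : HasCompactSupport φ) {s u : ℝ} (hs : 0 ≤ s)
    (hsu : s ≤ u) :
    ∫ ω, (Mp f a φ X α u ω - Mp f a φ X α 0 ω) ^ 2 ∂P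
      = ∫ ω, (Mp f a φ X α s ω - Mp f a φ X α 0 ω) ^ 2 ∂P
        + ∫ ω, (Mp f a φ X α u ω - Mp f a φ X α s ω) ^ 2 ∂P := by
  obtain ⟨C, C0, hC⟩ := hP.D_bdd H h hc hs
  obtain ⟨C', C0', hC'⟩ := hP.D_bdd H h hc (hs.trans hsu)
  have m1 := hP.D_meas H h hs
  have m1' := m1.mono (F.le s) le_rfl
  have m2' := (hP.D_meas H h (hs.trans hsu)).mono (F.le u) le_rfl
  have z := hP.mart_weight H hM h hc hs hsu m1 hC
  have ib : ∀ {g : Ω → ℝ} (C : ℝ), Measurable g → (∀ ω, |g ω| ≤ C) → Integrable g P :=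
    fun C hg hb => Integrable.of_bound hg.aestronglyMeasurable C (ae_of_all _ hb)
  have sqb : ∀ {g : Ω → ℝ} {C : ℝ}, (∀ ω, |g ω| ≤ C) → ∀ ω, |g ω ^ 2| ≤ C ^ 2 := by
    intro g C hg ω
    rw [abs_pow]
    exact pow_le_pow_left₀ (abs_nonneg _) (hg ω) 2
  have i1 := ib _ (m1'.pow_const 2) (sqb hC)
  have i2 := ib _ (m2'.pow_const 2) (sqb hC')
  have bΔ : ∀ ω, |(Mp f a φ X α u ω - Mp f a φ X α 0 ω) - (Mp f a φ X α s ω - Mp f a φ X α 0 ω)| ≤ C' + C :=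
    fun ω => (abs_sub _ _).trans (add_le_add (hC' ω) (hC ω))
  have i3 : Integrable (fun ω => (Mp f a φ X α u ω - Mp f a φ X α s ω) ^ 2) P := by
    have := ib _ ((m2'.sub m1').pow_const 2) (sqb bΔ)
    refine this.congr (ae_of_all _ fun ω => ?_)
    simp
  have i4 : Integrable (fun ω => 2 * ((Mp f a φ X α s ω - Mp f a φ X α 0 ω) *
      (Mp f a φ X α u ω - Mp f a φ X α s ω))) P := by
    refine Integrable.const_mul ?_ 2
    have := ib (C * (C' + C)) (m1'.mul (m2'.sub m1')) (fun ω => by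
      simp only [Pi.mul_apply, Pi.sub_apply]
      rw [abs_mul]; exact mul_le_mul (hC ω) (bΔ ω) (abs_nonneg _) C0)
    refine this.congr (ae_of_all _ fun ω => ?_)
    simp
  have e := integral_add (i1.add i3) i4
  have e' := integral_add i1 i3
  simp only [Pi.add_apply] at e e'
  have z' : ∫ ω, 2 * ((Mp f a φ X α s ω - Mp f a φ X α 0 ω) *
      (Mp f a φ X α u ω - Mp f a φ X α s ω)) ∂P = 0 := by rw [integral_const_mul, z, mul_zero]
  rw [z', add_zero, e'] at e
  rw [← e]
  refine integral_congr_ae (ae_of_all _ fun ω => ?_)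
  beta_reduce
  ring

lemma PathC.qv_one (hP : PathC A F X α) (H : Hyp A f σ a) (hM : MartC f a P F X α)
    {φ : EN N → ℝ} (h : ContDiff ℝ 2 φ) (hc : HasCompactSupport φ) {K : ℝ}
    (hK : ∀ x, ∀ β ∈ A, |gen f a φ x β| ≤ K) {s u : ℝ} (hs : 0 ≤ s)
    (hsu : s ≤ u) :
    |∫ ω, (Mp f a φ X α u ω - Mp f a φ X α s ω) ^ 2 ∂P
      - ∫ ω, Ip (Gam σ φ) X α s u ω ∂P| ≤ 3 * K ^ 2 * (u - s) ^ 2 := by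
  have := hP.qv H hM h hc hK hs hsu (w := fun _ => 1) (B := 1) measurable_const (by simp) (by simp)
  simpa using this

lemma PathC.Ip_Gam_int (hP : PathC A F X α) (H : Hyp A f σ a) 
    {φ : EN N → ℝ} (h : ContDiff ℝ 2 φ) (hc : HasCompactSupport φ) {s u : ℝ} (hsu : s ≤ u) :
    Integrable (Ip (Gam σ φ) X α s u) P := by
  obtain ⟨KG, hKG0, hKG⟩ := PathC.Gam_bdd H h hc
  exact Integrable.of_bound ((hP.Ip_meas H (Gam_cont H h) s u).mono (F.le u) le_rfl).aestronglyMeasurable _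
    (ae_of_all _ fun ω => Ip_bdd hP.α_mem hKG ω hsu)

lemma PathC.second (hP : PathC A F X α) (H : Hyp A f σ a) (hM : MartC f a P F X α)
    {φ : EN N → ℝ} (h : ContDiff ℝ 2 φ) (hc : HasCompactSupport φ) {T : ℝ} (hT : 0 ≤ T) :
    ∫ ω, (Mp f a φ X α T ω - Mp f a φ X α 0 ω) ^ 2 ∂P = ∫ ω, Ip (Gam σ φ) X α 0 T ω ∂P := by
  obtain ⟨K, K0, hK⟩ := gen_bdd H h hc
  have grid : ∀ h' : ℝ, 0 ≤ h' → ∀ i : ℕ,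
      |∫ ω, (Mp f a φ X α (i * h') ω - Mp f a φ X α 0 ω) ^ 2 ∂P - ∫ ω, Ip (Gam σ φ) X α 0 (i * h') ω ∂P|
        ≤ i * (3 * K ^ 2 * h' ^ 2) := by
    intro h' hh' i
    induction i with
    | zero => simp [Ip]
    | succ i ih =>
      have p0 : 0 ≤ (i:ℝ) * h' := by positivity
      have p1 : (i:ℝ) * h' ≤ ((i+1:ℕ):ℝ) * h' := by push_cast; nlinarith
      have e1 := hP.step2 H hM h hc p0 p1
      have e2 := hP.qv_one H hM h hc hK p0 p1
      have e3 : ∫ ω, Ip (Gam σ φ) X α 0 (((i+1:ℕ):ℝ) * h') ω ∂P = ∫ ω, Ip (Gam σ φ) X α 0 (i * h') ω ∂P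
          + ∫ ω, Ip (Gam σ φ) X α (i * h') (((i+1:ℕ):ℝ) * h') ω ∂P := by
        rw [← integral_add (hP.Ip_Gam_int H h hc p0) (hP.Ip_Gam_int H h hc p1)]
        refine integral_congr_ae (ae_of_all _ fun ω => ?_)
        exact (hP.Ip_add H (Gam_cont H h) ω p0 p1).symm
      rw [e1, e3]
      have e4 : ((i+1:ℕ):ℝ) * h' - i * h' = h' := by push_cast; ring
      rw [e4] at e2
      rw [abs_le] at *
      push_cast at *
      constructor <;> linarith [ih.1, ih.2, e2.1, e2.2]
  have lim : ∀ n : ℕ, |∫ ω, (Mp f a φ X α T ω - Mp f a φ X α 0 ω) ^ 2 ∂P - ∫ ω, Ip (Gam σ φ) X α 0 T ω ∂P|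
      ≤ (3 * K ^ 2 * T ^ 2) * (1 / ((n:ℝ) + 1)) := by
    intro n
    have := grid (T / ((n+1:ℕ):ℝ)) (by positivity) (n+1)
    have hn : ((n+1:ℕ):ℝ) ≠ 0 := by positivity
    rw [mul_div_cancel₀ _ hn] at this
    refine this.trans_eq ?_
    push_cast at *
    field_simp
  have t0 := (tendsto_one_div_add_atTop_nhds_zero_nat (𝕜 := ℝ)).const_mul (3 * K ^ 2 * T ^ 2)
  rw [mul_zero] at t0
  have := ge_of_tendsto' t0 lim
  exact sub_eq_zero.1 (abs_nonpos_iff.1 this)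

lemma quartic_aux (x y : ℝ) (q : |y| ≤ 5) :
    (x + y) ^ 4 ≤ x ^ 4 + 4 * (x ^ 3 * y) + (16 * x ^ 2 + 35) * y ^ 2 := by
  rw [abs_le] at q
  have y2 : 0 ≤ y ^ 2 := sq_nonneg y
  have q5 : y ^ 2 ≤ 25 := by nlinarith
  have k1 : 4 * x * y ≤ 10 * (x ^ 2 + 1) := by
    rcases le_total 0 x with hx | hx
    · nlinarith [sq_nonneg (x - 1), mul_le_mul_of_nonneg_left q.2 hx]
    · nlinarith [sq_nonneg (x + 1), mul_le_mul_of_nonpos_left q.1 hx]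
  have k2 : 4 * x * y * y ^ 2 ≤ 10 * (x ^ 2 + 1) * y ^ 2 := mul_le_mul_of_nonneg_right k1 y2
  have k3 : y ^ 2 * y ^ 2 ≤ 25 * y ^ 2 := mul_le_mul_of_nonneg_right q5 y2
  have e : (x + y) ^ 4 = x ^ 4 + 4 * (x ^ 3 * y) + 6 * x ^ 2 * y ^ 2 + 4 * x * y * y ^ 2 + y ^ 2 * y ^ 2 := by
    ring
  rw [e]
  linarith

set_option maxHeartbeats 1000000 in
lemma PathC.fourth (hP : PathC A F X α) (H : Hyp A f σ a) (hM : MartC f a P F X α)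
    {φ : EN N → ℝ} (h : ContDiff ℝ 2 φ) (hc : HasCompactSupport φ) (hφ : ∀ x, |φ x| ≤ 2)
    {κ : ℝ} (hκ : ∀ x, ∀ β ∈ A, |Gam σ φ x β| ≤ κ) {T : ℝ} (hT : 0 ≤ T) :
    ∫ ω, (Mp f a φ X α T ω - Mp f a φ X α 0 ω) ^ 4 ∂P ≤ (κ * T + 1) * (16 * (κ * T + 1) + 35) := by
  obtain ⟨K, K0, hK⟩ := gen_bdd H h hc
  have κ0 : 0 ≤ κ := by
    obtain ⟨ω⟩ : Nonempty Ω := P.nonempty_of_neZero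
    exact (abs_nonneg _).trans (hκ (X 0 ω) _ (hP.α_mem 0 ω))
  obtain ⟨n, hn⟩ := exists_nat_gt (K * T + 3 * K ^ 2 * T ^ 2)
  have n0 : (0:ℝ) < n := lt_of_le_of_lt (by positivity) hn
  set d := T / n with hd
  have d0 : 0 ≤ d := by positivity
  have nd : n * d = T := by rw [hd]; field_simp
  have Kd : K * d ≤ 1 := by
    rw [hd, mul_div_assoc', div_le_one n0]
    nlinarith [mul_nonneg (mul_nonneg (by norm_num : (0:ℝ) ≤ 3) (sq_nonneg K)) (sq_nonneg T)]
  set b := κ * d + 3 * K ^ 2 * d ^ 2 with hb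
  have b0 : 0 ≤ b := by positivity
  have nb : n * b ≤ κ * T + 1 := by
    have : n * b = κ * T + (3 * K ^ 2 * T ^ 2) / n := by
      rw [hb, hd]; field_simp
    rw [this]
    have : (3 * K ^ 2 * T ^ 2) / n ≤ 1 := by
      rw [div_le_one n0]; nlinarith [mul_nonneg K0 hT]
    linarith
  have ib : ∀ {g : Ω → ℝ} (C : ℝ), Measurable g → (∀ ω, |g ω| ≤ C) → Integrable g P :=
    fun C hg hb => Integrable.of_bound hg.aestronglyMeasurable C (ae_of_all _ hb)
  -- conditional variance bound
  have cv : ∀ (i : ℕ) (w : Ω → ℝ) (B : ℝ), Measurable[F (i * d)] w → (∀ ω, 0 ≤ w ω) → (∀ ω, w ω ≤ B) →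
      ∫ ω, w ω * (Mp f a φ X α (((i+1:ℕ):ℝ) * d) ω - Mp f a φ X α (i * d) ω) ^ 2 ∂P ≤ b * ∫ ω, w ω ∂P := by
    intro i w B hw h0 hB
    have p0 : 0 ≤ (i:ℝ) * d := by positivity
    have p1 : (i:ℝ) * d ≤ ((i+1:ℕ):ℝ) * d := by push_cast; nlinarith
    have e2 := hP.qv H hM h hc hK p0 p1 hw h0 hB
    have e4 : ((i+1:ℕ):ℝ) * d - i * d = d := by push_cast; ring
    rw [e4] at e2
    have hwm : Measurable w := hw.mono (F.le _) le_rfl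
    have hwi : Integrable w P := ib B hwm (fun ω => by rw [abs_of_nonneg (h0 ω)]; exact hB ω)
    have e5 : ∫ ω, w ω * Ip (Gam σ φ) X α (i * d) (((i+1:ℕ):ℝ) * d) ω ∂P ≤ κ * d * ∫ ω, w ω ∂P := by
      rw [← integral_const_mul]
      refine integral_mono_of_nonneg (ae_of_all _ fun ω => ?_) (hwi.const_mul _) (ae_of_all _ fun ω => ?_)
      · refine mul_nonneg (h0 ω) ?_
        unfold Ip
        exact integral_nonneg fun r => Gam_nonneg _ _ _
      · have := (le_abs_self _).trans (Ip_bdd (X := X) hP.α_mem hκ ω p1)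
        rw [e4] at this
        have := mul_le_mul_of_nonneg_left this (h0 ω)
        beta_reduce
        linarith
    have := (abs_le.1 e2).2
    rw [hb]
    nlinarith
  have grid : ∀ i : ℕ, i ≤ n → ∫ ω, (Mp f a φ X α (i * d) ω - Mp f a φ X α 0 ω) ^ 2 ∂P ≤ i * b ∧
      ∫ ω, (Mp f a φ X α (i * d) ω - Mp f a φ X α 0 ω) ^ 4 ∂P ≤ i * (b * (16 * (n * b) + 35)) := by
    intro i
    induction i with
    | zero => simp
    | succ i ih =>
      intro hi
      obtain ⟨ih2, ih4⟩ := ih (by omega)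
      have p0 : 0 ≤ (i:ℝ) * d := by positivity
      have p1 : (i:ℝ) * d ≤ ((i+1:ℕ):ℝ) * d := by push_cast; nlinarith
      have e4 : ((i+1:ℕ):ℝ) * d - i * d = d := by push_cast; ring
      have e1 := hP.step2 H hM h hc p0 p1
      have e2 := cv i (fun _ => 1) 1 measurable_const (by simp) (by simp)
      simp at e2
      obtain ⟨C, C0, hC⟩ := hP.D_bdd H h hc p0
      have m1 := hP.D_meas H h p0
      have z := hP.mart_weight H hM h hc p0 p1 (w := fun ω => (Mp f a φ X α (i * d) ω - Mp f a φ X α 0 ω) ^ 3)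
        (by letI := F (i * d); exact m1.pow_const 3) (B := C ^ 3) (fun ω => by
          rw [abs_pow]; exact pow_le_pow_left₀ (abs_nonneg _) (hC ω) 3)
      have cw := cv i (fun ω => 16 * (Mp f a φ X α (i * d) ω - Mp f a φ X α 0 ω) ^ 2 + 35) (16 * C ^ 2 + 35)
        (by letI := F (i * d); exact ((m1.pow_const 2).const_mul 16).add_const 35) (fun ω => by positivity)
        (fun ω => by
          have : (Mp f a φ X α (i * d) ω - Mp f a φ X α 0 ω) ^ 2 ≤ C ^ 2 := by
            rw [← sq_abs]; exact pow_le_pow_left₀ (abs_nonneg _) (hC ω) 2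
          linarith)
      have m1' := m1.mono (F.le _) le_rfl
      have m2' := (hP.D_meas H h (p0.trans p1)).mono (F.le _) le_rfl
      have Δb : ∀ ω, |Mp f a φ X α (((i+1:ℕ):ℝ) * d) ω - Mp f a φ X α (i * d) ω| ≤ 5 := by
        intro ω
        rw [hP.Mp_sub H h p0 p1 ω]
        have q := Ip_bdd (X := X) hP.α_mem hK ω p1
        rw [e4] at q
        have q1 := hφ (X (((i+1:ℕ):ℝ) * d) ω)
        have q2 := hφ (X (i * d) ω)
        rw [abs_le] at *
        constructor <;> linarith [q.1, q.2, q1.1, q1.2, q2.1, q2.2]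
      set D1 : Ω → ℝ := fun ω => Mp f a φ X α (i * d) ω - Mp f a φ X α 0 ω with hD1
      set Δ : Ω → ℝ := fun ω => Mp f a φ X α (((i+1:ℕ):ℝ) * d) ω - Mp f a φ X α (i * d) ω with hΔ
      have mΔ : Measurable Δ := by
        have := m2'.sub m1'
        convert this using 1
        ext ω
        simp [hΔ, hD1]
      have pb : ∀ (p q : ℕ), Integrable (fun ω => D1 ω ^ p * Δ ω ^ q) P := by
        intro p q
        refine ib (C ^ p * 5 ^ q) ((m1'.pow_const p).mul (mΔ.pow_const q)) fun ω => ?_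
        rw [abs_mul, abs_pow, abs_pow]
        exact mul_le_mul (pow_le_pow_left₀ (abs_nonneg _) (hC ω) p)
          (pow_le_pow_left₀ (abs_nonneg _) (Δb ω) q) (by positivity) (by positivity)
      have eD : ∀ ω, Mp f a φ X α (((i+1:ℕ):ℝ) * d) ω - Mp f a φ X α 0 ω = D1 ω + Δ ω := by
        intro ω; simp only [hD1, hΔ]; ring
      refine ⟨?_, ?_⟩
      · rw [e1]
        push_cast at *
        linarith
      · have i4 : Integrable (fun ω => D1 ω ^ 4) P := by simpa using pb 4 0
        have i31 : Integrable (fun ω => 4 * (D1 ω ^ 3 * Δ ω)) P := by simpa using (pb 3 1).const_mul 4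
        have i2 : Integrable (fun ω => D1 ω ^ 2) P := by simpa using pb 2 0
        have iw : Integrable (fun ω => (16 * D1 ω ^ 2 + 35) * Δ ω ^ 2) P := by
          have := ((pb 2 2).const_mul 16).add ((pb 0 2).const_mul 35)
          refine this.congr (ae_of_all _ fun ω => ?_)
          simp
          ring
        have st : ∫ ω, (Mp f a φ X α (((i+1:ℕ):ℝ) * d) ω - Mp f a φ X α 0 ω) ^ 4 ∂P ≤
            ∫ ω, (D1 ω ^ 4 + 4 * (D1 ω ^ 3 * Δ ω) + (16 * D1 ω ^ 2 + 35) * Δ ω ^ 2) ∂P := by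
          refine integral_mono_of_nonneg (ae_of_all _ fun ω => by positivity) ((i4.add i31).add iw) (ae_of_all _ fun ω => ?_)
          beta_reduce
          rw [eD]
          exact quartic_aux _ _ (Δb ω)
        have e := integral_add (i4.add i31) iw
        have e' := integral_add i4 i31
        simp only [Pi.add_apply] at e e'
        rw [e, e', integral_const_mul, z] at st
        have ew : ∫ ω, (16 * D1 ω ^ 2 + 35) ∂P = 16 * ∫ ω, D1 ω ^ 2 ∂P + 35 := by
          rw [integral_add (i2.const_mul 16) (integrable_const _), integral_const_mul]
          simp
        rw [ew] at cw
        have inb : (i:ℝ) * b ≤ n * b := by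
          have : (i:ℝ) ≤ n := by exact_mod_cast (by omega : i ≤ n)
          nlinarith
        have : b * (16 * ∫ ω, D1 ω ^ 2 ∂P + 35) ≤ b * (16 * (n * b) + 35) := by
          refine mul_le_mul_of_nonneg_left ?_ b0
          linarith
        have ec : ((i+1:ℕ):ℝ) * (b * (16 * (n * b) + 35)) = i * (b * (16 * (n * b) + 35)) + b * (16 * (n * b) + 35) := by
          push_cast; ring
        refine st.trans ?_
        rw [ec]
        have cw' : ∫ ω, (16 * D1 ω ^ 2 + 35) * Δ ω ^ 2 ∂P ≤ b * (16 * ∫ ω, D1 ω ^ 2 ∂P + 35) := cw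
        have ih4' : ∫ ω, D1 ω ^ 4 ∂P ≤ i * (b * (16 * (n * b) + 35)) := ih4
        linarith
  have := (grid n le_rfl).2
  rw [nd] at this
  refine this.trans ?_
  rw [← mul_assoc]
  have : 0 ≤ n * b := by positivity
  exact mul_le_mul nb (by linarith) (by positivity) (by linarith)

end fourth


section gz
variable {N M : ℕ} {A : Set (EN M)} {f : EN N → EN M → EN N}
    {σ : EN N → EN M → Matrix (Fin N) (Fin M) ℝ}
    {a : EN N → EN M → Matrix (Fin N) (Fin N) ℝ} {Ω : Type*}
    [mΩ : MeasurableSpace Ω] {P : Measure Ω} [IsProbabilityMeasure P] {F : Filtration ℝ mΩ}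
    {X : ℝ → Ω → EN N} {α : ℝ → Ω → EN M}

lemma sq_split (x l : ℝ) (hl : 0 < l) : x ^ 2 ≤ l * |x| + (1 / l ^ 2) * x ^ 4 := by
  rcases le_total |x| l with h | h
  · have : x ^ 2 ≤ l * |x| := by
      rw [← sq_abs]; nlinarith [abs_nonneg x]
    have h4 : 0 ≤ (1 / l ^ 2) * x ^ 4 := by positivity
    linarith
  · have h2 : l ^ 2 ≤ x ^ 2 := by rw [← sq_abs x]; exact pow_le_pow_left₀ hl.le h 2
    have h3 : x ^ 2 ≤ (1 / l ^ 2) * x ^ 4 := by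
      rw [one_div, inv_mul_eq_div, le_div_iff₀ (by positivity)]
      nlinarith [sq_nonneg x]
    have : 0 ≤ l * |x| := by positivity
    linarith

lemma PathC.sq_le (hP : PathC A F X α) (H : Hyp A f σ a) (hM : MartC f a P F X α)
    {φ : EN N → ℝ} (h : ContDiff ℝ 2 φ) (hc : HasCompactSupport φ) (hφ : ∀ x, |φ x| ≤ 2)
    {κ : ℝ} (hκ : ∀ x, ∀ β ∈ A, |Gam σ φ x β| ≤ κ) {T : ℝ} (hT : 0 ≤ T) {C0 : ℝ}
    (h1 : ∫ ω, |Mp f a φ X α T ω - Mp f a φ X α 0 ω| ∂P ≤ C0) {l : ℝ} (hl : 0 < l) :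
    ∫ ω, (Mp f a φ X α T ω - Mp f a φ X α 0 ω) ^ 2 ∂P ≤ l * C0 +
      (1 / l ^ 2) * ((κ * T + 1) * (16 * (κ * T + 1) + 35)) := by
  obtain ⟨C, C0, hC⟩ := hP.D_bdd H h hc hT
  have m1 := (hP.D_meas H h hT).mono (F.le _) le_rfl
  have i0 : Integrable (fun ω => Mp f a φ X α T ω - Mp f a φ X α 0 ω) P :=
    Integrable.of_bound m1.aestronglyMeasurable C (ae_of_all _ hC)
  have i4 : Integrable (fun ω => (Mp f a φ X α T ω - Mp f a φ X α 0 ω) ^ 4) P :=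
    Integrable.of_bound (m1.pow_const 4).aestronglyMeasurable (C ^ 4) (ae_of_all _ fun ω => by
      rw [Real.norm_eq_abs, abs_pow]; exact pow_le_pow_left₀ (abs_nonneg _) (hC ω) 4)
  have h4 := hP.fourth H hM h hc hφ hκ hT
  have i0' := i0.abs
  have e1 : ∫ ω, (Mp f a φ X α T ω - Mp f a φ X α 0 ω) ^ 2 ∂P ≤
      ∫ ω, (l * |Mp f a φ X α T ω - Mp f a φ X α 0 ω| + (1 / l ^ 2) * (Mp f a φ X α T ω - Mp f a φ X α 0 ω) ^ 4) ∂P :=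
    integral_mono_of_nonneg (ae_of_all _ fun ω => sq_nonneg _) ((i0'.const_mul l).add (i4.const_mul _))
      (ae_of_all _ fun ω => sq_split _ _ hl)
  have e2 := integral_add (i0'.const_mul l) (i4.const_mul (1 / l ^ 2))
  rw [e2, integral_const_mul, integral_const_mul] at e1
  have := mul_le_mul_of_nonneg_left h1 hl.le
  have := mul_le_mul_of_nonneg_left h4 (by positivity : 0 ≤ 1 / l ^ 2)
  linarith

lemma PathC.gam_zero (hP : PathC A F X α) (H : Hyp A f σ a) (hM : MartC f a P F X α)
    {ψ : EN N → ℝ} (h : ContDiff ℝ 2 ψ) (hc : HasCompactSupport ψ) {T : ℝ} (hT : 0 ≤ T) {C0 : ℝ}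
    (hC0 : ∀ φ : EN N → ℝ, ContDiff ℝ 2 φ → HasCompactSupport φ → (∀ x, |φ x| ≤ 2) →
      (∀ x, ψ x = 0 → φ x = 0) → ∫ ω, |Mp f a φ X α T ω - Mp f a φ X α 0 ω| ∂P ≤ C0) :
    ∫ ω, Ip (Gam σ ψ) X α 0 T ω ∂P = 0 := by
  obtain ⟨κ, κ0, hκ⟩ := PathC.Gam_bdd H h hc
  set G := ∫ ω, Ip (Gam σ ψ) X α 0 T ω ∂P with hG
  have G0 : 0 ≤ G := integral_nonneg fun ω => by
    unfold Ip
    exact integral_nonneg fun r => Gam_nonneg _ _ _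
  set E := (κ * T + 1) * (16 * (κ * T + 1) + 35) with hE
  have C00 : 0 ≤ C0 := (integral_nonneg fun ω => abs_nonneg _).trans
    (hC0 (fun _ => 0) contDiff_const HasCompactSupport.zero (by simp) (by simp))
  have main : ∀ m : ℕ, G ≤ (2 * (C0 + E)) * (1 / ((m:ℝ) + 1)) := by
    intro m'
    set m : ℝ := (m':ℝ) + 1 with hm
    have m1 : 1 ≤ m := by rw [hm]; linarith [(Nat.cast_nonneg m' : (0:ℝ) ≤ m')]
    have m0 : 0 < m := by linarith
    set k : ℝ := m ^ 2 with hk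
    have k1 : 1 ≤ k := one_le_pow₀ m1
    let φs : EN N → ℝ := fun x => Real.sin (k * ψ x)
    let φc : EN N → ℝ := fun x => Real.cos (k * ψ x) - 1
    have hs : ContDiff ℝ 2 φs := Real.contDiff_sin.comp (contDiff_const.mul h)
    have hcc : ContDiff ℝ 2 φc := (Real.contDiff_cos.comp (contDiff_const.mul h)).sub contDiff_const
    have ss : HasCompactSupport φs := hc.comp_left (g := fun y => Real.sin (k * y)) (by simp)
    have sc : HasCompactSupport φc := hc.comp_left (g := fun y => Real.cos (k * y) - 1) (by simp)
    have bs : ∀ x, |φs x| ≤ 2 := fun x => (Real.abs_sin_le_one _).trans (by norm_num)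
    have bc : ∀ x, |φc x| ≤ 2 := fun x => by
      have := Real.abs_cos_le_one (k * ψ x)
      simp only [φc]
      rw [abs_le] at *
      constructor <;> linarith [this.1, this.2]
    have gs : ∀ x β, Gam σ φs x β = (Real.cos (k * ψ x) * k) ^ 2 * Gam σ ψ x β := by
      intro x β
      refine Gam_comp h (g := fun y => Real.sin (k * y)) ?_ β
      have := ((hasDerivAt_id (ψ x)).const_mul k).sin
      simpa using this
    have gcs : ∀ x β, Gam σ φc x β = (-(Real.sin (k * ψ x) * k)) ^ 2 * Gam σ ψ x β := by
      intro x β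
      refine Gam_comp h (g := fun y => Real.cos (k * y) - 1) ?_ β
      have := (((hasDerivAt_id (ψ x)).const_mul k).cos).sub_const 1
      simpa using this
    have kb : ∀ c : ℝ, c ^ 2 ≤ 1 → ∀ x, ∀ β ∈ A, |(c * k) ^ 2 * Gam σ ψ x β| ≤ k ^ 2 * κ := by
      intro c hc x β hβ
      rw [abs_mul, abs_of_nonneg (sq_nonneg _)]
      refine mul_le_mul ?_ (hκ x β hβ) (abs_nonneg _) (sq_nonneg _)
      nlinarith [sq_nonneg k]
    have ks : ∀ x, ∀ β ∈ A, |Gam σ φs x β| ≤ k ^ 2 * κ := by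
      intro x β hβ
      rw [gs]
      exact kb _ (Real.cos_sq_le_one _) x β hβ
    have kc : ∀ x, ∀ β ∈ A, |Gam σ φc x β| ≤ k ^ 2 * κ := by
      intro x β hβ
      rw [gcs, neg_sq]
      exact kb _ (Real.sin_sq_le_one _) x β hβ
    have l0 : 0 < m ^ 3 := by positivity
    have q1 := hP.sq_le H hM hs ss bs ks hT (hC0 φs hs ss bs (fun x hx => by simp [φs, hx])) l0
    have q2 := hP.sq_le H hM hcc sc bc kc hT (hC0 φc hcc sc bc (fun x hx => by simp [φc, hx])) l0
    rw [hP.second H hM hs ss hT] at q1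
    rw [hP.second H hM hcc sc hT] at q2
    have sum : ∫ ω, Ip (Gam σ φs) X α 0 T ω ∂P + ∫ ω, Ip (Gam σ φc) X α 0 T ω ∂P = k ^ 2 * G := by
      rw [hG, ← integral_const_mul, ← integral_add (hP.Ip_Gam_int H hs ss hT) (hP.Ip_Gam_int H hcc sc hT)]
      refine integral_congr_ae (ae_of_all _ fun ω => ?_)
      beta_reduce
      unfold Ip
      rw [← integral_const_mul, ← integral_add (hP.intOn H (Gam_cont H hs) ω 0 T) (hP.intOn H (Gam_cont H hcc) ω 0 T)]
      refine integral_congr_ae (ae_of_all _ fun r => ?_)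
      beta_reduce
      rw [gs, gcs]
      have := Real.sin_sq_add_cos_sq (k * ψ (X r ω))
      linear_combination (k ^ 2 * Gam σ ψ (X r ω) (α r ω)) * this
    have cb : (k ^ 2 * κ * T + 1) * (16 * (k ^ 2 * κ * T + 1) + 35) ≤ k ^ 4 * E := by
      have k2 : 1 ≤ k ^ 2 := one_le_pow₀ k1
      have c0 : 0 ≤ κ * T := by positivity
      have a1 : k ^ 2 * κ * T + 1 ≤ k ^ 2 * (κ * T + 1) := by linarith
      have a2 : 16 * (k ^ 2 * κ * T + 1) + 35 ≤ k ^ 2 * (16 * (κ * T + 1) + 35) := by linarith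
      calc _ ≤ (k ^ 2 * (κ * T + 1)) * (k ^ 2 * (16 * (κ * T + 1) + 35)) :=
            mul_le_mul a1 a2 (by positivity) (by positivity)
        _ = _ := by rw [hE]; ring
    have E0 : 0 ≤ E := by positivity
    have cb2 : 1 / (m ^ 3) ^ 2 * ((k ^ 2 * κ * T + 1) * (16 * (k ^ 2 * κ * T + 1) + 35)) ≤ m ^ 2 * E := by
      refine (mul_le_mul_of_nonneg_left cb (by positivity)).trans_eq ?_
      rw [hk]
      field_simp
    have fin : m ^ 4 * G ≤ 2 * (m ^ 3 * (C0 + E)) := by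
      have : m ^ 2 * E ≤ m ^ 3 * E := mul_le_mul_of_nonneg_right (pow_le_pow_right₀ m1 (by norm_num)) E0
      have e : k ^ 2 * G = m ^ 4 * G := by rw [hk]; ring
      linarith
    rw [mul_one_div, le_div_iff₀ m0]
    have m3 : 0 < m ^ 3 := by positivity
    nlinarith
  have t0 := (tendsto_one_div_add_atTop_nhds_zero_nat (𝕜 := ℝ)).const_mul (2 * (C0 + E))
  rw [mul_zero] at t0
  exact le_antisymm (ge_of_tendsto' t0 main) G0

lemma PathC.const_of_gam (hP : PathC A F X α) (H : Hyp A f σ a) (hM : MartC f a P F X α)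
    {ψ : EN N → ℝ} (h : ContDiff ℝ 2 ψ) (hc : HasCompactSupport ψ) {T : ℝ} 
    (h0 : ∫ ω, Ip (Gam σ ψ) X α 0 T ω ∂P = 0) {t : ℝ} (ht : 0 ≤ t) (htT : t ≤ T) :
    ∀ᵐ ω ∂P, Mp f a ψ X α t ω = Mp f a ψ X α 0 ω := by
  have e := hP.second H hM h hc ht
  have le : ∫ ω, Ip (Gam σ ψ) X α 0 t ω ∂P ≤ 0 := by
    refine le_trans ?_ h0.le
    refine integral_mono (hP.Ip_Gam_int H h hc ht) (hP.Ip_Gam_int H h hc (ht.trans htT)) fun ω => ?_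
    rw [← hP.Ip_add H (Gam_cont H h) ω ht htT]
    have : 0 ≤ Ip (Gam σ ψ) X α t T ω := by
      unfold Ip
      exact integral_nonneg fun r => Gam_nonneg _ _ _
    linarith
  obtain ⟨C, C0, hC⟩ := hP.D_bdd H h hc ht
  have m1 := (hP.D_meas H h ht).mono (F.le _) le_rfl
  have i2 : Integrable (fun ω => (Mp f a ψ X α t ω - Mp f a ψ X α 0 ω) ^ 2) P :=
    Integrable.of_bound (m1.pow_const 2).aestronglyMeasurable (C ^ 2) (ae_of_all _ fun ω => by
      rw [Real.norm_eq_abs, abs_pow]; exact pow_le_pow_left₀ (abs_nonneg _) (hC ω) 2)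
  have z : ∫ ω, (Mp f a ψ X α t ω - Mp f a ψ X α 0 ω) ^ 2 ∂P = 0 :=
    le_antisymm (e.trans_le le) (integral_nonneg fun ω => sq_nonneg _)
  rw [integral_eq_zero_iff_of_nonneg (fun ω => sq_nonneg _) i2] at z
  filter_upwards [z] with ω hω
  have := pow_eq_zero_iff (two_ne_zero) |>.1 hω
  linarith

end gz


section hump
variable {N M : ℕ} {A : Set (EN M)} {f : EN N → EN M → EN N}
    {σ : EN N → EN M → Matrix (Fin N) (Fin M) ℝ}
    {a : EN N → EN M → Matrix (Fin N) (Fin N) ℝ} {Ω : Type*}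

lemma Mp_congr {X : ℝ → Ω → EN N} {α : ℝ → Ω → EN M} {φ ψ : EN N → ℝ} {R T : ℝ} (hT : 0 ≤ T) {ω : Ω}
    (h : ∀ x, ‖x‖ < R → φ x = ψ x) (hX : ∀ r ∈ Icc 0 T, ‖X r ω‖ < R) :
    Mp f a φ X α T ω = Mp f a ψ X α T ω := by
  unfold Mp Ip
  rw [h _ (hX T ⟨hT, le_rfl⟩)]
  congr 1
  refine setIntegral_congr_fun measurableSet_Ioc fun r hr => ?_
  refine gen_congr ?_ _
  have : {y : EN N | ‖y‖ < R} ∈ 𝓝 (X r ω) :=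
    (isOpen_lt continuous_norm continuous_const).mem_nhds (hX r (Ioc_subset_Icc_self hr))
  filter_upwards [this] with y hy using h y hy

lemma Mp_zero {X : ℝ → Ω → EN N} {α : ℝ → Ω → EN M} (T : ℝ) (ω : Ω) :
    Mp f a (fun _ => 0) X α T ω = 0 := by
  unfold Mp Ip
  simp [gen_zero]

/-- time clamp -/
def clampT (T q : ℝ) : ℝ := max 0 (min q T)

lemma clampT_mem {T : ℝ} (hT : 0 ≤ T) (q : ℝ) : clampT T q ∈ Icc 0 T :=
  ⟨le_max_left _ _, max_le hT (min_le_right _ _)⟩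

lemma clampT_eq {T q : ℝ} (hq : q ∈ Icc 0 T) : clampT T q = q := by
  unfold clampT; rw [min_eq_left hq.2, max_eq_right hq.1]

/-- exit event -/
def exitE (X : ℝ → Ω → EN N) (T : ℝ) (R : ℕ) : Set Ω := {ω | ∃ q : ℚ, (R:ℝ) < ‖X (clampT T q) ω‖}

lemma exitE_anti (X : ℝ → Ω → EN N) (T : ℝ) : Antitone (exitE X T) := by
  rintro R R' h ω ⟨q, hq⟩
  exact ⟨q, lt_of_le_of_lt (by exact_mod_cast h) hq⟩

lemma not_exitE {X : ℝ → Ω → EN N} {T : ℝ} {R : ℕ} {ω : Ω} (hc : Continuous fun t => X t ω)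
    (h : ω ∉ exitE X T R) : ∀ r ∈ Icc 0 T, ‖X r ω‖ ≤ R := by
  have cl : IsClosed {r : ℝ | ‖X (clampT T r) ω‖ ≤ R} := by
    refine isClosed_le (hc.norm.comp ?_) continuous_const
    unfold clampT
    fun_prop
  have dn : Dense (range ((↑) : ℚ → ℝ)) := Rat.denseRange_cast
  have sub : range ((↑) : ℚ → ℝ) ⊆ {r : ℝ | ‖X (clampT T r) ω‖ ≤ R} := by
    rintro _ ⟨q, rfl⟩
    by_contra h'
    exact h ⟨q, not_le.1 h'⟩
  intro r hr
  have := cl.closure_subset_iff.2 sub (dn r)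
  simpa [clampT_eq hr] using this

lemma iInter_exitE {X : ℝ → Ω → EN N} {T : ℝ} (hT : 0 ≤ T) (hc : ∀ ω, Continuous fun t => X t ω) :
    ⋂ R, exitE X T R = ∅ := by
  rw [eq_empty_iff_forall_notMem]
  intro ω hω
  obtain ⟨C, hC⟩ := (isCompact_Icc (a := 0) (b := T)).exists_bound_of_continuousOn (hc ω).continuousOn
  obtain ⟨R, hR⟩ := exists_nat_gt C
  obtain ⟨q, hq⟩ := mem_iInter.1 hω R
  have := hC _ (clampT_mem hT q)
  linarith

variable [mΩ : MeasurableSpace Ω] {P : Measure Ω} [IsProbabilityMeasure P] {F : Filtration ℝ mΩ}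
    {X : ℝ → Ω → EN N} {α : ℝ → Ω → EN M}

lemma PathC.exitE_meas (hP : PathC A F X α) (T : ℝ) (R : ℕ) : MeasurableSet (exitE X T R) := by
  have : exitE X T R = ⋃ q : ℚ, {ω | (R:ℝ) < ‖X (clampT T q) ω‖} := by ext; simp [exitE]
  rw [this]
  refine MeasurableSet.iUnion fun q => measurableSet_lt measurable_const ?_
  exact ((hP.X_meas _).mono (F.le _) le_rfl).norm

lemma PathC.exitE_tendsto (hP : PathC A F X α) {T : ℝ} (hT : 0 ≤ T) {g : Ω → ℝ} (hg : Integrable g P) :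
    Tendsto (fun R => ∫ ω in exitE X T R, |g ω| ∂P) atTop (𝓝 0) := by
  have := tendsto_setIntegral_of_antitone (μ := P) (fun R => hP.exitE_meas T R) (exitE_anti X T)
    (f := fun ω => |g ω|) ⟨0, hg.abs.integrableOn⟩
  rw [iInter_exitE hT hP.X_cont] at this
  simpa using this

lemma Mp_add (hP : PathC A F X α) (H : Hyp A f σ a) {φ ψ : EN N → ℝ} (h : ContDiff ℝ 2 φ) (h' : ContDiff ℝ 2 ψ)
    (t : ℝ) (ω : Ω) : Mp f a (fun x => φ x + ψ x) X α t ω = Mp f a φ X α t ω + Mp f a ψ X α t ω := by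
  unfold Mp
  have : Ip (gen f a (fun x => φ x + ψ x)) X α 0 t ω = Ip (gen f a φ) X α 0 t ω + Ip (gen f a ψ) X α 0 t ω := by
    unfold Ip
    rw [← integral_add (hP.intOn H (gen_cont H h) ω 0 t) (hP.intOn H (gen_cont H h') ω 0 t)]
    refine integral_congr_ae (ae_of_all _ fun r => ?_)
    exact gen_add h h' _ _
  rw [this]
  ring

/-- gliding hump -/
lemma PathC.hump (hP : PathC A F X α) (H : Hyp A f σ a) {T : ℝ} (hT : 0 ≤ T)
    (hI : ∀ φ : EN N → ℝ, ContDiff ℝ 2 φ → (∃ K, ∀ y, |φ y| ≤ K) → Integrable (Mp f a φ X α T) P) :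
    ∃ R : ℕ, ∀ φ : EN N → ℝ, ContDiff ℝ 2 φ → HasCompactSupport φ → (∀ x, |φ x| ≤ 2) →
      (∀ x, ‖x‖ ≤ R → φ x = 0) → ∫ ω, |Mp f a φ X α T ω| ∂P ≤ 1 := by
  by_contra hcon
  push Not at hcon
  let Inv : (EN N → ℝ) × ℕ → Prop := fun p => ContDiff ℝ 2 p.1 ∧ (∀ x, (p.2:ℝ) < ‖x‖ → p.1 x = 0) ∧
    (∀ x, |p.1 x| ≤ 2) ∧ ∫ ω in exitE X T p.2, |Mp f a p.1 X α T ω| ∂P ≤ 1/4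
  have step : ∀ p : {p // Inv p}, ∃ p' : {p // Inv p}, p.1.2 + 1 ≤ p'.1.2 ∧
      (∀ x, ‖x‖ ≤ p.1.2 + 1 → p'.1.1 x = p.1.1 x) ∧
      1/2 ≤ ∫ ω in exitE X T p.1.2 \ exitE X T p'.1.2, |Mp f a p'.1.1 X α T ω| ∂P := by
    rintro ⟨⟨Φ, R⟩, c1, c2, c3, c4⟩
    dsimp only at c1 c2 c3 c4 ⊢
    obtain ⟨φ, d1, d2, d3, d4, d5⟩ := hcon (R + 1)
    push_cast at d4
    have iΦ := hI Φ c1 ⟨2, c3⟩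
    have iφ := hI φ d1 ⟨2, d3⟩
    have cs : ContDiff ℝ 2 (fun x => Φ x + φ x) := c1.add d1
    have bs : ∀ x, |Φ x + φ x| ≤ 2 := by
      intro x
      rcases le_or_gt ‖x‖ R with hx | hx
      · rw [d4 x (by linarith), add_zero]; exact c3 x
      · rw [c2 x hx, zero_add]; exact d3 x
    have is := hI _ cs ⟨2, bs⟩
    have lim := (hP.exitE_tendsto hT is).eventually (gt_mem_nhds (by norm_num : (0:ℝ) < 1/4))
    obtain ⟨k, hk⟩ := compact_far d2
    obtain ⟨R', hR', hge⟩ := (lim.and (eventually_ge_atTop (max (R + 1) k))).exists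
    have hge1 := (le_max_left _ _).trans hge
    have hge2 := (le_max_right _ _).trans hge
    have hge1' : (R:ℝ) + 1 ≤ R' := by exact_mod_cast hge1
    have hge2' : (k:ℝ) ≤ R' := by exact_mod_cast hge2
    refine ⟨⟨⟨fun x => Φ x + φ x, R'⟩, cs, ?_, bs, hR'.le⟩, hge1, ?_, ?_⟩
    · intro x hx
      dsimp only at hx ⊢
      rw [c2 x (by linarith), hk x (by linarith), add_zero]
    · intro x hx
      dsimp only
      rw [d4 x hx, add_zero]
    · dsimp only
      have mE := hP.exitE_meas T R
      have z : ∫ ω, |Mp f a φ X α T ω| ∂P = ∫ ω in exitE X T R, |Mp f a φ X α T ω| ∂P := by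
        symm
        refine setIntegral_eq_integral_of_forall_compl_eq_zero fun ω hω => ?_
        have := not_exitE (hP.X_cont ω) hω
        rw [Mp_congr (ψ := fun _ => 0) (R := R + 1) hT (fun x hx => d4 x hx.le) (fun r hr => by
          linarith [this r hr]), Mp_zero, abs_zero]
      have tri : ∫ ω in exitE X T R, |Mp f a φ X α T ω| ∂P ≤
          ∫ ω in exitE X T R, |Mp f a (fun x => Φ x + φ x) X α T ω| ∂P + ∫ ω in exitE X T R, |Mp f a Φ X α T ω| ∂P := by
        rw [← integral_add is.abs.integrableOn iΦ.abs.integrableOn]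
        refine setIntegral_mono iφ.abs.integrableOn (is.abs.add iΦ.abs).integrableOn fun ω => ?_
        beta_reduce
        rw [Mp_add hP H c1 d1]
        have := abs_sub (Mp f a Φ X α T ω + Mp f a φ X α T ω) (Mp f a Φ X α T ω)
        rwa [add_sub_cancel_left] at this
      rw [setIntegral_diff (hP.exitE_meas T R') is.abs.integrableOn (exitE_anti X T (by omega))]
      linarith
  choose nx n1 n2 n3 using step
  let p0 : {p // Inv p} := ⟨⟨fun _ => 0, 0⟩, contDiff_const, by simp, by simp, by
    simp [Mp_zero]⟩
  let s : ℕ → {p // Inv p} := fun k => nx^[k] p0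
  have ss : ∀ k, s (k+1) = nx (s k) := fun k => Function.iterate_succ_apply' nx k p0
  let Φ : ℕ → EN N → ℝ := fun k => (s k).1.1
  let R : ℕ → ℕ := fun k => (s k).1.2
  have hR : ∀ k, R k + 1 ≤ R (k+1) := fun k => by simp only [R, ss]; exact n1 _
  have Rm : Monotone R := monotone_nat_of_le_succ fun k => by have := hR k; omega
  have Rk : ∀ k, k ≤ R k := by
    intro k
    induction k with
    | zero => simp
    | succ k ih => have := hR k; omega
  have eqs : ∀ k x, ‖x‖ ≤ R k + 1 → Φ (k+1) x = Φ k x := fun k x hx => by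
    simp only [Φ, ss]; exact n2 _ x hx
  have eqj : ∀ k j x, k ≤ j → ‖x‖ ≤ R k + 1 → Φ j x = Φ k x := by
    intro k j x hkj hx
    induction j, hkj using Nat.le_induction with
    | base => rfl
    | succ j hj ih =>
      rw [eqs j x, ih]
      have : (R k : ℝ) ≤ R j := by exact_mod_cast Rm hj
      linarith
  let φ : EN N → ℝ := fun x => Φ ⌈‖x‖⌉₊ x
  have hφ : ∀ k x, ‖x‖ < R k + 1 → φ x = Φ k x := by
    intro k x hx
    have h1 : ‖x‖ ≤ R ⌈‖x‖⌉₊ + 1 := by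
      have : (⌈‖x‖⌉₊ : ℝ) ≤ R ⌈‖x‖⌉₊ := by exact_mod_cast Rk _
      linarith [Nat.le_ceil ‖x‖]
    simp only [φ]
    rw [← eqj _ (max k ⌈‖x‖⌉₊) x (le_max_right _ _) h1, ← eqj _ (max k ⌈‖x‖⌉₊) x (le_max_left _ _) hx.le]
  have cφ : ContDiff ℝ 2 φ := by
    rw [contDiff_iff_contDiffAt]
    intro x
    obtain ⟨k, hk⟩ := exists_nat_gt ‖x‖
    have hk' : ‖x‖ < R k + 1 := by
      have : (k:ℝ) ≤ R k := by exact_mod_cast Rk k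
      linarith
    refine ((s k).2.1.contDiffAt (x := x)).congr_of_eventuallyEq ?_
    have : {y : EN N | ‖y‖ < R k + 1} ∈ 𝓝 x :=
      (isOpen_lt continuous_norm continuous_const).mem_nhds hk'
    filter_upwards [this] with y hy using hφ k y hy
  have bφ : ∀ x, |φ x| ≤ 2 := fun x => (s _).2.2.2.1 x
  have iφ := hI φ cφ ⟨2, bφ⟩
  have low : ∀ k, 1/2 ≤ ∫ ω in exitE X T (R k), |Mp f a φ X α T ω| ∂P := by
    intro k
    have e := n3 (s k)
    rw [← ss] at e
    refine e.trans ?_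
    have : ∫ ω in exitE X T (s k).1.2 \ exitE X T (s (k+1)).1.2, |Mp f a (s (k+1)).1.1 X α T ω| ∂P
        = ∫ ω in exitE X T (s k).1.2 \ exitE X T (s (k+1)).1.2, |Mp f a φ X α T ω| ∂P := by
      refine setIntegral_congr_fun ((hP.exitE_meas _ _).diff (hP.exitE_meas _ _)) fun ω hω => ?_
      have := not_exitE (hP.X_cont ω) hω.2
      beta_reduce
      rw [Mp_congr (ψ := (s (k+1)).1.1) (R := R (k+1) + 1) hT (fun x hx => hφ (k+1) x hx) (fun r hr => by
          linarith [this r hr])]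
    rw [this]
    exact setIntegral_mono_set iφ.abs.integrableOn (ae_of_all _ fun ω => abs_nonneg _)
      (HasSubset.Subset.eventuallyLE diff_subset)
  have lim := (hP.exitE_tendsto hT iφ).comp (tendsto_atTop_mono Rk tendsto_id)
  have := ge_of_tendsto' lim low
  norm_num at this

/-- tail condition -/
def TCond (f : EN N → EN M → EN N) (a : EN N → EN M → Matrix (Fin N) (Fin N) ℝ) (P : Measure Ω)
    (X : ℝ → Ω → EN N) (α : ℝ → Ω → EN M) (R : ℕ → ℕ) : Prop :=
  ∀ n : ℕ, ∀ φ : EN N → ℝ, ContDiff ℝ 2 φ → HasCompactSupport φ →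
    (∀ x, ‖x‖ ≤ R n → φ x = 0) → ∀ t : ℝ, 0 ≤ t → t ≤ n → ∀ᵐ ω ∂P, Mp f a φ X α t ω = Mp f a φ X α 0 ω

lemma PathC.tcond (hP : PathC A F X α) (H : Hyp A f σ a) (hM : MartC f a P F X α)
    (hI : ∀ φ : EN N → ℝ, ContDiff ℝ 2 φ → (∃ K, ∀ y, |φ y| ≤ K) → ∀ t, 0 ≤ t → Integrable (Mp f a φ X α t) P) :
    ∃ R : ℕ → ℕ, TCond f a P X α R := by
  have : ∀ n : ℕ, ∃ R : ℕ, ∀ φ : EN N → ℝ, ContDiff ℝ 2 φ → HasCompactSupport φ →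
    (∀ x, ‖x‖ ≤ R → φ x = 0) → ∀ t, 0 ≤ t → t ≤ (n:ℝ) → ∀ᵐ ω ∂P, Mp f a φ X α t ω = Mp f a φ X α 0 ω := by
    intro n
    have n0 : (0:ℝ) ≤ n := Nat.cast_nonneg n
    obtain ⟨R, hR⟩ := hP.hump (P := P) H n0 (fun φ h1 h2 => hI φ h1 h2 n n0)
    refine ⟨R, fun ψ h1 h2 h3 t t0 tn => ?_⟩
    refine hP.const_of_gam H hM h1 h2 (hP.gam_zero H hM h1 h2 n0 (C0 := 3) ?_) t0 tn
    intro φ c1 c2 c3 c4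
    have := hR φ c1 c2 c3 (fun x hx => c4 x (h3 x hx))
    have i1 : Integrable (fun ω => |Mp f a φ X α n ω|) P := (hP.Mp_int H c1 c2 n0).abs
    have le : ∫ ω, |Mp f a φ X α n ω - Mp f a φ X α 0 ω| ∂P ≤ ∫ ω, (|Mp f a φ X α n ω| + 2) ∂P := by
      refine integral_mono_of_nonneg (ae_of_all _ fun ω => abs_nonneg _) (i1.add (integrable_const _)) (ae_of_all _ fun ω => ?_)
      refine (abs_sub _ _).trans (add_le_add le_rfl ?_)
      simpa [Mp, Ip] using c3 (X 0 ω)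
    rw [integral_add i1 (integrable_const _)] at le
    simp at le
    linarith
  choose R hR using this
  exact ⟨R, hR⟩

end hump

section ctrl
variable {N M : ℕ} {A : Set (EN M)} {f : EN N → EN M → EN N}
    {σ : EN N → EN M → Matrix (Fin N) (Fin M) ℝ}
    {a : EN N → EN M → Matrix (Fin N) (Fin N) ℝ} {x : EN N}

instance (c : Control N M A f a x) : MeasurableSpace c.Ω := c.mΩ
instance (c : Control N M A f a x) : IsProbabilityMeasure c.P := c.isProb

lemma Control.pathC (c : Control N M A f a x) : PathC A c.F c.X c.α :=
  ⟨c.X_cont, c.X_prog, c.α_prog, c.α_mem⟩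

lemma Control.martC (c : Control N M A f a x) : MartC f a c.P c.F c.X c.α := by
  intro φ h1 h2 s t hs hst G hG
  have hb : ∃ K, ∀ y, |φ y| ≤ K := h2.exists_bound_of_continuous h1.continuous
  have i2 := c.mart_int φ h1 hb t (hs.trans hst)
  have e := c.mart φ h1 hb s t hs hst
  have := setIntegral_condExp (c.F.le s) i2 hG
  refine this.symm.trans ?_
  refine setIntegral_congr_ae (c.F.le s _ hG) ?_
  filter_upwards [e] with ω hω _ using hω

lemma Control.tcond (c : Control N M A f a x) (H : Hyp A f σ a) : ∃ R : ℕ → ℕ, TCond f a c.P c.X c.α R :=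
  c.pathC.tcond H c.martC fun φ h1 h2 t ht => c.mart_int φ h1 h2 t ht

end ctrl


section conv
variable {N M : ℕ} {A : Set (EN M)} {f : EN N → EN M → EN N}
    {σ : EN N → EN M → Matrix (Fin N) (Fin M) ℝ}
    {a : EN N → EN M → Matrix (Fin N) (Fin N) ℝ} {Ω : Type*}
    [mΩ : MeasurableSpace Ω] {P : Measure Ω} [IsProbabilityMeasure P] {F : Filtration ℝ mΩ}
    {X : ℝ → Ω → EN N} {α : ℝ → Ω → EN M}

lemma PathC.tail_const (hP : PathC A F X α) {R : ℕ → ℕ} (hT : TCond f a P X α R) {n : ℕ}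
    {θ : EN N → ℝ} (h : ContDiff ℝ 2 θ) (h0 : ∀ x, ‖x‖ ≤ R n → θ x = 0) {t : ℝ} (t0 : 0 ≤ t) (tn : t ≤ n) :
    ∀ᵐ ω ∂P, Mp f a θ X α t ω = θ (X 0 ω) := by
  have cut := fun k : ℕ => exists_cut N (k:ℝ) (Nat.cast_nonneg k)
  choose χ c1 c2 c3 c4 c5 using cut
  have ev : ∀ k : ℕ, ∀ᵐ ω ∂P, Mp f a (fun x => θ x * χ k x) X α t ω = Mp f a (fun x => θ x * χ k x) X α 0 ω := by
    intro k
    refine hT n _ (h.mul (c1 k)) (far_compact (k := k + 1) fun x hx => ?_) (fun x hx => ?_) t t0 tn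
    · rw [c5 k x hx, mul_zero]
    · rw [h0 x hx, zero_mul]
  rw [← ae_all_iff] at ev
  filter_upwards [ev] with ω hω
  obtain ⟨C, hC⟩ := (isCompact_Icc (a := 0) (b := t)).exists_bound_of_continuousOn (hP.X_cont ω).continuousOn
  obtain ⟨k, hk⟩ := exists_nat_gt C
  have e : ∀ x, ‖x‖ < (k:ℝ) → θ x = θ x * χ k x := fun x hx => by
    rw [c4 k x (by linarith), mul_one]
  rw [Mp_congr (ψ := fun x => θ x * χ k x) (R := k) t0 e (fun r hr => (hC r hr).trans_lt hk), hω k]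
  simp only [Mp, Ip, Ioc_self, Measure.restrict_empty, integral_zero_measure, sub_zero]
  exact (e _ ((hC 0 ⟨le_rfl, t0⟩).trans_lt hk)).symm

lemma PathC.split (hP : PathC A F X α) (H : Hyp A f σ a) {R : ℕ → ℕ} (hT : TCond f a P X α R) (n : ℕ)
    {φ : EN N → ℝ} (h : ContDiff ℝ 2 φ) (hb : ∃ K, ∀ y, |φ y| ≤ K) : 
    ∃ φ₁ : EN N → ℝ, ∃ ξ : Ω → ℝ, ContDiff ℝ 2 φ₁ ∧ HasCompactSupport φ₁ ∧ Integrable ξ P ∧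
      ∀ t : ℝ, 0 ≤ t → t ≤ n → ∀ᵐ ω ∂P, Mp f a φ X α t ω = Mp f a φ₁ X α t ω + ξ ω := by
  obtain ⟨χ, c1, c2, c3, c4, c5⟩ := exists_cut N (R n : ℝ) (Nat.cast_nonneg _)
  obtain ⟨K, hK⟩ := hb
  have s1 : ContDiff ℝ 2 (fun x => φ x * χ x) := h.mul c1
  have s2 : ContDiff ℝ 2 (fun x => φ x * (1 - χ x)) := h.mul (contDiff_const.sub c1)
  refine ⟨fun x => φ x * χ x, fun ω => φ (X 0 ω) * (1 - χ (X 0 ω)), s1,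
    far_compact (k := R n + 1) fun x hx => ?_, ?_, fun t t0 tn => ?_⟩
  · rw [c5 x hx, mul_zero]
  · have Xm : Measurable (X 0) := (hP.X_meas 0).mono (F.le 0) le_rfl
    refine Integrable.of_bound (s2.continuous.measurable.comp Xm).aestronglyMeasurable K (ae_of_all _ fun ω => ?_)
    rw [Real.norm_eq_abs, abs_mul]
    have e1 : |1 - χ (X 0 ω)| ≤ 1 := by
      rw [abs_le]; constructor <;> linarith [c2 (X 0 ω), c3 (X 0 ω)]
    have e2 := hK (X 0 ω)
    nlinarith [abs_nonneg (φ (X 0 ω)), abs_nonneg (1 - χ (X 0 ω))]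
  · have := hP.tail_const hT (n := n) s2 (fun x hx => by rw [c4 x (by linarith)]; ring) t0 tn
    filter_upwards [this] with ω hω
    beta_reduce at hω
    rw [← hω, ← Mp_add hP H s1 s2]
    congr 1
    ext x
    ring

lemma PathC.full_int (hP : PathC A F X α) (H : Hyp A f σ a) {R : ℕ → ℕ} (hT : TCond f a P X α R)
    {φ : EN N → ℝ} (h : ContDiff ℝ 2 φ) (hb : ∃ K, ∀ y, |φ y| ≤ K) {t : ℝ} (t0 : 0 ≤ t) :
    Integrable (Mp f a φ X α t) P := by
  obtain ⟨n, hn⟩ := exists_nat_ge t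
  obtain ⟨φ₁, ξ, h1, h2, h3, h4⟩ := hP.split H hT n h hb
  exact ((hP.Mp_int H h1 h2 t0).add h3).congr ((h4 t t0 hn).mono fun ω hω => hω.symm)

lemma PathC.full_mart (hP : PathC A F X α) (H : Hyp A f σ a) (hM : MartC f a P F X α) {R : ℕ → ℕ}
    (hT : TCond f a P X α R)
    {φ : EN N → ℝ} (h : ContDiff ℝ 2 φ) (hb : ∃ K, ∀ y, |φ y| ≤ K) {s t : ℝ} (s0 : 0 ≤ s) (hst : s ≤ t) :
    P[Mp f a φ X α t | F s] =ᵐ[P] Mp f a φ X α s := by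
  have t0 := s0.trans hst
  refine hP.mart_cond H h (hP.full_int H hT h hb s0) (hP.full_int H hT h hb t0) fun G hG => ?_
  obtain ⟨n, hn⟩ := exists_nat_ge t
  obtain ⟨φ₁, ξ, h1, h2, h3, h4⟩ := hP.split H hT n h hb
  have key : ∀ r : ℝ, 0 ≤ r → r ≤ n → ∫ ω in G, Mp f a φ X α r ω ∂P =
      ∫ ω in G, Mp f a φ₁ X α r ω ∂P + ∫ ω in G, ξ ω ∂P := by
    intro r r0 rn
    rw [← integral_add (hP.Mp_int H h1 h2 r0).integrableOn h3.integrableOn]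
    exact integral_congr_ae (ae_restrict_of_ae (h4 r r0 rn))
  rw [key t t0 hn, key s s0 (hst.trans hn), hM φ₁ h1 h2 s t s0 hst G hG]

end conv

/-- build a control from its characteristic properties -/
def mkControl {N M : ℕ} {A : Set (EN M)} {f : EN N → EN M → EN N}
    {σ : EN N → EN M → Matrix (Fin N) (Fin M) ℝ}
    {a : EN N → EN M → Matrix (Fin N) (Fin N) ℝ} {Ω : Type}
    [mΩ : MeasurableSpace Ω] {P : Measure Ω} [IsProbabilityMeasure P] {F : Filtration ℝ mΩ}
    {X : ℝ → Ω → EN N} {α : ℝ → Ω → EN M} {x : EN N} {R : ℕ → ℕ}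
    (hP : PathC A F X α) (H : Hyp A f σ a) (hM : MartC f a P F X α)
    (hT : TCond f a P X α R) (hi : ∀ᵐ ω ∂P, X 0 ω = x) : Control N M A f a x where
  Ω := Ω
  P := P
  F := F
  X := X
  α := α
  X_cont := hP.X_cont
  X_prog := hP.X_prog
  α_prog := hP.α_prog
  α_mem := hP.α_mem
  init := hi
  mart_int := fun φ h hb t ht => hP.full_int H hT h hb ht
  mart := fun φ h hb s t hs hst => hP.full_mart H hM hT h hb hs hst


section red
variable {N M : ℕ} {A : Set (EN M)} {f : EN N → EN M → EN N}
    {σ : EN N → EN M → Matrix (Fin N) (Fin M) ℝ}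
    {a : EN N → EN M → Matrix (Fin N) (Fin N) ℝ} {Ω : Type*}
    [mΩ : MeasurableSpace Ω] {F : Filtration ℝ mΩ}
    {X : ℝ → Ω → EN N} {α : ℝ → Ω → EN M}

lemma PathC.Ip_cont (hP : PathC A F X α) (H : Hyp A f σ a) {g : EN N → EN M → ℝ}
    (hg : ContinuousOn (fun p : EN N × EN M => g p.1 p.2) (univ ×ˢ A)) (s : ℝ) (ω : Ω) :
    Continuous (fun t => Ip g X α s t ω) := by
  have ii : ∀ u v, IntervalIntegrable (fun r => g (X r ω) (α r ω)) volume u v := fun u v =>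
    ⟨hP.intOn H hg ω u v, hP.intOn H hg ω v u⟩
  have c := (intervalIntegral.continuous_primitive ii s).comp (continuous_id.max (continuous_const (y := s)))
  refine c.congr fun t => ?_
  simp only [Function.comp, id, Ip]
  rcases le_total s t with h | h
  · rw [max_eq_left h, intervalIntegral.integral_of_le h]
  · rw [max_eq_right h, Ioc_eq_empty (not_lt.2 h)]
    simp

lemma PathC.Mp_cont (hP : PathC A F X α) (H : Hyp A f σ a) {φ : EN N → ℝ} (h : ContDiff ℝ 2 φ) (ω : Ω) :
    Continuous (fun t => Mp f a φ X α t ω) :=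
  (h.continuous.comp (hP.X_cont ω)).sub (hP.Ip_cont H (gen_cont H h) 0 ω)

lemma PathC.Mp_close (hP : PathC A F X α) (H : Hyp A f σ a) {φ ψ : EN N → ℝ} (h : ContDiff ℝ 2 φ)
    (h' : ContDiff ℝ 2 ψ) {ε : ℝ} (he : ∀ x, |φ x - ψ x| ≤ ε ∧ ∀ β ∈ A, |gen f a φ x β - gen f a ψ x β| ≤ ε)
    {t : ℝ} (t0 : 0 ≤ t) (ω : Ω) : |Mp f a φ X α t ω - Mp f a ψ X α t ω| ≤ ε * (1 + t) := by
  have e1 : Ip (gen f a φ) X α 0 t ω - Ip (gen f a ψ) X α 0 t ω =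
      Ip (fun x β => gen f a φ x β - gen f a ψ x β) X α 0 t ω := by
    unfold Ip
    rw [← integral_sub (hP.intOn H (gen_cont H h) ω 0 t) (hP.intOn H (gen_cont H h') ω 0 t)]
  have e2 := Ip_bdd (X := X) (g := fun x β => gen f a φ x β - gen f a ψ x β) hP.α_mem
    (fun x β hβ => (he x).2 β hβ) ω t0
  rw [← e1] at e2
  have e3 := (he (X t ω)).1
  unfold Mp
  rw [abs_le] at *
  constructor <;> nlinarith [e2.1, e2.2, e3.1, e3.2]

/-- small-parameter principle -/
lemma zero_of_small {z C : ℝ} (h : ∀ ε > 0, |z| ≤ ε * C) : z = 0 := by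
  have : Tendsto (fun ε : ℝ => ε * C) (𝓝[>] 0) (𝓝 (0 * C)) :=
    (tendsto_id.mul_const C).mono_left nhdsWithin_le_nhds
  rw [zero_mul] at this
  have h2 := ge_of_tendsto this (eventually_mem_nhdsWithin.mono fun ε hε => h ε hε)
  exact abs_nonpos_iff.1 h2

lemma rat_seq (s : ℝ) (c : ℝ) : ∃ q : ℕ → ℚ, Tendsto (fun n => ((q n : ℚ) : ℝ)) atTop (𝓝 s) ∧
    ∀ n : ℕ, s + c / ((n:ℝ) + 1) < q n ∧ (q n : ℝ) < s + (c + 1) / ((n:ℝ) + 1) := by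
  have : ∀ n : ℕ, ∃ q : ℚ, s + c / ((n:ℝ) + 1) < q ∧ (q : ℝ) < s + (c + 1) / ((n:ℝ) + 1) := fun n => by
    refine exists_rat_btwn ?_
    have : (0:ℝ) < (n:ℝ) + 1 := by positivity
    gcongr
    linarith
  choose q hq using this
  refine ⟨q, ?_, hq⟩
  have t : ∀ d : ℝ, Tendsto (fun n : ℕ => s + d / ((n:ℝ) + 1)) atTop (𝓝 s) := fun d => by
    have := (tendsto_one_div_add_atTop_nhds_zero_nat (𝕜 := ℝ)).const_mul d
    simp only [mul_zero, mul_one_div] at this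
    simpa using this.const_add s
  exact tendsto_of_tendsto_of_tendsto_of_le_of_le (t c) (t (c+1)) (fun n => (hq n).1.le) (fun n => (hq n).2.le)

/-- countable reduction of the martingale property -/
lemma PathC.martC_countable (hP : PathC A F X α) (H : Hyp A f σ a)
    (hF : ∀ s, ∃ C : Set (Set Ω), C.Countable ∧ IsPiSystem C ∧ F s = MeasurableSpace.generateFrom C) :
    ∃ S : Set (Ω → ℝ), S.Countable ∧ (∀ m ∈ S, Measurable m ∧ ∃ K, ∀ ω, |m ω| ≤ K) ∧
      ∀ (P : Measure Ω) [IsProbabilityMeasure P], MartC f a P F X α ↔ ∀ m ∈ S, ∫ ω, m ω ∂P = 0 := by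
  classical
  choose C Cc Cp Cg using hF
  obtain ⟨D, hDT, Dc, Dd⟩ := exists_dense H {φ : EN N → ℝ | ContDiff ℝ 2 φ ∧ HasCompactSupport φ} (fun φ h => h)
  let mf : (EN N → ℝ) → ℝ → ℝ → Set Ω → Ω → ℝ := fun φ s u G =>
    G.indicator (fun ω => Mp f a φ X α u ω - Mp f a φ X α s ω)
  let S : Set (Ω → ℝ) := {m | ∃ φ ∈ D, ∃ s u : ℚ, (0:ℝ) ≤ s ∧ (s:ℝ) ≤ u ∧ ∃ G ∈ insert univ (C s), m = mf φ s u G}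
  have Gm : ∀ (s : ℝ), ∀ G ∈ insert univ (C s), MeasurableSet[F s] G := by
    rintro s G (rfl | hG)
    · exact MeasurableSet.univ
    · rw [Cg s]; exact MeasurableSpace.measurableSet_generateFrom hG
  refine ⟨S, ?_, ?_, ?_⟩
  · have : S = ⋃ φ ∈ D, ⋃ s : ℚ, ⋃ u : ℚ, ⋃ G ∈ insert univ (C s), {m | (0:ℝ) ≤ s ∧ (s:ℝ) ≤ u ∧ m = mf φ s u G} := by
      ext m
      simp only [S, mem_setOf_eq, mem_iUnion, exists_prop]
      constructor
      · rintro ⟨φ, h1, s, u, h2, h3, G, h4, h5⟩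
        exact ⟨φ, h1, s, u, G, h4, h2, h3, h5⟩
      · rintro ⟨φ, h1, s, u, G, h4, h2, h3, h5⟩
        exact ⟨φ, h1, s, u, h2, h3, G, h4, h5⟩
    rw [this]
    refine Dc.biUnion fun φ _ => countable_iUnion fun s => countable_iUnion fun u =>
      ((Cc s).insert univ).biUnion fun G _ => ?_
    exact (countable_singleton (mf φ s u G)).mono fun m hm => hm.2.2
  · rintro _ ⟨φ, hφ, s, u, s0, su, G, hG, rfl⟩
    obtain ⟨h1, h2⟩ := hDT hφ
    refine ⟨?_, ?_⟩
    · refine Measurable.indicator ?_ (F.le _ _ (Gm s G hG))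
      exact ((hP.Mp_meas H h1 u).mono (F.le _) le_rfl).sub ((hP.Mp_meas H h1 s).mono (F.le _) le_rfl)
    · obtain ⟨K, K0, hK⟩ := hP.Mp_bdd H h1 h2
      refine ⟨K * (1 + u) + K * (1 + s), fun ω => ?_⟩
      simp only [mf]
      by_cases hω : ω ∈ G
      · rw [indicator_of_mem hω]
        exact (abs_sub _ _).trans (add_le_add (hK u (s0.trans su) ω) (hK s s0 ω))
      · rw [indicator_of_notMem hω, abs_zero]
        have := s0.trans su
        positivity
  · intro P _
    have eqv : ∀ φ : EN N → ℝ, ContDiff ℝ 2 φ → HasCompactSupport φ → ∀ s u : ℝ, 0 ≤ s → s ≤ u → ∀ G,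
        MeasurableSet G → (∫ ω, mf φ s u G ω ∂P = ∫ ω in G, Mp f a φ X α u ω ∂P - ∫ ω in G, Mp f a φ X α s ω ∂P) := by
      intro φ h1 h2 s u s0 su G hG
      simp only [mf]
      rw [integral_indicator hG, integral_sub (hP.Mp_int H h1 h2 (s0.trans su)).integrableOn (hP.Mp_int H h1 h2 s0).integrableOn]
    constructor
    · rintro hM _ ⟨φ, hφ, s, u, s0, su, G, hG, rfl⟩
      obtain ⟨h1, h2⟩ := hDT hφ
      rw [eqv φ h1 h2 s u s0 su G (F.le _ _ (Gm s G hG)), hM φ h1 h2 s u s0 su G (Gm s G hG), sub_self]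
    · intro hS
      -- step 1: all G, rational times, D
      have st1 : ∀ φ ∈ D, ∀ s u : ℚ, (0:ℝ) ≤ s → (s:ℝ) ≤ u → ∀ G, MeasurableSet[F s] G →
          ∫ ω in G, Mp f a φ X α u ω ∂P = ∫ ω in G, Mp f a φ X α s ω ∂P := by
        intro φ hφ s u s0 su
        obtain ⟨h1, h2⟩ := hDT hφ
        have i1 := hP.Mp_int (P := P) H h1 h2 (s0.trans su)
        have i2 := hP.Mp_int (P := P) H h1 h2 s0
        have bas : ∀ G ∈ insert univ (C s), ∫ ω in G, Mp f a φ X α u ω ∂P = ∫ ω in G, Mp f a φ X α s ω ∂P := by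
          intro G hG
          have := hS _ ⟨φ, hφ, s, u, s0, su, G, hG, rfl⟩
          rw [eqv φ h1 h2 s u s0 su G (F.le _ _ (Gm s G hG))] at this
          linarith
        intro G hG
        induction G, hG using MeasurableSpace.induction_on_inter (Cg s) (Cp s) with
        | empty => simp
        | basic G hG => exact bas G (Or.inr hG)
        | compl G hG ih =>
          have hG' := F.le _ _ hG
          have e1 := integral_add_compl hG' i1
          have e2 := integral_add_compl hG' i2
          have e3 := bas univ (Or.inl rfl)
          simp only [setIntegral_univ] at e3
          linarith
        | iUnion g hd hg ih =>
          rw [integral_iUnion (fun i => F.le _ _ (hg i)) hd i1.integrableOn,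
            integral_iUnion (fun i => F.le _ _ (hg i)) hd i2.integrableOn]
          exact tsum_congr ih
      -- step 2 : all φ
      have st2 : ∀ φ, ContDiff ℝ 2 φ → HasCompactSupport φ → ∀ s u : ℚ, (0:ℝ) ≤ s → (s:ℝ) ≤ u → ∀ G, MeasurableSet[F s] G →
          ∫ ω in G, Mp f a φ X α u ω ∂P = ∫ ω in G, Mp f a φ X α s ω ∂P := by
        intro φ h1 h2 s u s0 su G hG
        rw [← sub_eq_zero]
        refine zero_of_small (C := (1 + u) + (1 + s)) fun ε hε => ?_
        obtain ⟨ψ, hψ, hc⟩ := Dd φ ⟨h1, h2⟩ ε hε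
        obtain ⟨h3, h4⟩ := hDT hψ
        have cl : ∀ t : ℝ, 0 ≤ t → |∫ ω in G, Mp f a φ X α t ω ∂P - ∫ ω in G, Mp f a ψ X α t ω ∂P| ≤ ε * (1 + t) := by
          intro t t0
          rw [← integral_sub (hP.Mp_int H h1 h2 t0).integrableOn (hP.Mp_int H h3 h4 t0).integrableOn]
          have := norm_setIntegral_le_of_norm_le_const (μ := P) (s := G) (C := ε * (1 + t))
            (f := fun ω => Mp f a φ X α t ω - Mp f a ψ X α t ω) (measure_lt_top _ _)
            (fun ω _ => hP.Mp_close H h1 h3 hc t0 ω)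
          refine this.trans ?_
          have h5 : P.real G ≤ 1 := measureReal_le_one
          have : 0 ≤ ε * (1 + t) := by positivity
          nlinarith
        have c1 := cl u (s0.trans su)
        have c2 := cl s s0
        have c3 := st1 ψ hψ s u s0 su G hG
        rw [c3] at c1
        rw [abs_le] at *
        constructor <;> nlinarith [c1.1, c1.2, c2.1, c2.2]
      -- step 3 : real times
      intro φ h1 h2 s u s0 su G hG
      obtain ⟨q, hq, hq'⟩ := rat_seq s 0
      obtain ⟨p, hp, hp'⟩ := rat_seq u 1
      obtain ⟨K, K0, hK⟩ := hP.Mp_bdd H h1 h2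
      have pos : ∀ n : ℕ, (0:ℝ) < 1 / ((n:ℝ) + 1) := fun n => by positivity
      have le1 : ∀ n : ℕ, 1 / ((n:ℝ) + 1) ≤ 1 := fun n => by
        rw [div_le_one (by positivity)]; linarith [(Nat.cast_nonneg n : (0:ℝ) ≤ n)]
      have qb : ∀ n : ℕ, s < q n ∧ (q n : ℝ) < s + 1 / ((n:ℝ) + 1) := fun n => by simpa using hq' n
      have pb : ∀ n : ℕ, u + 1 / ((n:ℝ) + 1) < p n ∧ (p n : ℝ) < u + 2 := fun n => by
        refine ⟨(hp' n).1, (hp' n).2.trans_le ?_⟩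
        have := le1 n
        have e : (1 + 1 : ℝ) / ((n:ℝ) + 1) = 1 / ((n:ℝ) + 1) + 1 / ((n:ℝ) + 1) := by ring
        rw [e]; linarith
      have dct : ∀ (r : ℝ) (t : ℕ → ℚ), Tendsto (fun n => ((t n:ℚ):ℝ)) atTop (𝓝 r) → (∀ n, 0 ≤ (t n : ℝ) ∧ (t n : ℝ) ≤ u + 2) →
          Tendsto (fun n => ∫ ω in G, Mp f a φ X α (t n) ω ∂P) atTop (𝓝 (∫ ω in G, Mp f a φ X α r ω ∂P)) := by
        intro r t ht hb
        refine tendsto_integral_of_dominated_convergence (fun _ => K * (1 + (u + 2))) (fun n => ?_)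
          (integrable_const _) (fun n => ae_of_all _ fun ω => ?_) (ae_of_all _ fun ω => ?_)
        · exact ((hP.Mp_meas H h1 _).mono (F.le _) le_rfl).aestronglyMeasurable
        · refine (hK _ (hb n).1 ω).trans ?_
          have := (hb n).2
          gcongr
        · exact ((hP.Mp_cont H h1 ω).tendsto r).comp ht
      have t1 := dct s q hq (fun n => ⟨s0.trans (qb n).1.le, by linarith [(qb n).2, le1 n]⟩)
      have t2 := dct u p hp (fun n => ⟨by linarith [(pb n).1, pos n], (pb n).2.le⟩)
      refine tendsto_nhds_unique t2 (t1.congr fun n => ?_)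
      symm
      refine st2 φ h1 h2 (q n) (p n) (s0.trans (qb n).1.le) (by linarith [(qb n).2, (pb n).1]) G ?_
      exact F.mono (qb n).1.le _ hG

/-- countable reduction of the tail condition -/
lemma PathC.tcond_countable (hP : PathC A F X α) (H : Hyp A f σ a) :
    ∃ S : ℕ → ℕ → Set (Ω → ℝ), (∀ n R, (S n R).Countable) ∧
      (∀ n R, ∀ m ∈ S n R, Measurable m ∧ ∃ K, ∀ ω, |m ω| ≤ K) ∧
      ∀ (P : Measure Ω) [IsProbabilityMeasure P] (R : ℕ → ℕ), TCond f a P X α R ↔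
        ∀ n, ∀ m ∈ S n (R n), ∫ ω, m ω ∂P = 0 := by
  have hd := fun R : ℕ => exists_dense H {φ : EN N → ℝ | (ContDiff ℝ 2 φ ∧ HasCompactSupport φ) ∧
    ∀ x, ‖x‖ ≤ R → φ x = 0} (fun φ h => h.1)
  choose D hDT Dc Dd using hd
  let mf : (EN N → ℝ) → ℝ → Ω → ℝ := fun φ t ω => |Mp f a φ X α t ω - Mp f a φ X α 0 ω|
  let S : ℕ → ℕ → Set (Ω → ℝ) := fun n R => {m | ∃ φ ∈ D R, ∃ q : ℚ, m = mf φ (clampT n q)}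
  have n0 : ∀ n : ℕ, (0:ℝ) ≤ n := fun n => Nat.cast_nonneg n
  have mm : ∀ n R, ∀ m ∈ S n R, Measurable m ∧ ∃ K, ∀ ω, |m ω| ≤ K := by
    rintro n R _ ⟨φ, hφ, q, rfl⟩
    obtain ⟨⟨h1, h2⟩, h3⟩ := hDT R hφ
    have t0 := (clampT_mem (n0 n) q).1
    obtain ⟨K, K0, hK⟩ := hP.D_bdd H h1 h2 t0
    refine ⟨?_, K, fun ω => ?_⟩
    · exact ((hP.D_meas H h1 t0).mono (F.le _) le_rfl).abs
    · simp only [mf]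
      rw [abs_abs]
      exact hK ω
  refine ⟨S, fun n R => ?_, mm, ?_⟩
  · have : S n R = ⋃ φ ∈ D R, ⋃ q : ℚ, {mf φ (clampT n q)} := by
      ext m
      simp only [S, mem_setOf_eq, mem_iUnion, exists_prop, mem_singleton_iff]
    rw [this]
    exact (Dc R).biUnion fun φ _ => countable_iUnion fun q => countable_singleton _
  · intro P _ R
    constructor
    · rintro hT n _ ⟨φ, hφ, q, rfl⟩
      obtain ⟨⟨h1, h2⟩, h3⟩ := hDT (R n) hφ
      have := hT n φ h1 h2 h3 (clampT n q) (clampT_mem (n0 n) q).1 (clampT_mem (n0 n) q).2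
      rw [integral_eq_zero_of_ae]
      filter_upwards [this] with ω hω
      simp [mf, hω]
    · intro hS n φ h1 h2 h3 t t0 tn
      choose ψ hψ hc using fun k : ℕ => Dd (R n) φ ⟨⟨h1, h2⟩, h3⟩ (1 / ((k:ℝ) + 1)) (by positivity)
      have ev : ∀ k : ℕ, ∀ q : ℚ, ∀ᵐ ω ∂P, Mp f a (ψ k) X α (clampT n q) ω = Mp f a (ψ k) X α 0 ω := by
        intro k q
        have hmem : mf (ψ k) (clampT n q) ∈ S n (R n) := ⟨ψ k, hψ k, q, rfl⟩
        have z := hS n _ hmem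
        obtain ⟨m1, K, hK⟩ := mm n (R n) _ hmem
        rw [integral_eq_zero_iff_of_nonneg (fun ω => abs_nonneg _)
          (Integrable.of_bound m1.aestronglyMeasurable K (ae_of_all _ hK))] at z
        filter_upwards [z] with ω hω
        have : |Mp f a (ψ k) X α (clampT n q) ω - Mp f a (ψ k) X α 0 ω| = 0 := hω
        exact sub_eq_zero.1 (abs_eq_zero.1 this)
      simp only [← ae_all_iff] at ev
      filter_upwards [ev] with ω hω
      -- first extend to time t
      have ev2 : ∀ k, Mp f a (ψ k) X α t ω = Mp f a (ψ k) X α 0 ω := by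
        intro k
        have hψ1 := (hDT (R n) (hψ k)).1.1
        have cc : Continuous (fun r : ℝ => Mp f a (ψ k) X α (clampT n r) ω) := by
          refine (hP.Mp_cont H hψ1 ω).comp ?_
          unfold clampT; fun_prop
        have cl : IsClosed {r : ℝ | Mp f a (ψ k) X α (clampT n r) ω = Mp f a (ψ k) X α 0 ω} :=
          isClosed_eq cc continuous_const
        have dn : Dense (range ((↑) : ℚ → ℝ)) := Rat.denseRange_cast
        have := cl.closure_subset_iff.2 (by rintro _ ⟨q, rfl⟩; exact hω k q) (dn t)
        simpa [clampT_eq (show t ∈ Icc (0:ℝ) n from ⟨t0, tn⟩)] using this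
      have lim : ∀ r : ℝ, 0 ≤ r → Tendsto (fun k => Mp f a (ψ k) X α r ω) atTop (𝓝 (Mp f a φ X α r ω)) := by
        intro r r0
        rw [tendsto_iff_dist_tendsto_zero]
        have t := (tendsto_one_div_add_atTop_nhds_zero_nat (𝕜 := ℝ)).mul_const (1 + r)
        rw [zero_mul] at t
        refine squeeze_zero (fun _ => dist_nonneg) (fun k => ?_) t
        rw [dist_comm, Real.dist_eq]
        exact hP.Mp_close H h1 (hDT (R n) (hψ k)).1.1 (hc k) r0 ω
      exact tendsto_nhds_unique (lim t t0) ((lim 0 le_rfl).congr fun k => (ev2 k).symm)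

end red

section canon

/-- canonical path space -/
abbrev CS (N M : ℕ) := C(ℝ, EN N × EN M)

instance instMeasCS (N M : ℕ) : MeasurableSpace (CS N M) := borel _
instance instBorelCS (N M : ℕ) : BorelSpace (CS N M) := ⟨rfl⟩
instance instNonemptyCS (N M : ℕ) : Nonempty (CS N M) := ⟨ContinuousMap.const ℝ 0⟩

variable {N M : ℕ}

lemma CS_ev_cont (r : ℝ) : Continuous (fun ω : CS N M => ω r) := by fun_prop

lemma CS_meas_iff {Z : Type*} [MeasurableSpace Z] {Φ : Z → CS N M}
    (h : ∀ q : ℚ, Measurable fun z => Φ z q) : Measurable Φ := by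
  let e : CS N M → (ℚ → EN N × EN M) := fun ω q => ω q
  have ec : Continuous e := continuous_pi fun q => CS_ev_cont _
  have ei : Function.Injective e := by
    intro ω ω' hh
    ext1 r
    have : (ω : ℝ → EN N × EN M) = ω' := by
      refine Continuous.ext_on (Rat.denseRange_cast (𝕜 := ℝ)) ω.continuous ω'.continuous ?_
      rintro _ ⟨q, rfl⟩
      exact congrFun hh q
    rw [this]
  have em : MeasurableEmbedding e := ec.measurableEmbedding ei
  exact em.measurable_comp_iff.1 (measurable_pi_iff.2 h)

/-- stopped evaluation map -/
def stopEv (s : ℝ) (ω : CS N M) : ℚ → EN N × EN M := fun q => ω (min (q:ℝ) s)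

lemma stopEv_ev {s r : ℝ} (h : r ≤ s) :
    Measurable[MeasurableSpace.comap (stopEv (N := N) (M := M) s) inferInstance] (fun ω : CS N M => ω r) := by
  letI := MeasurableSpace.comap (stopEv (N := N) (M := M) s) inferInstance
  obtain ⟨q, hq, -⟩ := rat_seq r 0
  refine measurable_of_tendsto_metrizable (f := fun (n : ℕ) (ω : CS N M) => stopEv s ω (q n)) (fun n => ?_) ?_
  · exact (measurable_pi_apply (q n)).comp (comap_measurable (stopEv s))
  · rw [tendsto_pi_nhds]
    intro ω
    have : Tendsto (fun n => min ((q n : ℚ) : ℝ) s) atTop (𝓝 (min r s)) := hq.min tendsto_const_nhds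
    rw [min_eq_left h] at this
    exact (ω.continuous.tendsto r).comp this

/-- canonical filtration -/
def GF (N M : ℕ) : Filtration ℝ (instMeasCS N M) where
  seq s := MeasurableSpace.comap (stopEv s) inferInstance
  mono' s t hst := by
    refine Measurable.comap_le ?_
    letI := MeasurableSpace.comap (stopEv (N := N) (M := M) t) inferInstance
    exact measurable_pi_iff.2 fun q => stopEv_ev ((min_le_right _ _).trans hst)
  le' s := by
    refine Measurable.comap_le ?_
    exact measurable_pi_iff.2 fun q => (CS_ev_cont _).measurable

lemma GF_pi (s : ℝ) : ∃ C : Set (Set (CS N M)), C.Countable ∧ IsPiSystem C ∧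
    GF N M s = MeasurableSpace.generateFrom C := by
  letI m : MeasurableSpace (CS N M) := GF N M s
  have h : @MeasurableSpace.CountablyGenerated (CS N M) m :=
    MeasurableSpace.CountablyGenerated.comap (stopEv (N := N) (M := M) s)
  obtain ⟨b, bc, hb⟩ := h.isCountablyGenerated
  refine ⟨generateSetAlgebra b, countable_generateSetAlgebra bc, ?_, ?_⟩
  · exact (isSetAlgebra_generateSetAlgebra (𝒜 := b)).isSetRing.isSetSemiring.isPiSystem
  · rw [generateFrom_generateSetAlgebra_eq]; exact hb

/-- state part -/
def XX (s : ℝ) (ω : CS N M) : EN N := (ω s).1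
/-- difference quotients of the integrated control -/
def dqY (n : ℕ) (s : ℝ) (ω : CS N M) : EN M := ((n:ℝ) + 1) • ((ω s).2 - (ω (s - 1 / ((n:ℝ) + 1))).2)
open Classical in
/-- decoded control -/
def AA (A : Set (EN M)) (a0 : EN M) (s : ℝ) (ω : CS N M) : EN M :=
  if limUnder atTop (fun n => dqY n s ω) ∈ A then limUnder atTop (fun n => dqY n s ω) else a0

lemma CS_pathC {A : Set (EN M)} (hA : IsClosed A) {a0 : EN M} (ha0 : a0 ∈ A) :
    PathC A (GF N M) (XX (N := N)) (AA A a0) := by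
  have ad : ∀ r s : ℝ, r ≤ s → Measurable[GF N M s] (fun ω : CS N M => ω r) := fun r s h => stopEv_ev h
  refine ⟨fun ω => ?_, ?_, ?_, fun t ω => ?_⟩
  · exact continuous_fst.comp ω.continuous
  · refine StronglyAdapted.isStronglyProgressive_of_continuous (fun s => ?_) (fun ω => continuous_fst.comp ω.continuous)
    letI := GF N M s
    exact (measurable_fst.comp (ad s s le_rfl)).stronglyMeasurable
  · have h1 : ∀ n, IsStronglyProgressive (GF N M) (dqY (N := N) (M := M) n) := fun n => by
      refine StronglyAdapted.isStronglyProgressive_of_continuous (fun s => ?_) (fun ω => ?_)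
      · have a1 := ad s s le_rfl
        have a2 := ad (s - 1 / ((n:ℝ) + 1)) s (by have : 0 < 1 / ((n:ℝ) + 1) := by positivity
                                                  linarith)
        letI := GF N M s
        exact (((measurable_snd.comp a1).sub (measurable_snd.comp a2)).const_smul ((n:ℝ) + 1)).stronglyMeasurable
      · have := ω.continuous
        unfold dqY
        fun_prop
    intro t
    letI := (GF N M) t
    have h2 : StronglyMeasurable (fun p : Iic t × CS N M => limUnder atTop (fun n => dqY n p.1 p.2)) :=
      StronglyMeasurable.limUnder (fun n => h1 n t)
    refine StronglyMeasurable.ite ?_ h2 stronglyMeasurable_const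
    exact h2.measurable hA.measurableSet
  · unfold AA
    split_ifs with h
    · exact h
    · exact ha0

section enc
variable {A : Set (EN M)} {f : EN N → EN M → EN N}
    {σ : EN N → EN M → Matrix (Fin N) (Fin M) ℝ}
    {a : EN N → EN M → Matrix (Fin N) (Fin N) ℝ} {Ω : Type*}
    [mΩ : MeasurableSpace Ω] {F : Filtration ℝ mΩ}
    {X : ℝ → Ω → EN N} {α : ℝ → Ω → EN M}

/-- coordinate functions of the control variable -/
def cg {N M : ℕ} (i : Fin M) (_ : EN N) (β : EN M) : ℝ := β i

lemma coord_cont (i : Fin M) : ContinuousOn (fun p : EN N × EN M => cg i p.1 p.2) (univ ×ˢ A) := by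
  unfold cg
  apply Continuous.continuousOn
  fun_prop

/-- encoding of the future after time `t` -/
def Enc (hP : PathC A F X α) (H : Hyp A f σ a) (t : ℝ) (ω : Ω) : CS N M where
  toFun s := (X (t + max s 0) ω, WithLp.toLp 2 fun i => Ip (cg i) X α t (t + max s 0) ω)
  continuous_toFun := by
    refine Continuous.prodMk ((hP.X_cont ω).comp (by fun_prop)) ?_
    refine (PiLp.continuous_toLp 2 _).comp (continuous_pi fun i => ?_)
    exact (hP.Ip_cont H (coord_cont i) t ω).comp (by fun_prop)

lemma Enc_meas (hP : PathC A F X α) (H : Hyp A f σ a) (t : ℝ) {s : ℝ} (s0 : 0 ≤ s) :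
    @Measurable _ _ (F (t + s)) (GF N M s) (Enc hP H t) := by
  refine Measurable.of_comap_le ?_
  show MeasurableSpace.comap _ (MeasurableSpace.comap _ _) ≤ _
  rw [MeasurableSpace.comap_comp]
  refine Measurable.comap_le ?_
  have hle : ∀ q : ℚ, t + max (min (q:ℝ) s) 0 ≤ t + s := fun q => by
    have : max (min (q:ℝ) s) 0 ≤ s := max_le (min_le_right _ _) s0
    linarith
  have m1 : ∀ q : ℚ, Measurable[F (t + s)] (X (t + max (min (q:ℝ) s) 0)) := fun q =>
    (hP.X_meas _).mono (F.mono (hle q)) le_rfl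
  have m2 : ∀ q : ℚ, ∀ i, Measurable[F (t + s)] (Ip (cg i) X α t (t + max (min (q:ℝ) s) 0)) := fun q i =>
    (hP.Ip_meas H (coord_cont i) t _).mono (F.mono (hle q)) le_rfl
  letI := F (t + s)
  refine measurable_pi_iff.2 fun q => ?_
  refine Measurable.prodMk (m1 q) ?_
  exact (WithLp.measurable_toLp 2 _).comp (measurable_pi_iff.2 fun i => m2 q i)

lemma Enc_meas' (hP : PathC A F X α) (H : Hyp A f σ a) (t : ℝ) : Measurable (Enc hP H t) := by
  refine CS_meas_iff fun q => ?_
  refine Measurable.prodMk ?_ ?_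
  · exact (hP.X_meas _).mono (F.le _) le_rfl
  · refine (WithLp.measurable_toLp 2 _).comp (measurable_pi_iff.2 fun i => ?_)
    exact (hP.Ip_meas H (coord_cont i) t _).mono (F.le _) le_rfl

lemma XX_Enc (hP : PathC A F X α) (H : Hyp A f σ a) (t : ℝ) {s : ℝ} (s0 : 0 ≤ s) (ω : Ω) :
    XX s (Enc hP H t ω) = X (t + s) ω := by
  simp [XX, Enc, max_eq_left s0]

lemma AA_Enc (hP : PathC A F X α) (H : Hyp A f σ a) (a0 : EN M) (t : ℝ) (ω : Ω) :
    ∀ᵐ s : ℝ, 0 < s → AA A a0 s (Enc hP H t ω) = α (t + s) ω := by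
  have li : ∀ i, ∀ᵐ r : ℝ, ∀ c, HasDerivAt (fun u => ∫ v in c..u, (α v ω) i) ((α r ω) i) r := fun i => by
    refine LocallyIntegrable.ae_hasDerivAt_integral ?_
    rw [locallyIntegrable_iff]
    intro K hK
    obtain ⟨R, hR⟩ := hK.isBounded.subset_closedBall 0
    refine IntegrableOn.mono_set (t := Ioc (-R-1) (R+1)) (hP.intOn H (coord_cont (N := N) i) ω _ _) (hR.trans ?_)
    intro r hr
    simp only [Metric.mem_closedBall, dist_zero_right, Real.norm_eq_abs] at hr
    rw [abs_le] at hr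
    constructor <;> linarith [hr.1, hr.2]
  have li2 := ae_all_iff.2 li
  have li3 := (quasiMeasurePreserving_add_left volume t).ae li2
  filter_upwards [li3] with s hs s0
  have lim : Tendsto (fun n : ℕ => dqY n s (Enc hP H t ω)) atTop (𝓝 (α (t + s) ω)) := by
    have e : Tendsto (fun n : ℕ => (WithLp.ofLp (dqY n s (Enc hP H t ω)) : Fin M → ℝ)) atTop
        (𝓝 (WithLp.ofLp (α (t + s) ω))) := by
      rw [tendsto_pi_nhds]
      intro i
      have d := hasDerivAt_iff_tendsto_slope_zero.1 (hs i t)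
      have u : Tendsto (fun n : ℕ => - (1 / ((n:ℝ) + 1))) atTop (𝓝[≠] 0) := by
        refine tendsto_nhdsWithin_iff.2 ⟨?_, Eventually.of_forall fun n => ?_⟩
        · simpa using (tendsto_one_div_add_atTop_nhds_zero_nat (𝕜 := ℝ)).neg
        · have : 0 < 1 / ((n:ℝ) + 1) := by positivity
          simp only [mem_compl_iff, mem_singleton_iff]
          linarith
      refine (d.comp u).congr' ?_
      have ev : ∀ᶠ n : ℕ in atTop, 1 / ((n:ℝ) + 1) < s :=
        (tendsto_one_div_add_atTop_nhds_zero_nat (𝕜 := ℝ)).eventually_lt_const s0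
      filter_upwards [ev] with n hn
      have np : (0:ℝ) < (n:ℝ) + 1 := by positivity
      simp only [Function.comp, dqY, Enc, ContinuousMap.coe_mk, PiLp.smul_apply, PiLp.sub_apply, smul_eq_mul]
      rw [max_eq_left s0.le, max_eq_left (by linarith), intervalIntegral.integral_of_le (by linarith),
        intervalIntegral.integral_of_le (by linarith)]
      simp only [Ip, cg]
      rw [show t + s + -(1 / ((n:ℝ) + 1)) = t + (s - 1 / ((n:ℝ) + 1)) by ring]
      rw [show (-(1 / ((n:ℝ) + 1)))⁻¹ = -((n:ℝ)+1) by field_simp]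
      ring
    have := ((PiLp.continuous_toLp 2 (fun _ : Fin M => ℝ)).tendsto _).comp e
    simpa [Function.comp_def] using this
  unfold AA
  rw [lim.limUnder_eq, if_pos (hP.α_mem _ _)]

lemma Ip_Enc (hP : PathC A F X α) (H : Hyp A f σ a) (a0 : EN M) (g : EN N → EN M → ℝ) (t : ℝ) {s u : ℝ} (s0 : 0 ≤ s)
    (ω : Ω) : Ip g XX (AA A a0) s u (Enc hP H t ω) = Ip g X α (t + s) (t + u) ω := by
  unfold Ip
  rcases le_total s u with hsu | hsu
  · have e1 : ∫ r in Ioc s u, g (XX r (Enc hP H t ω)) (AA A a0 r (Enc hP H t ω)) = ∫ r in Ioc s u, g (X (t + r) ω) (α (t + r) ω) := by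
      refine setIntegral_congr_ae measurableSet_Ioc ?_
      filter_upwards [AA_Enc hP H a0 t ω] with r hr hr2
      have : 0 < r := s0.trans_lt hr2.1
      rw [hr this, XX_Enc hP H t this.le]
    rw [e1, ← intervalIntegral.integral_of_le hsu, ← intervalIntegral.integral_of_le (by linarith),
      intervalIntegral.integral_comp_add_left (fun r => g (X r ω) (α r ω)) t]
  · rw [Ioc_eq_empty (not_lt.2 hsu), Ioc_eq_empty (not_lt.2 (by linarith))]
    simp

lemma Mp_Enc (hP : PathC A F X α) (H : Hyp A f σ a) (a0 : EN M) {φ : EN N → ℝ} (h : ContDiff ℝ 2 φ) {t u : ℝ}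
    (t0 : 0 ≤ t) (u0 : 0 ≤ u)
    (ω : Ω) : Mp f a φ XX (AA A a0) u (Enc hP H t ω) = Mp f a φ X α (t + u) ω + Ip (gen f a φ) X α 0 t ω := by
  unfold Mp
  rw [XX_Enc hP H t u0, Ip_Enc hP H a0 _ t le_rfl, add_zero, ← hP.Ip_add H (gen_cont H h) ω t0 (by linarith : t ≤ t + u)]
  ring
end enc
end canon

section law
open ProbabilityTheory
variable {N M : ℕ} {A : Set (EN M)} {f : EN N → EN M → EN N}
    {σ : EN N → EN M → Matrix (Fin N) (Fin M) ℝ}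
    {a : EN N → EN M → Matrix (Fin N) (Fin N) ℝ} {a0 : EN M} {Ω : Type*}
    [mΩ : MeasurableSpace Ω] {P : Measure Ω} [IsProbabilityMeasure P] {F : Filtration ℝ mΩ}
    {X : ℝ → Ω → EN N} {α : ℝ → Ω → EN M}

/-- admissible canonical laws -/
structure GoodLaw (f : EN N → EN M → EN N) (a : EN N → EN M → Matrix (Fin N) (Fin N) ℝ) (A : Set (EN M))
    (a0 : EN M) (y : EN N) (Q : Measure (CS N M)) (R : ℕ → ℕ) : Prop where
  init : ∀ᵐ ω ∂Q, XX 0 ω = y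
  mart : MartC f a Q (GF N M) XX (AA A a0)
  tc : TCond f a Q XX (AA A a0) R

lemma Enc_mart (hP : PathC A F X α) (H : Hyp A f σ a) (hM : MartC f a P F X α) {t : ℝ} (t0 : 0 ≤ t)
    {φ : EN N → ℝ} (h : ContDiff ℝ 2 φ) (hc : HasCompactSupport φ) {s u : ℝ} (s0 : 0 ≤ s) (su : s ≤ u)
    {G : Set (CS N M)} (hG : MeasurableSet[GF N M s] G) {B : Set Ω} (hB : MeasurableSet[F t] B) :
    ∫ ω in B ∩ Enc hP H t ⁻¹' G, (Mp f a φ XX (AA A a0) u (Enc hP H t ω) - Mp f a φ XX (AA A a0) s (Enc hP H t ω)) ∂P = 0 := by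
  have e : ∀ ω, Mp f a φ XX (AA A a0) u (Enc hP H t ω) - Mp f a φ XX (AA A a0) s (Enc hP H t ω)
      = Mp f a φ X α (t + u) ω - Mp f a φ X α (t + s) ω := fun ω => by
    rw [Mp_Enc hP H a0 h t0 s0, Mp_Enc hP H a0 h t0 (s0.trans su)]; ring
  simp only [e]
  have hS : MeasurableSet[F (t + s)] (B ∩ Enc hP H t ⁻¹' G) := by
    refine MeasurableSet.inter (F.mono (by linarith) _ hB) ?_
    exact (Enc_meas hP H t s0) hG
  rw [integral_sub (hP.Mp_int H h hc (by linarith)).integrableOn (hP.Mp_int H h hc (by linarith)).integrableOn,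
    hM φ h hc (t + s) (t + u) (by linarith) (by linarith) _ hS, sub_self]

lemma Enc_tc (hP : PathC A F X α) (H : Hyp A f σ a) {R : ℕ → ℕ} (hT : TCond f a P X α R) {t : ℝ} (t0 : 0 ≤ t)
    {n : ℕ} {φ : EN N → ℝ} (h : ContDiff ℝ 2 φ) (hc : HasCompactSupport φ)
    (h0 : ∀ x, ‖x‖ ≤ R (⌈t⌉₊ + n) → φ x = 0) {u : ℝ} (u0 : 0 ≤ u) (un : u ≤ n) :
    ∀ᵐ ω ∂P, Mp f a φ XX (AA A a0) u (Enc hP H t ω) = Mp f a φ XX (AA A a0) 0 (Enc hP H t ω) := by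
  have ht := Nat.le_ceil t
  have n0 : (0:ℝ) ≤ n := Nat.cast_nonneg n
  have e1 := hT (⌈t⌉₊ + n) φ h hc h0 (t + u) (by linarith) (by push_cast; linarith)
  have e2 := hT (⌈t⌉₊ + n) φ h hc h0 t t0 (by push_cast; linarith)
  filter_upwards [e1, e2] with ω h1 h2
  rw [Mp_Enc hP H a0 h t0 u0, Mp_Enc hP H a0 h t0 le_rfl, add_zero, h1, h2]

/-- the law of the encoding at time 0 is good -/
lemma Enc_good (hP : PathC A F X α) (H : Hyp A f σ a) (ha0 : a0 ∈ A) (hM : MartC f a P F X α) {R : ℕ → ℕ} (hT : TCond f a P X α R)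
    {y : EN N} (hi : ∀ᵐ ω ∂P, X 0 ω = y) : GoodLaw f a A a0 y (P.map (Enc hP H 0)) R := by
  have hC := CS_pathC (N := N) H.hA.isClosed ha0
  have em := Enc_meas' hP H 0
  have : IsProbabilityMeasure (P.map (Enc hP H 0)) := Measure.isProbabilityMeasure_map em.aemeasurable
  refine ⟨?_, ?_, ?_⟩
  · have ms : MeasurableSet {ω : CS N M | XX 0 ω = y} :=
      ((hC.X_meas 0).mono ((GF N M).le _) le_rfl) (measurableSet_singleton y)
    rw [ae_map_iff em.aemeasurable ms]
    filter_upwards [hi] with ω hω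
    rw [XX_Enc hP H 0 le_rfl]; simpa using hω
  · intro φ h hc s u s0 su G hG
    have hG' := (GF N M).le _ _ hG
    rw [← sub_eq_zero, ← integral_sub (hC.Mp_int H h hc (s0.trans su)).integrableOn (hC.Mp_int H h hc s0).integrableOn]
    rw [setIntegral_map hG' ?_ em.aemeasurable]
    · simpa using Enc_mart (a0 := a0) hP H hM le_rfl h hc s0 su hG (B := univ) MeasurableSet.univ
    · exact (((hC.Mp_meas H h u).mono ((GF N M).le _) le_rfl).sub ((hC.Mp_meas H h s).mono ((GF N M).le _) le_rfl)).aestronglyMeasurable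
  · intro n φ h hc h0 u u0 un
    have ms : MeasurableSet {ω : CS N M | Mp f a φ XX (AA A a0) u ω = Mp f a φ XX (AA A a0) 0 ω} :=
      measurableSet_eq_fun ((hC.Mp_meas H h u).mono ((GF N M).le _) le_rfl) ((hC.Mp_meas H h 0).mono ((GF N M).le _) le_rfl)
    rw [ae_map_iff em.aemeasurable ms]
    exact Enc_tc hP H hT le_rfl h hc (by simpa using h0) u0 un

lemma disint_zero {Y Z : Type*} [MeasurableSpace Y] [MeasurableSpace Z] [StandardBorelSpace Z] [Nonempty Z]
    {ξ : Ω → Y} {Ψ : Ω → Z} (hξ : Measurable ξ) (hΨ : Measurable Ψ) {m : Z → ℝ} (hm : Measurable m)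
    {K : ℝ} (hK : ∀ z, |m z| ≤ K) (h : ∀ B, MeasurableSet B → ∫ ω in ξ ⁻¹' B, m (Ψ ω) ∂P = 0) :
    ∀ᵐ y ∂(P.map ξ), ∫ z, m z ∂(condDistrib Ψ ξ P y) = 0 := by
  have : IsProbabilityMeasure (P.map ξ) := Measure.isProbabilityMeasure_map hξ.aemeasurable
  have sm : StronglyMeasurable (fun y => ∫ z, m z ∂(condDistrib Ψ ξ P y)) := hm.stronglyMeasurable.integral_kernel
  have K0 : ∀ y, ‖∫ z, m z ∂(condDistrib Ψ ξ P y)‖ ≤ K := fun y => by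
    have := norm_integral_le_of_norm_le_const (μ := condDistrib Ψ ξ P y) (f := m) (C := K) (ae_of_all _ hK)
    simpa using this
  have int : Integrable (fun y => ∫ z, m z ∂(condDistrib Ψ ξ P y)) (P.map ξ) :=
    Integrable.of_bound sm.aestronglyMeasurable K (ae_of_all _ K0)
  refine int.ae_eq_zero_of_forall_setIntegral_eq_zero fun B hB _ => ?_
  have i2 : Integrable (fun p : Y × Z => m p.2) (P.map ξ ⊗ₘ condDistrib Ψ ξ P) :=
    Integrable.of_bound (hm.comp measurable_snd).aestronglyMeasurable K (ae_of_all _ fun p => hK _)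
  have e := Measure.setIntegral_compProd hB MeasurableSet.univ (i2.integrableOn (s := B ×ˢ univ))
  simp only [Measure.restrict_univ] at e
  rw [← e, compProd_map_condDistrib hΨ.aemeasurable, setIntegral_map (f := fun p : Y × Z => m p.2) (hB.prod MeasurableSet.univ)
    (hm.comp measurable_snd).aestronglyMeasurable (hξ.prodMk hΨ).aemeasurable, ← h B hB]
  congr 2
  ext ω
  simp

lemma cond_mart (hP : PathC A F X α) (H : Hyp A f σ a) (ha0 : a0 ∈ A) (hM : MartC f a P F X α) {t : ℝ} (t0 : 0 ≤ t)
    {C : Set Ω} (hC : MeasurableSet[F t] C) :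
    MartC f a ((P[|C]).map (Enc hP H t)) (GF N M) XX (AA A a0) := by
  have hCC := CS_pathC (N := N) H.hA.isClosed ha0
  have em := Enc_meas' hP H t
  by_cases pc : P C = 0
  · intro φ h hc s u s0 su G hG
    rw [cond_eq_zero_of_meas_eq_zero pc]
    simp
  have pr : IsProbabilityMeasure (P[|C]) := cond_isProbabilityMeasure pc
  have : IsProbabilityMeasure ((P[|C]).map (Enc hP H t)) := Measure.isProbabilityMeasure_map em.aemeasurable
  intro φ h hc s u s0 su G hG
  have hG' := (GF N M).le _ _ hG
  rw [← sub_eq_zero, ← integral_sub (hCC.Mp_int H h hc (s0.trans su)).integrableOn (hCC.Mp_int H h hc s0).integrableOn]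
  rw [setIntegral_map hG' ?_ em.aemeasurable]
  · rw [ProbabilityTheory.cond, Measure.restrict_smul, integral_smul_measure,
      Measure.restrict_restrict (em hG'), inter_comm, Enc_mart (a0 := a0) hP H hM t0 h hc s0 su hG hC, smul_zero]
  · exact (((hCC.Mp_meas H h u).mono ((GF N M).le _) le_rfl).sub ((hCC.Mp_meas H h s).mono ((GF N M).le _) le_rfl)).aestronglyMeasurable

lemma cond_tc (hP : PathC A F X α) (H : Hyp A f σ a) (ha0 : a0 ∈ A) {R : ℕ → ℕ} (hT : TCond f a P X α R) {t : ℝ} (t0 : 0 ≤ t)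
    {C : Set Ω} :
    TCond f a ((P[|C]).map (Enc hP H t)) XX (AA A a0) (fun n => R (⌈t⌉₊ + n)) := by
  have hCC := CS_pathC (N := N) H.hA.isClosed ha0
  have em := Enc_meas' hP H t
  intro n φ h hc h0 u u0 un
  have ms : MeasurableSet {ω : CS N M | Mp f a φ XX (AA A a0) u ω = Mp f a φ XX (AA A a0) 0 ω} :=
    measurableSet_eq_fun ((hCC.Mp_meas H h u).mono ((GF N M).le _) le_rfl) ((hCC.Mp_meas H h 0).mono ((GF N M).le _) le_rfl)
  rw [ae_map_iff em.aemeasurable ms]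
  exact cond_absolutelyContinuous.ae_le (Enc_tc hP H hT t0 h hc h0 u0 un)

/-- conditional laws are good -/
lemma cond_good (hP : PathC A F X α) (H : Hyp A f σ a) (ha0 : a0 ∈ A) (hM : MartC f a P F X α) {R : ℕ → ℕ} (hT : TCond f a P X α R)
    {t : ℝ} (t0 : 0 ≤ t) :
    ∀ᵐ y ∂(P.map (X t)), GoodLaw f a A a0 y (condDistrib (Enc hP H t) (X t) P y) (fun n => R (⌈t⌉₊ + n)) := by
  have hC := CS_pathC (N := N) H.hA.isClosed ha0
  have em := Enc_meas' hP H t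
  have xm : Measurable (X t) := (hP.X_meas t).mono (F.le _) le_rfl
  have x0m : Measurable (XX (N := N) (M := M) 0) := (hC.X_meas 0).mono ((GF N M).le _) le_rfl
  have : IsProbabilityMeasure (P.map (X t)) := Measure.isProbabilityMeasure_map xm.aemeasurable
  have g1 : ∀ᵐ y ∂(P.map (X t)), ∀ᵐ ω ∂(condDistrib (Enc hP H t) (X t) P y), XX 0 ω = y := by
    have ms : MeasurableSet {p : EN N × CS N M | XX 0 p.2 = p.1} :=
      measurableSet_eq_fun (x0m.comp measurable_snd) measurable_fst
    refine Measure.ae_ae_of_ae_compProd (p := fun p : EN N × CS N M => XX 0 p.2 = p.1) ?_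
    rw [compProd_map_condDistrib em.aemeasurable, ae_map_iff (xm.prodMk em).aemeasurable ms]
    refine ae_of_all _ fun ω => ?_
    show XX 0 (Enc hP H t ω) = X t ω
    rw [XX_Enc hP H t le_rfl, add_zero]
  obtain ⟨S, Sc, Sb, hS⟩ := hC.martC_countable H GF_pi
  obtain ⟨T, Tc, Tb, hTT⟩ := hC.tcond_countable H
  have key : ∀ m : CS N M → ℝ, (Measurable m ∧ ∃ K, ∀ ω, |m ω| ≤ K) →
      (∀ C, MeasurableSet[F t] C → P C ≠ 0 → ∫ ω, m ω ∂((P[|C]).map (Enc hP H t)) = 0) →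
      ∀ᵐ y ∂(P.map (X t)), ∫ z, m z ∂(condDistrib (Enc hP H t) (X t) P y) = 0 := by
    rintro m ⟨mm, K, hK⟩ hz
    refine disint_zero xm em mm hK fun B hB => ?_
    by_cases pc : P (X t ⁻¹' B) = 0
    · rw [Measure.restrict_eq_zero.2 pc]; simp
    · have := hz (X t ⁻¹' B) (hP.X_meas t hB) pc
      rw [integral_map em.aemeasurable mm.aestronglyMeasurable, ProbabilityTheory.cond, integral_smul_measure] at this
      refine (smul_eq_zero.1 this).resolve_left ?_
      rw [ENNReal.toReal_inv]
      exact inv_ne_zero <| ENNReal.toReal_ne_zero.2 ⟨pc, measure_ne_top _ _⟩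
  have prb : ∀ C, P C ≠ 0 → IsProbabilityMeasure ((P[|C]).map (Enc hP H t)) := fun C pc => by
    have pr : IsProbabilityMeasure (P[|C]) := cond_isProbabilityMeasure pc
    exact Measure.isProbabilityMeasure_map em.aemeasurable
  have g2 : ∀ᵐ y ∂(P.map (X t)), ∀ m ∈ S, ∫ z, m z ∂(condDistrib (Enc hP H t) (X t) P y) = 0 := by
    rw [ae_ball_iff Sc]
    intro m hm
    refine key m (Sb m hm) fun C hC pc => ?_
    have := prb C pc
    exact (hS _).1 (cond_mart hP H ha0 hM t0 hC) m hm
  have g3 : ∀ᵐ y ∂(P.map (X t)), ∀ n : ℕ, ∀ m ∈ T n (R (⌈t⌉₊ + n)), ∫ z, m z ∂(condDistrib (Enc hP H t) (X t) P y) = 0 := by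
    rw [ae_all_iff]
    intro n
    rw [ae_ball_iff (Tc _ _)]
    intro m hm
    refine key m (Tb _ _ m hm) fun C hC pc => ?_
    have := prb C pc
    exact (hTT _ (fun n => R (⌈t⌉₊ + n))).1 (cond_tc hP H ha0 hT t0) n m hm
  filter_upwards [g1, g2, g3] with y h1 h2 h3
  exact ⟨h1, (hS _).2 h2, (hTT _ (fun n => R (⌈t⌉₊ + n))).2 h3⟩
end law

section sel
open ProbabilityTheory

lemma exists_param (Z : Type*) [MeasurableSpace Z] [StandardBorelSpace Z] [Nonempty Z] :
    ∃ κ : Kernel (ℚ → ℝ) Z, IsMarkovKernel κ ∧ ∀ Q : Measure Z, IsProbabilityMeasure Q → ∃ w, κ w = Q := by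
  let e := embeddingReal Z
  have he : MeasurableEmbedding e := measurableEmbedding_embeddingReal Z
  obtain ⟨g, gm, hg⟩ := he.exists_measurable_extend (g := (id : Z → Z)) measurable_id (fun _ => inferInstance)
  let k : (ℚ → ℝ) → Measure Z := fun w => ((stieltjesOfMeasurableRat (fun w : ℚ → ℝ => w) measurable_id w).measure).map g
  have km : Measurable k := (Measure.measurable_map g gm).comp (measurable_measure_stieltjesOfMeasurableRat measurable_id)
  refine ⟨⟨k, km⟩, ⟨fun w => ?_⟩, fun Q hQ => ?_⟩
  · exact Measure.isProbabilityMeasure_map gm.aemeasurable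
  · have pr : IsProbabilityMeasure (Q.map e) := Measure.isProbabilityMeasure_map he.measurable.aemeasurable
    refine ⟨fun q => cdf (Q.map e) q, ?_⟩
    have rs : IsRatStieltjesPoint (fun w : ℚ → ℝ => w) (fun q : ℚ => cdf (Q.map e) q) := by
      refine ⟨fun p q h => (monotone_cdf _) (by exact_mod_cast h), ?_, ?_, fun q => ?_⟩
      · exact (tendsto_cdf_atTop _).comp (tendsto_ratCast_atTop_iff.2 tendsto_id)
      · exact (tendsto_cdf_atBot _).comp (tendsto_ratCast_atBot_iff.2 tendsto_id)
      · show (⨅ r : Ioi q, cdf (Q.map e) ((r:ℚ):ℝ)) = cdf (Q.map e) (q:ℝ)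
        refine Eq.trans ?_ (StieltjesFunction.iInf_rat_gt_eq _ _)
        exact Equiv.iInf_congr (Equiv.subtypeEquivRight fun r => by simp) (fun r => rfl)
    have eq : (stieltjesOfMeasurableRat (fun w : ℚ → ℝ => w) measurable_id (fun q : ℚ => cdf (Q.map e) q)) = cdf (Q.map e) := by
      ext x
      have hq : ∀ q : ℚ, stieltjesOfMeasurableRat (fun w : ℚ → ℝ => w) measurable_id (fun q : ℚ => cdf (Q.map e) q) q = cdf (Q.map e) q := fun q => by
        rw [stieltjesOfMeasurableRat_eq, toRatCDF_of_isRatStieltjesPoint rs]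
      rw [← StieltjesFunction.iInf_rat_gt_eq, ← StieltjesFunction.iInf_rat_gt_eq]
      simp only [hq]
    show ((stieltjesOfMeasurableRat (fun w : ℚ → ℝ => w) measurable_id (fun q : ℚ => cdf (Q.map e) q)).measure).map g = Q
    rw [eq, measure_cdf, Measure.map_map gm he.measurable]
    have : g ∘ e = id := by
      ext z; exact congrFun hg z
    rw [this, Measure.map_id]

variable {N M : ℕ} {A : Set (EN M)} {f : EN N → EN M → EN N}
    {σ : EN N → EN M → Matrix (Fin N) (Fin M) ℝ}
    {a : EN N → EN M → Matrix (Fin N) (Fin N) ℝ} {a0 : EN M} {Ω : Type*}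
    [mΩ : MeasurableSpace Ω] {P : Measure Ω} [IsProbabilityMeasure P] {F : Filtration ℝ mΩ}
    {X : ℝ → Ω → EN N} {α : ℝ → Ω → EN M}

/-- discounted payoff along a path -/
def pf (lam : ℝ) (V l : EN N → ℝ) (X : ℝ → Ω → EN N) (t : ℝ) (ω : Ω) : ℝ :=
  Real.exp (-(lam * t)) * V (X t ω) + ∫ s in Ioc (0:ℝ) t, Real.exp (-(lam * s)) * l (X s ω)

lemma pf_int_cont {lam : ℝ} {l : EN N → ℝ} (hl : Continuous l) {X : ℝ → Ω → EN N} {ω : Ω} (hX : Continuous fun t => X t ω) (s : ℝ) :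
    Continuous fun t => ∫ r in Ioc s t, Real.exp (-(lam * r)) * l (X r ω) := by
  have cc : Continuous fun r => Real.exp (-(lam * r)) * l (X r ω) := by fun_prop
  have c := (intervalIntegral.continuous_primitive (fun u v => cc.intervalIntegrable (μ := volume) u v) s).comp (continuous_id.max (continuous_const (y := s)))
  refine c.congr fun t => ?_
  simp only [Function.comp, id]
  rcases le_total s t with h | h
  · rw [max_eq_left h, intervalIntegral.integral_of_le h]
  · rw [max_eq_right h, Ioc_eq_empty (not_lt.2 h)]
    simp

lemma pf_cont {lam : ℝ} {V l : EN N → ℝ} (hV : Continuous V) (hl : Continuous l) {X : ℝ → Ω → EN N} {ω : Ω} (hX : Continuous fun t => X t ω) :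
    Continuous fun t => pf lam V l X t ω := by
  unfold pf
  have := pf_int_cont (lam := lam) hl hX 0
  fun_prop

lemma disc_int {lam K s t : ℝ} (hlam : 0 < lam) (K0 : 0 ≤ K) (hs : 0 ≤ s) {g : ℝ → ℝ} (hg : ∀ r, |g r| ≤ K) :
    |∫ r in Ioc s t, Real.exp (-(lam * r)) * g r| ≤ K / lam := by
  have int : IntegrableOn (fun r => K * Real.exp (-lam * r)) (Ioi 0) := (integrableOn_exp_mul_Ioi (by linarith) 0).const_mul K
  have ss : Ioc s t ⊆ Ioi 0 := fun r hr => lt_of_le_of_lt hs hr.1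
  have e : ∫ r in Ioi (0:ℝ), K * Real.exp (-lam * r) = K / lam := by
    rw [integral_const_mul, integral_exp_mul_Ioi (by linarith)]
    simp
    field_simp
  rw [← Real.norm_eq_abs, ← e]
  refine (norm_integral_le_of_norm_le (int.mono_set ss) (ae_of_all _ fun r => ?_)).trans ?_
  · rw [norm_mul, Real.norm_eq_abs, Real.norm_eq_abs, Real.abs_exp, mul_comm, neg_mul]
    exact mul_le_mul_of_nonneg_right (hg r) (Real.exp_pos _).le
  · exact setIntegral_mono_set int (ae_of_all _ fun r => by positivity) (HasSubset.Subset.eventuallyLE ss)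

lemma pf_bdd {lam : ℝ} (hlam : 0 < lam) {V l : EN N → ℝ} {KV Kl : ℝ} (hV : ∀ x, |V x| ≤ KV) (hl : ∀ x, |l x| ≤ Kl)
    {t : ℝ} (t0 : 0 ≤ t) (ω : Ω) : |pf lam V l X t ω| ≤ KV + Kl / lam := by
  unfold pf
  have K0 : 0 ≤ Kl := (abs_nonneg _).trans (hl 0)
  have h1 := disc_int (s := 0) (t := t) hlam K0 le_rfl (g := fun r => l (X r ω)) (fun r => hl _)
  refine (abs_add_le _ _).trans (add_le_add ?_ h1)
  rw [abs_mul, Real.abs_exp]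
  have : Real.exp (-(lam * t)) ≤ 1 := Real.exp_le_one_iff.2 (by nlinarith)
  calc _ ≤ 1 * |V (X t ω)| := mul_le_mul_of_nonneg_right this (abs_nonneg _)
    _ ≤ KV := by rw [one_mul]; exact hV _

lemma PathC.pf_int_meas (hP : PathC A F X α) (H : Hyp A f σ a) {lam : ℝ} {l : EN N → ℝ} (hl : Continuous l) (s t : ℝ) :
    Measurable fun ω => ∫ r in Ioc s t, Real.exp (-(lam * r)) * l (X r ω) := by
  have h1 : Measurable (fun p : ℝ × Ω => l (X p.1 p.2)) :=
    hP.meas_joint H (g := fun x _ => l x) (by apply Continuous.continuousOn; fun_prop)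
  have h2 : Measurable (fun p : ℝ × Ω => Real.exp (-(lam * p.1)) * l (X p.1 p.2)) := by
    refine Measurable.mul ?_ h1
    fun_prop
  exact (StronglyMeasurable.integral_prod_left' (μ := volume.restrict (Ioc s t)) h2.stronglyMeasurable).measurable

lemma PathC.pf_meas (hP : PathC A F X α) (H : Hyp A f σ a) {lam : ℝ} {V l : EN N → ℝ} (hV : Measurable V) (hl : Continuous l) (t : ℝ) :
    Measurable (pf lam V l X t) := by
  unfold pf
  exact ((hV.comp ((hP.X_meas t).mono (F.le _) le_rfl)).const_mul _).add (hP.pf_int_meas H hl 0 t)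

lemma PathC.pf_integral_cont (hP : PathC A F X α) (H : Hyp A f σ a) {lam : ℝ} (hlam : 0 < lam) {V l : EN N → ℝ} (hV : Continuous V) (hl : Continuous l)
    {KV Kl : ℝ} (hVb : ∀ x, |V x| ≤ KV) (hlb : ∀ x, |l x| ≤ Kl) : ContinuousOn (fun t => ∫ ω, pf lam V l X t ω ∂P) (Ici 0) := by
  refine continuousOn_of_dominated (bound := fun _ => KV + Kl / lam) (fun t _ => ?_) (fun t ht => ?_) (integrable_const _) ?_
  · exact (hP.pf_meas H hV.measurable hl t).aestronglyMeasurable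
  · exact ae_of_all _ fun ω => pf_bdd hlam hVb hlb ht ω
  · exact ae_of_all _ fun ω => (pf_cont hV hl (hP.X_cont ω)).continuousOn

lemma TCond.mono {R R' : ℕ → ℕ} (h : TCond f a P X α R) (hR : ∀ n, R n ≤ R' n) : TCond f a P X α R' :=
  fun n φ h1 h2 h3 => h n φ h1 h2 fun x hx => h3 x (hx.trans (by exact_mod_cast hR n))

/-- measurable selection of nearly optimal laws -/
lemma sel_laws (H : Hyp A f σ a) (ha0 : a0 ∈ A) (μ : Measure (EN N)) [IsFiniteMeasure μ] {lam : ℝ} (hlam : 0 < lam)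
    {V l : EN N → ℝ} (hV : Continuous V) (hl : Continuous l)
    {KV Kl : ℝ} (hVb : ∀ x, |V x| ≤ KV) (hlb : ∀ x, |l x| ≤ Kl) {U : EN N → ℝ} (hU : Measurable U)
    (hex : ∀ᵐ y ∂μ, ∃ (Q : Measure (CS N M)) (R : ℕ → ℕ), IsProbabilityMeasure Q ∧ GoodLaw f a A a0 y Q R ∧
      ∀ s, 0 ≤ s → ∫ ω, pf lam V l XX s ω ∂Q ≤ U y) {δ : ℝ≥0∞} (hδ : 0 < δ) :
    ∃ S, MeasurableSet S ∧ μ Sᶜ ≤ δ ∧ ∃ κ : Kernel (EN N) (CS N M), IsMarkovKernel κ ∧ ∃ R : ℕ → ℕ, ∀ y ∈ S,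
      GoodLaw f a A a0 y (κ y) R ∧ ∀ s, 0 ≤ s → ∫ ω, pf lam V l XX s ω ∂(κ y) ≤ U y := by
  have hC := CS_pathC (N := N) H.hA.isClosed ha0
  have x0m : Measurable (XX (N := N) (M := M) 0) := (hC.X_meas 0).mono ((GF N M).le _) le_rfl
  obtain ⟨κ, κm, κs⟩ := exists_param (CS N M)
  obtain ⟨S, Sc, Sb, hS⟩ := hC.martC_countable H GF_pi
  obtain ⟨T, Tc, Tb, hTT⟩ := hC.tcond_countable H
  let E : Set (EN N × ((ℚ → ℝ) × (ℕ → ℕ))) := {p | GoodLaw f a A a0 p.1 (κ p.2.1) p.2.2 ∧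
      ∀ s, 0 ≤ s → ∫ ω, pf lam V l XX s ω ∂(κ p.2.1) ≤ U p.1}
  have im : ∀ m : CS N M → ℝ, Measurable m → Measurable (fun p : EN N × ((ℚ → ℝ) × (ℕ → ℕ)) => ∫ ω, m ω ∂(κ p.2.1)) := fun m hm =>
    (hm.stronglyMeasurable.integral_kernel (κ := κ)).measurable.comp (measurable_fst.comp measurable_snd)
  have hE : MeasurableSet E := by
    have eq : E = {p | ∀ᵐ ω ∂(κ p.2.1), XX 0 ω = p.1} ∩ (⋂ m ∈ S, {p | ∫ ω, m ω ∂(κ p.2.1) = 0}) ∩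
        (⋂ n : ℕ, ⋃ R : ℕ, {p | p.2.2 n = R} ∩ ⋂ m ∈ T n R, {p | ∫ ω, m ω ∂(κ p.2.1) = 0}) ∩
        (⋂ q : ℚ, {p | (0:ℝ) ≤ q → ∫ ω, pf lam V l XX q ω ∂(κ p.2.1) ≤ U p.1}) := by
      ext ⟨y, w, R⟩
      simp only [E, mem_setOf_eq, mem_inter_iff, mem_iInter, mem_iUnion]
      constructor
      · rintro ⟨⟨h1, h2, h3⟩, h4⟩
        exact ⟨⟨⟨h1, (hS _).1 h2⟩, fun n => ⟨R n, rfl, (hTT _ R).1 h3 n⟩⟩, fun q hq => h4 q hq⟩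
      · rintro ⟨⟨⟨h1, h2⟩, h3⟩, h4⟩
        refine ⟨⟨h1, (hS _).2 h2, (hTT _ R).2 fun n => ?_⟩, fun s s0 => ?_⟩
        · obtain ⟨_, rfl, h⟩ := h3 n
          exact h
        · obtain ⟨q, hq, hq'⟩ := rat_seq s 0
          have qs : ∀ n : ℕ, s ≤ q n := fun n => by
            have := (hq' n).1; simp only [zero_div, add_zero] at this; exact this.le
          have c := (hC.pf_integral_cont (P := κ w) H hlam hV hl hVb hlb) s s0
          have := c.tendsto.comp (tendsto_nhdsWithin_iff.2 ⟨hq, Eventually.of_forall fun n => s0.trans (qs n)⟩)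
          exact le_of_tendsto this (Eventually.of_forall fun n => h4 (q n) (s0.trans (qs n)))
    rw [eq]
    refine MeasurableSet.inter (MeasurableSet.inter (MeasurableSet.inter ?_ ?_) ?_) ?_
    · let η : Kernel (EN N × ((ℚ → ℝ) × (ℕ → ℕ))) (CS N M) := κ.comap (fun p => p.2.1) (measurable_fst.comp measurable_snd)
      have ms : MeasurableSet {p : (EN N × ((ℚ → ℝ) × (ℕ → ℕ))) × CS N M | XX 0 p.2 = p.1.1}ᶜ :=
        (measurableSet_eq_fun (x0m.comp measurable_snd) (measurable_fst.comp measurable_fst)).compl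
      exact (Kernel.measurable_kernel_prodMk_left (κ := η) ms) (measurableSet_singleton 0)
    · exact MeasurableSet.biInter Sc fun m hm => (im m (Sb m hm).1) (measurableSet_singleton 0)
    · refine MeasurableSet.iInter fun n => MeasurableSet.iUnion fun R => MeasurableSet.inter ?_ ?_
      · have : Measurable (fun p : EN N × ((ℚ → ℝ) × (ℕ → ℕ)) => p.2.2 n) :=
          (measurable_pi_apply n).comp (measurable_snd.comp measurable_snd)
        exact this (measurableSet_singleton R)
      · exact MeasurableSet.biInter (Tc n R) fun m hm => (im m (Tb n R m hm).1) (measurableSet_singleton 0)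
    · refine MeasurableSet.iInter fun q => ?_
      by_cases hq : (0:ℝ) ≤ q
      · simp only [hq, true_imp_iff]
        exact measurableSet_le (im _ (hC.pf_meas H hV.measurable hl q)) (hU.comp measurable_fst)
      · simp [hq]
  obtain ⟨G, Gm, Gd, g, gm, ⟨K, hK, hKg⟩, hg⟩ := selection μ E hE (by
    filter_upwards [hex] with y hy
    obtain ⟨Q, R, hQ, h1, h2⟩ := hy
    obtain ⟨w, rfl⟩ := κs Q hQ
    exact ⟨(w, R), h1, h2⟩) δ hδ
  have bd : ∀ n : ℕ, ∃ B : ℕ, ∀ y ∈ G, (g y).2 n ≤ B := fun n => by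
    have c : Continuous (fun p : (ℚ → ℝ) × (ℕ → ℕ) => p.2 n) := by fun_prop
    obtain ⟨B, hB⟩ := (hK.image c).bddAbove
    exact ⟨B, fun y hy => hB ⟨g y, hKg y hy, rfl⟩⟩
  choose R hR using bd
  refine ⟨G, Gm, Gd, κ.comap (fun y => (g y).1) (measurable_fst.comp gm), inferInstance, R, fun y hy => ?_⟩
  obtain ⟨⟨h1, h2, h3⟩, h4⟩ := hg y hy
  exact ⟨⟨h1, h2, h3.mono fun n => hR n y hy⟩, h4⟩
end sel

section cat
open ProbabilityTheory

variable {N M : ℕ} {A : Set (EN M)} {f : EN N → EN M → EN N}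
    {σ : EN N → EN M → Matrix (Fin N) (Fin M) ℝ}
    {a : EN N → EN M → Matrix (Fin N) (Fin N) ℝ} {a0 : EN M} {Ω : Type*}
    [mΩ : MeasurableSpace Ω] {P : Measure Ω} [IsProbabilityMeasure P] {F : Filtration ℝ mΩ}
    {X : ℝ → Ω → EN N} {α : ℝ → Ω → EN M}

/-- filtration for the concatenated process -/
def FC (F : Filtration ℝ mΩ) (t : ℝ) : Filtration ℝ (mΩ.prod (instMeasCS N M)) where
  seq s := (F s).prod (if s < t then ⊥ else GF N M (s - t))
  mono' s u hsu := by
    refine sup_le_sup (MeasurableSpace.comap_mono (F.mono hsu)) (MeasurableSpace.comap_mono ?_)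
    split_ifs with h1 h2
    · exact le_rfl
    · exact bot_le
    · linarith
    · exact (GF N M).mono (by linarith)
  le' s := by
    refine sup_le_sup (MeasurableSpace.comap_mono (F.le s)) (MeasurableSpace.comap_mono ?_)
    split_ifs with h1
    · exact bot_le
    · exact (GF N M).le _

/-- concatenated state -/
def XC (X : ℝ → Ω → EN N) (t s : ℝ) (p : Ω × CS N M) : EN N :=
  X (min s t) p.1 + (XX (max (s - t) 0) p.2 - XX 0 p.2)

/-- concatenated control -/
def AC (A : Set (EN M)) (a0 : EN M) (α : ℝ → Ω → EN M) (t s : ℝ) (p : Ω × CS N M) : EN M :=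
  if s ≤ t then α s p.1 else AA A a0 (s - t) p.2

lemma FC_fst (t s : ℝ) : Measurable[FC (N := N) (M := M) F t s, F s] (Prod.fst : Ω × CS N M → Ω) := by
  intro B hB
  exact (le_sup_left : _ ≤ (FC (N := N) (M := M) F t s : MeasurableSpace _)) _ ⟨B, hB, rfl⟩

lemma FC_snd {t s : ℝ} (h : t ≤ s) : Measurable[FC (N := N) (M := M) F t s, GF N M (s - t)] (Prod.snd : Ω × CS N M → CS N M) := by
  intro B hB
  refine (le_sup_right : _ ≤ (FC (N := N) (M := M) F t s : MeasurableSpace _)) _ ⟨B, ?_, rfl⟩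
  rw [if_neg (not_lt.2 h)]
  exact hB

lemma cat_path (hP : PathC A F X α) (H : Hyp A f σ a) (ha0 : a0 ∈ A) (t : ℝ) :
    PathC A (FC (N := N) (M := M) F t) (XC X t) (AC A a0 α t) := by
  have hC := CS_pathC (N := N) H.hA.isClosed ha0
  have cont : ∀ p : Ω × CS N M, Continuous fun s => XC X t s p := fun p => by
    unfold XC
    exact ((hP.X_cont p.1).comp (continuous_id.min continuous_const)).add
      (((hC.X_cont p.2).comp ((continuous_id.sub continuous_const).max continuous_const)).sub continuous_const)
  refine ⟨cont, ?_, ?_, ?_⟩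
  · refine StronglyAdapted.isStronglyProgressive_of_continuous (fun s => ?_) cont
    have m1 : Measurable[FC (N := N) (M := M) F t s] fun p : Ω × CS N M => X (min s t) p.1 :=
      ((hP.X_meas (min s t)).mono (F.mono (min_le_left s t)) le_rfl).comp (FC_fst t s)
    refine Measurable.stronglyMeasurable ?_
    rcases lt_or_ge s t with h | h
    · have : XC X t s = fun p : Ω × CS N M => X (min s t) p.1 := by
        ext1 p
        simp [XC, max_eq_right (by linarith : s - t ≤ 0)]
      rw [this]; exact m1
    · have m2 : Measurable[FC (N := N) (M := M) F t s] fun p : Ω × CS N M => XX (s - t) p.2 :=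
        (hC.X_meas (s - t)).comp (FC_snd h)
      have m3 : Measurable[FC (N := N) (M := M) F t s] fun p : Ω × CS N M => XX 0 p.2 :=
        ((hC.X_meas 0).mono ((GF N M).mono (by linarith)) le_rfl).comp (FC_snd h)
      have : XC X t s = fun p : Ω × CS N M => X (min s t) p.1 + (XX (s - t) p.2 - XX 0 p.2) := by
        ext1 p
        simp [XC, max_eq_left (by linarith : 0 ≤ s - t)]
      rw [this]
      letI := FC (N := N) (M := M) F t s
      exact m1.add (m2.sub m3)
  · intro s
    have m1 : Measurable[Subtype.instMeasurableSpace.prod (FC (N := N) (M := M) F t s)] fun p : Iic s × (Ω × CS N M) => α p.1 p.2.1 := by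
      have := (hP.α_prog s).measurable
      refine this.comp (f := fun p : Iic s × (Ω × CS N M) => (p.1, p.2.1)) ?_
      have fm := FC_fst (N := N) (M := M) (F := F) t s
      letI := FC (N := N) (M := M) F t s
      letI := F s
      exact measurable_fst.prodMk (fm.comp measurable_snd)
    refine Measurable.stronglyMeasurable ?_
    rcases lt_or_ge s t with h | h
    · have : (fun p : Iic s × (Ω × CS N M) => AC A a0 α t p.1 p.2) = fun p : Iic s × (Ω × CS N M) => α p.1 p.2.1 := by
        ext1 p
        simp only [AC]
        rw [if_pos (p.1.2.trans h.le)]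
      rw [this]; exact m1
    · have m2 : Measurable[Subtype.instMeasurableSpace.prod (FC (N := N) (M := M) F t s)] fun p : Iic s × (Ω × CS N M) => AA A a0 ((p.1:ℝ) - t) p.2.2 := by
        have := (hC.α_prog (s - t)).measurable
        refine this.comp (f := fun p : Iic s × (Ω × CS N M) => ((⟨(p.1:ℝ) - t, sub_le_sub_right p.1.2 t⟩ : Iic (s - t)), p.2.2)) ?_
        have fm := FC_snd (N := N) (M := M) (F := F) h
        letI := FC (N := N) (M := M) F t s
        letI := GF N M (s - t)
        refine Measurable.prodMk (Measurable.subtype_mk ?_) (fm.comp measurable_snd)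
        exact (measurable_subtype_coe.comp measurable_fst).sub_const t
      letI := FC (N := N) (M := M) F t s
      refine Measurable.ite ?_ m1 m2
      exact measurableSet_le (measurable_subtype_coe.comp measurable_fst) measurable_const
  · intro s p
    unfold AC
    split_ifs
    · exact hP.α_mem _ _
    · exact hC.α_mem _ _

lemma Mp_zero' (φ : EN N → ℝ) (X : ℝ → Ω → EN N) (α : ℝ → Ω → EN M) (ω : Ω) : Mp f a φ X α 0 ω = φ (X 0 ω) := by
  simp [Mp, Ip]

lemma XC_le {t s : ℝ} (h : s ≤ t) (p : Ω × CS N M) : XC X t s p = X s p.1 := by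
  simp [XC, max_eq_right (by linarith : s - t ≤ 0), min_eq_left h]

lemma XC_ge {t s : ℝ} (h : t ≤ s) {p : Ω × CS N M} (hp : XX 0 p.2 = X t p.1) : XC X t s p = XX (s - t) p.2 := by
  simp [XC, max_eq_left (by linarith : 0 ≤ s - t), min_eq_right h, hp]

lemma cat_Mp (hP : PathC A F X α) (H : Hyp A f σ a) (ha0 : a0 ∈ A) {t : ℝ} (t0 : 0 ≤ t) {φ : EN N → ℝ} (h : ContDiff ℝ 2 φ)
    {s : ℝ} (s0 : 0 ≤ s) {p : Ω × CS N M} (hp : XX 0 p.2 = X t p.1) :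
    Mp f a φ (XC X t) (AC A a0 α t) s p = Mp f a φ X α (min s t) p.1 +
      (Mp f a φ XX (AA A a0) (max (s - t) 0) p.2 - Mp f a φ XX (AA A a0) 0 p.2) := by
  have e1 : ∀ u, u ≤ t → Ip (gen f a φ) (XC X t) (AC A a0 α t) 0 u p = Ip (gen f a φ) X α 0 u p.1 := by
    intro u hu
    unfold Ip
    refine setIntegral_congr_fun measurableSet_Ioc fun r hr => ?_
    simp only [XC_le (hr.2.trans hu), AC, if_pos (hr.2.trans hu)]
  rcases le_total s t with hst | hst
  · rw [max_eq_right (by linarith : s - t ≤ 0), min_eq_left hst]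
    simp [Mp, e1 s hst, XC_le hst]
  · rw [max_eq_left (by linarith : 0 ≤ s - t), min_eq_right hst, Mp_zero']
    have e2 : Ip (gen f a φ) (XC X t) (AC A a0 α t) t s p = Ip (gen f a φ) XX (AA A a0) 0 (s - t) p.2 := by
      unfold Ip
      rw [← intervalIntegral.integral_of_le hst, ← intervalIntegral.integral_of_le (by linarith : (0:ℝ) ≤ s - t)]
      have := intervalIntegral.integral_comp_sub_right (a := t) (b := s) (fun r => gen f a φ (XX r p.2) (AA A a0 r p.2)) t
      rw [sub_self] at this
      rw [← this, intervalIntegral.integral_of_le hst, intervalIntegral.integral_of_le hst]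
      refine setIntegral_congr_fun measurableSet_Ioc fun r hr => ?_
      simp only [XC_ge hr.1.le hp, AC, if_neg (not_le.2 hr.1)]
    have e3 := (cat_path hP H ha0 t).Ip_add H (gen_cont H h) p t0 hst
    unfold Mp
    rw [← e3, e2, e1 t le_rfl, XC_ge hst hp, hp]
    ring

variable {κ : Kernel (EN N) (CS N M)} [IsMarkovKernel κ]

/-- concatenated law -/
def PC (P : Measure Ω) (κ : Kernel (EN N) (CS N M)) (Y : Ω → EN N) (hY : Measurable Y) : Measure (Ω × CS N M) :=
  P ⊗ₘ (κ.comap Y hY)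

instance {Y : Ω → EN N} {hY : Measurable Y} : IsProbabilityMeasure (PC P κ Y hY) := by
  unfold PC; infer_instance

lemma XX_meas (s : ℝ) : Measurable (XX s : CS N M → EN N) :=
  ((CS_pathC (N := N) (M := M) (isClosed_univ) (mem_univ 0)).X_meas s).mono ((GF N M).le s) le_rfl

lemma cat_ae {R : ℕ → ℕ} {Y : Ω → EN N} (hY : Measurable Y) (hg : ∀ᵐ y ∂P.map Y, GoodLaw f a A a0 y (κ y) R) :
    ∀ᵐ p ∂PC P κ Y hY, XX 0 p.2 = Y p.1 := by
  unfold PC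
  have ms : MeasurableSet {p : Ω × CS N M | XX 0 p.2 = Y p.1} :=
    measurableSet_eq_fun ((XX_meas 0).comp measurable_snd) (hY.comp measurable_fst)
  rw [Measure.ae_compProd_iff ms]
  filter_upwards [ae_of_ae_map hY.aemeasurable hg] with ω hω
  exact hω.init

lemma cat_mart (hP : PathC A F X α) (H : Hyp A f σ a) (ha0 : a0 ∈ A) (hM : MartC f a P F X α) {t : ℝ} (t0 : 0 ≤ t) {R : ℕ → ℕ}
    (hY : Measurable (X t)) (hg : ∀ᵐ y ∂P.map (X t), GoodLaw f a A a0 y (κ y) R) :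
    MartC f a (PC P κ (X t) hY) (FC (N := N) (M := M) F t) (XC X t) (AC A a0 α t) := by
  have hC := CS_pathC (N := N) H.hA.isClosed ha0
  have ae := cat_ae (P := P) (κ := κ) hY hg
  intro φ h hc s u s0 su G hG
  have u0 := s0.trans su
  have hG' : MeasurableSet G := (FC (N := N) (M := M) F t).le s _ hG
  have mm : 0 ≤ min s t := le_min s0 t0
  have mm' : 0 ≤ min u t := le_min u0 t0
  let D1 : ℝ → Ω → ℝ := fun s => Mp f a φ X α (min s t)
  let D2 : ℝ → CS N M → ℝ := fun s => Mp f a φ XX (AA A a0) (max (s - t) 0)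
  have m1 : ∀ s, 0 ≤ s → Measurable (D1 s) := fun s _ => (hP.Mp_meas H h _).mono (F.le _) le_rfl
  have m2 : ∀ s, Measurable (D2 s) := fun s => (hC.Mp_meas H h _).mono ((GF N M).le _) le_rfl
  obtain ⟨C1, C10, hC1⟩ := hP.Mp_bdd H h hc
  obtain ⟨C2, C20, hC2⟩ := hC.Mp_bdd H h hc
  have i1 : ∀ s, 0 ≤ s → Integrable (fun p : Ω × CS N M => D1 s p.1) (PC P κ (X t) hY) := fun s s0 =>
    Integrable.of_bound ((m1 s s0).comp measurable_fst).aestronglyMeasurable _ (ae_of_all _ fun p => hC1 _ (le_min s0 t0) p.1)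
  have i2 : ∀ s, Integrable (fun p : Ω × CS N M => D2 s p.2) (PC P κ (X t) hY) := fun s =>
    Integrable.of_bound ((m2 s).comp measurable_snd).aestronglyMeasurable _ (ae_of_all _ fun p => hC2 _ (le_max_right _ _) p.2)
  have z1 : ∫ p in G, (D1 u p.1 - D1 s p.1) ∂PC P κ (X t) hY = 0 := by
    rcases lt_or_ge s t with hst | hst
    · have : ∃ G1, MeasurableSet[F s] G1 ∧ Prod.fst ⁻¹' G1 = G := by
        have e : (FC (N := N) (M := M) F t s : MeasurableSpace _) = (F s).comap Prod.fst := by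
          show (F s).prod (if s < t then ⊥ else GF N M (s - t)) = _
          rw [if_pos hst, MeasurableSpace.prod, MeasurableSpace.comap_bot, sup_bot_eq]
        rw [e] at hG
        exact hG
      obtain ⟨G1, hG1, rfl⟩ := this
      have hG1' := F.le s _ hG1
      have := Measure.setIntegral_compProd (μ := P) (κ := κ.comap (X t) hY) (f := fun p : Ω × CS N M => D1 u p.1 - D1 s p.1) hG1' MeasurableSet.univ
        (((i1 u u0).sub (i1 s s0)).integrableOn)
      rw [prod_univ] at this
      unfold PC
      rw [this]
      simp only [Measure.restrict_univ, integral_const, probReal_univ, one_smul]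
      rw [integral_sub (hP.Mp_int H h hc mm').integrableOn (hP.Mp_int H h hc mm).integrableOn, sub_eq_zero]
      simp only [D1, min_eq_left hst.le]
      exact hM φ h hc s _ s0 (le_min su hst.le) G1 hG1
    · simp [D1, min_eq_right hst, min_eq_right (hst.trans su)]
  have z2 : ∫ p in G, (D2 u p.2 - D2 s p.2) ∂PC P κ (X t) hY = 0 := by
    rw [← integral_indicator hG']
    unfold PC
    have ii : Integrable (G.indicator fun p : Ω × CS N M => D2 u p.2 - D2 s p.2) (PC P κ (X t) hY) := ((i2 u).sub (i2 s)).indicator hG'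
    rw [Measure.integral_compProd ii]
    refine integral_eq_zero_of_ae ?_
    filter_upwards [ae_of_ae_map hY.aemeasurable hg] with ω hω
    have sec : MeasurableSet[GF N M (max (s - t) 0)] (Prod.mk ω ⁻¹' G) := by
      have : Measurable[GF N M (max (s - t) 0), FC (N := N) (M := M) F t s] (Prod.mk ω : CS N M → Ω × CS N M) := by
        have e : (if s < t then ⊥ else GF N M (s - t)) ≤ GF N M (max (s - t) 0) := by
          split_ifs
          · exact bot_le
          · exact (GF N M).mono (le_max_left _ _)
        have : Measurable[if s < t then ⊥ else GF N M (s - t), FC (N := N) (M := M) F t s] (Prod.mk ω : CS N M → Ω × CS N M) := by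
          letI := F s
          letI : MeasurableSpace (CS N M) := if s < t then ⊥ else GF N M (s - t)
          exact measurable_prodMk_left
        exact this.mono e le_rfl
      exact this hG
    have := hω.mart φ h hc (max (s - t) 0) (max (u - t) 0) (le_max_right _ _) (max_le_max_right _ (by linarith)) _ sec
    have j : ∀ s, Integrable (D2 s) (κ (X t ω)) := fun s => hC.Mp_int H h hc (le_max_right _ _)
    rw [← sub_eq_zero, ← integral_sub (j u).integrableOn (j s).integrableOn, ← integral_indicator ((GF N M).le _ _ sec)] at this
    exact this
  have e : ∀ s, 0 ≤ s → ∫ p in G, Mp f a φ (XC X t) (AC A a0 α t) s p ∂PC P κ (X t) hY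
      = ∫ p in G, (D1 s p.1 + (D2 s p.2 - Mp f a φ XX (AA A a0) 0 p.2)) ∂PC P κ (X t) hY := by
    intro s s0
    refine setIntegral_congr_ae hG' ?_
    filter_upwards [ae] with p hp _
    exact cat_Mp hP H ha0 t0 h s0 hp
  have i3 : Integrable (fun p : Ω × CS N M => Mp f a φ XX (AA A a0) 0 p.2) (PC P κ (X t) hY) :=
    Integrable.of_bound (((hC.Mp_meas H h _).mono ((GF N M).le _) le_rfl).comp measurable_snd).aestronglyMeasurable _ (ae_of_all _ fun p => hC2 _ le_rfl p.2)
  have i4 : ∀ s, 0 ≤ s → Integrable (fun p : Ω × CS N M => D1 s p.1 + (D2 s p.2 - Mp f a φ XX (AA A a0) 0 p.2)) (PC P κ (X t) hY) :=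
    fun s s0 => (i1 s s0).add ((i2 s).sub i3)
  rw [e s s0, e u u0, ← sub_eq_zero, ← integral_sub (i4 u u0).integrableOn (i4 s s0).integrableOn]
  have z3 := integral_add (μ := (PC P κ (X t) hY).restrict G) ((i1 u u0).sub (i1 s s0)).integrableOn ((i2 u).sub (i2 s)).integrableOn
  simp only [Pi.sub_apply] at z3
  rw [z1, z2, add_zero] at z3
  rw [← z3]
  refine integral_congr_ae (ae_of_all _ fun p => ?_)
  simp only []
  ring

lemma cat_tc (hP : PathC A F X α) (H : Hyp A f σ a) (ha0 : a0 ∈ A) {t : ℝ} (t0 : 0 ≤ t) {R R1 : ℕ → ℕ} (hT : TCond f a P X α R1)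
    (hY : Measurable (X t)) (hg : ∀ᵐ y ∂P.map (X t), GoodLaw f a A a0 y (κ y) R) :
    TCond f a (PC P κ (X t) hY) (XC X t) (AC A a0 α t) (fun n => max (R1 n) (R n)) := by
  have hC := CS_pathC (N := N) H.hA.isClosed ha0
  have ae := cat_ae (P := P) (κ := κ) hY hg
  intro n φ h hc hz s s0 sn
  have g1 := hT n φ h hc (fun x hx => hz x (hx.trans (by exact_mod_cast le_max_left _ _))) (min s t) (le_min s0 t0) ((min_le_left _ _).trans sn)
  have ms : MeasurableSet {p : Ω × CS N M | Mp f a φ X α (min s t) p.1 = Mp f a φ X α 0 p.1 ∧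
      Mp f a φ XX (AA A a0) (max (s - t) 0) p.2 = Mp f a φ XX (AA A a0) 0 p.2} := by
    refine MeasurableSet.inter (measurableSet_eq_fun ?_ ?_) (measurableSet_eq_fun ?_ ?_)
    · exact ((hP.Mp_meas H h _).mono (F.le _) le_rfl).comp measurable_fst
    · exact ((hP.Mp_meas H h _).mono (F.le _) le_rfl).comp measurable_fst
    · exact ((hC.Mp_meas H h _).mono ((GF N M).le _) le_rfl).comp measurable_snd
    · exact ((hC.Mp_meas H h _).mono ((GF N M).le _) le_rfl).comp measurable_snd
  have g2 : ∀ᵐ p ∂PC P κ (X t) hY, Mp f a φ X α (min s t) p.1 = Mp f a φ X α 0 p.1 ∧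
      Mp f a φ XX (AA A a0) (max (s - t) 0) p.2 = Mp f a φ XX (AA A a0) 0 p.2 := by
    unfold PC
    rw [Measure.ae_compProd_iff ms]
    filter_upwards [ae_of_ae_map hY.aemeasurable hg, g1] with ω hω h1
    have := hω.tc n φ h hc (fun x hx => hz x (hx.trans (by exact_mod_cast le_max_right _ _))) (max (s - t) 0) (le_max_right _ _) (max_le (by linarith) (by positivity))
    exact this.mono fun w hw => ⟨h1, hw⟩
  filter_upwards [ae, g2] with p hp h2
  rw [cat_Mp hP H ha0 t0 h s0 hp, cat_Mp hP H ha0 t0 h le_rfl hp, h2.1, h2.2, min_eq_left t0, max_eq_right (by linarith : 0 - t ≤ 0)]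

end cat

section catpf
open ProbabilityTheory

variable {N M : ℕ} {A : Set (EN M)} {f : EN N → EN M → EN N}
    {σ : EN N → EN M → Matrix (Fin N) (Fin M) ℝ}
    {a : EN N → EN M → Matrix (Fin N) (Fin N) ℝ} {a0 : EN M} {Ω : Type*}
    [mΩ : MeasurableSpace Ω] {P : Measure Ω} [IsProbabilityMeasure P] {F : Filtration ℝ mΩ}
    {X : ℝ → Ω → EN N} {α : ℝ → Ω → EN M} {lam : ℝ} {V l : EN N → ℝ}

lemma pf_XC_le {t s : ℝ} (h : s ≤ t) (p : Ω × CS N M) : pf lam V l (XC X t) s p = pf lam V l X s p.1 := by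
  unfold pf
  rw [XC_le h]
  congr 1
  refine setIntegral_congr_fun measurableSet_Ioc fun r hr => ?_
  simp only [XC_le (hr.2.trans h)]

lemma pf_XC_ge (hP : PathC A F X α) (H : Hyp A f σ a) (ha0 : a0 ∈ A) (hl : Continuous l) {t s : ℝ} (t0 : 0 ≤ t) (h : t ≤ s) {p : Ω × CS N M}
    (hp : XX 0 p.2 = X t p.1) :
    pf lam V l (XC X t) s p = (∫ r in Ioc (0:ℝ) t, Real.exp (-(lam * r)) * l (X r p.1)) + Real.exp (-(lam * t)) * pf lam V l XX (s - t) p.2 := by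
  unfold pf
  have cc : Continuous fun r => Real.exp (-(lam * r)) * l (XC X t r p) := by
    have := (cat_path hP H ha0 t).X_cont p
    fun_prop
  have e1 : ∫ r in Ioc (0:ℝ) t, Real.exp (-(lam * r)) * l (XC X t r p) = ∫ r in Ioc (0:ℝ) t, Real.exp (-(lam * r)) * l (X r p.1) := by
    refine setIntegral_congr_fun measurableSet_Ioc fun r hr => ?_
    simp only [XC_le hr.2]
  have e2 : ∫ r in Ioc t s, Real.exp (-(lam * r)) * l (XC X t r p) = Real.exp (-(lam * t)) * ∫ r in Ioc (0:ℝ) (s - t), Real.exp (-(lam * r)) * l (XX r p.2) := by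
    rw [← intervalIntegral.integral_of_le (by linarith : (0:ℝ) ≤ s - t)]
    have := intervalIntegral.integral_comp_sub_right (a := t) (b := s) (fun r => Real.exp (-(lam * r)) * l (XX r p.2)) t
    rw [sub_self] at this
    rw [← this, intervalIntegral.integral_of_le h, ← integral_const_mul]
    refine setIntegral_congr_fun measurableSet_Ioc fun r hr => ?_
    simp only [XC_ge hr.1.le hp]
    rw [← mul_assoc, ← Real.exp_add]
    ring_nf
  rw [← Ioc_union_Ioc_eq_Ioc t0 h, setIntegral_union (Set.Ioc_disjoint_Ioc_of_le le_rfl) measurableSet_Ioc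
    (cc.integrableOn_Ioc) (cc.integrableOn_Ioc), e1, e2, XC_ge h hp]
  have : Real.exp (-(lam * s)) = Real.exp (-(lam * t)) * Real.exp (-(lam * (s - t))) := by
    rw [← Real.exp_add]; ring_nf
  rw [this]
  ring

/-- concatenation of a control with a measurable family of nearly optimal ones -/
lemma concat {x : EN N} (c : Control N M A f a x) (H : Hyp A f σ a) (hlam : 0 < lam) (hV : Continuous V) (hl : Continuous l)
    {KV Kl KU : ℝ} (hVb : ∀ x, |V x| ≤ KV) (hlb : ∀ x, |l x| ≤ Kl) {U : EN N → ℝ} (hU : Measurable U) (hUb : ∀ x, |U x| ≤ KU)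
    (hex : ∀ y, Nonempty (Control N M A f a y) → ∃ c' : Control N M A f a y, ∀ s, 0 ≤ s → ∫ ω, pf lam V l c'.X s ω ∂c'.P ≤ U y)
    {t : ℝ} (t0 : 0 ≤ t) {δ : ℝ} (hδ : 0 < δ) :
    ∃ c' : Control N M A f a x, (∀ s, 0 ≤ s → s ≤ t → ∫ ω, pf lam V l c'.X s ω ∂c'.P = ∫ ω, pf lam V l c.X s ω ∂c.P) ∧
      ∀ s, t ≤ s → ∫ ω, pf lam V l c'.X s ω ∂c'.P ≤ ∫ ω, pf lam U l c.X t ω ∂c.P + δ := by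
  obtain ⟨ω0⟩ : Nonempty c.Ω := nonempty_of_isProbabilityMeasure c.P
  obtain ⟨a0, ha0⟩ : ∃ a0, a0 ∈ A := ⟨_, c.α_mem 0 ω0⟩
  have hP := c.pathC
  have hC := CS_pathC (N := N) H.hA.isClosed ha0
  obtain ⟨R1, hT⟩ := c.tcond H
  have hY : Measurable (c.X t) := (hP.X_meas t).mono (c.F.le t) le_rfl
  have cg := cond_good hP H ha0 c.martC hT t0
  have pr : IsProbabilityMeasure (c.P.map (c.X t)) := Measure.isProbabilityMeasure_map hY.aemeasurable
  have ex : ∀ᵐ y ∂c.P.map (c.X t), ∃ (Q : Measure (CS N M)) (R : ℕ → ℕ), IsProbabilityMeasure Q ∧ GoodLaw f a A a0 y Q R ∧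
      ∀ s, 0 ≤ s → ∫ ω, pf lam V l XX s ω ∂Q ≤ U y := by
    filter_upwards [cg] with y hy
    obtain ⟨c', hc'⟩ := hex y ⟨mkControl hC H hy.mart hy.tc hy.init⟩
    obtain ⟨R', hT'⟩ := c'.tcond H
    have em := Enc_meas' c'.pathC H 0
    refine ⟨c'.P.map (Enc c'.pathC H 0), R', Measure.isProbabilityMeasure_map em.aemeasurable,
      Enc_good c'.pathC H ha0 c'.martC hT' c'.init, fun s s0 => ?_⟩
    rw [integral_map em.aemeasurable (hC.pf_meas H hV.measurable hl s).aestronglyMeasurable]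
    refine le_trans (le_of_eq ?_) (hc' s s0)
    congr 1
    ext1 ω
    unfold pf
    rw [XX_Enc c'.pathC H 0 s0, zero_add]
    congr 1
    refine setIntegral_congr_fun measurableSet_Ioc fun r hr => ?_
    simp only [XX_Enc c'.pathC H 0 hr.1.le, zero_add]
  set KK : ℝ := KV + Kl / lam with hKK
  have KK0 : 0 ≤ KK := by
    have h1 := (abs_nonneg _).trans (hVb 0)
    have h2 := (abs_nonneg _).trans (hlb 0)
    positivity
  have KU0 := (abs_nonneg _).trans (hUb 0)
  set δ' : ℝ := δ / (KK + KU + 1) with hδ'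
  have δ'0 : 0 < δ' := by positivity
  obtain ⟨S, mS, μS, κ, hκ, R2, hS⟩ := sel_laws H ha0 (c.P.map (c.X t)) hlam hV hl hVb hlb hU ex (δ := ENNReal.ofReal δ') (by simpa using δ'0)
  classical
  let κ' : Kernel (EN N) (CS N M) := Kernel.piecewise mS κ (condDistrib (Enc hP H t) (c.X t) c.P)
  have mk : IsMarkovKernel κ' := inferInstance
  let R3 : ℕ → ℕ := fun n => max (R2 n) (R1 (⌈t⌉₊ + n))
  have good : ∀ᵐ y ∂c.P.map (c.X t), GoodLaw f a A a0 y (κ' y) R3 := by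
    filter_upwards [cg] with y hy
    by_cases hyS : y ∈ S
    · have : κ' y = κ y := by simp [κ', Kernel.piecewise_apply, hyS]
      rw [this]
      obtain ⟨⟨h1, h2, h3⟩, _⟩ := hS y hyS
      exact ⟨h1, h2, h3.mono fun n => le_max_left _ _⟩
    · have : κ' y = condDistrib (Enc hP H t) (c.X t) c.P y := by simp [κ', Kernel.piecewise_apply, hyS]
      rw [this]
      obtain ⟨h1, h2, h3⟩ := hy
      exact ⟨h1, h2, h3.mono fun n => le_max_right _ _⟩
  have hP' := cat_path (N := N) (a0 := a0) hP H ha0 t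
  have ae := cat_ae (P := c.P) (κ := κ') hY good
  have init : ∀ᵐ p ∂PC c.P κ' (c.X t) hY, XC c.X t 0 p = x := by
    have : ∀ᵐ p ∂PC c.P κ' (c.X t) hY, c.X 0 p.1 = x := by
      unfold PC
      have m0 : Measurable (c.X 0) := (hP.X_meas 0).mono (c.F.le 0) le_rfl
      have ms : MeasurableSet {p : c.Ω × CS N M | c.X 0 p.1 = x} := measurableSet_eq_fun (m0.comp measurable_fst) measurable_const
      rw [Measure.ae_compProd_iff ms]
      filter_upwards [c.init] with ω hω
      exact ae_of_all _ fun _ => hω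
    filter_upwards [this] with p hp
    rw [XC_le t0, hp]
  let c' : Control N M A f a x := mkControl hP' H (cat_mart hP H ha0 c.martC t0 hY good) (cat_tc hP H ha0 t0 hT hY good) init
  refine ⟨c', fun s s0 st => ?_, fun s hs => ?_⟩
  · show ∫ p, pf lam V l (XC c.X t) s p ∂PC c.P κ' (c.X t) hY = _
    have i : Integrable (pf lam V l (XC c.X t) s) (PC c.P κ' (c.X t) hY) :=
      Integrable.of_bound (hP'.pf_meas H hV.measurable hl s).aestronglyMeasurable KK (ae_of_all _ fun p => pf_bdd hlam hVb hlb s0 p)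
    unfold PC at i ⊢
    rw [Measure.integral_compProd i]
    simp only [pf_XC_le st, integral_const, probReal_univ, one_smul]
  · show ∫ p, pf lam V l (XC c.X t) s p ∂PC c.P κ' (c.X t) hY ≤ _
    have s0 := t0.trans hs
    have i : Integrable (pf lam V l (XC c.X t) s) (PC c.P κ' (c.X t) hY) :=
      Integrable.of_bound (hP'.pf_meas H hV.measurable hl s).aestronglyMeasurable KK (ae_of_all _ fun p => pf_bdd hlam hVb hlb s0 p)
    have ae' : ∀ᵐ ω ∂c.P, ∀ᵐ w ∂κ' (c.X t ω), pf lam V l (XC c.X t) s (ω, w) =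
        (∫ r in Ioc (0:ℝ) t, Real.exp (-(lam * r)) * l (c.X r ω)) + Real.exp (-(lam * t)) * pf lam V l XX (s - t) w := by
      have := Measure.ae_ae_of_ae_compProd (κ := κ'.comap (c.X t) hY) ae
      filter_upwards [this] with ω hω
      filter_upwards [hω] with w hw
      exact pf_XC_ge hP H ha0 hl t0 hs hw
    have i2 : ∀ y, Integrable (pf lam V l (XX : ℝ → CS N M → EN N) (s - t)) (κ' y) := fun y =>
      Integrable.of_bound (hC.pf_meas H hV.measurable hl _).aestronglyMeasurable KK (ae_of_all _ fun p => pf_bdd hlam hVb hlb (by linarith) p)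
    have e0 : Real.exp (-(lam * t)) ≤ 1 := Real.exp_le_one_iff.2 (by nlinarith)
    have inner : ∀ y, ∫ w, pf lam V l XX (s - t) w ∂κ' y ≤ U y + Sᶜ.indicator (fun _ => KK + KU) y := by
      intro y
      by_cases hyS : y ∈ S
      · have : κ' y = κ y := by simp [κ', Kernel.piecewise_apply, hyS]
        rw [this]
        simpa [hyS] using (hS y hyS).2 (s - t) (by linarith)
      · have b : ∫ w, pf lam V l XX (s - t) w ∂κ' y ≤ KK := by
          refine (integral_mono (i2 y) (integrable_const KK) fun w => (le_abs_self _).trans (pf_bdd hlam hVb hlb (by linarith) w)).trans ?_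
          simp
        have := (abs_le.1 (hUb y)).1
        simp [hyS]
        linarith
    have iU : Integrable (pf lam U l c.X t) c.P :=
      Integrable.of_bound (hP.pf_meas H hU hl t).aestronglyMeasurable _ (ae_of_all _ fun p => pf_bdd hlam hUb hlb t0 p)
    have mI : MeasurableSet (c.X t ⁻¹' Sᶜ) := hY mS.compl
    have iI : Integrable ((c.X t ⁻¹' Sᶜ).indicator (fun _ => KK + KU)) c.P := (integrable_const _).indicator mI
    unfold PC at i ⊢
    rw [Measure.integral_compProd i]
    have step : ∫ ω, ∫ w, pf lam V l (XC c.X t) s (ω, w) ∂(κ'.comap (c.X t) hY) ω ∂c.P ≤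
        ∫ ω, (pf lam U l c.X t ω + (c.X t ⁻¹' Sᶜ).indicator (fun _ => KK + KU) ω) ∂c.P := by
      refine integral_mono_ae i.integral_compProd (iU.add iI) ?_
      filter_upwards [ae'] with ω hω
      show ∫ w, pf lam V l (XC c.X t) s (ω, w) ∂κ' (c.X t ω) ≤ pf lam U l c.X t ω + (c.X t ⁻¹' Sᶜ).indicator (fun _ => KK + KU) ω
      rw [integral_congr_ae hω, integral_add (integrable_const _) ((i2 _).const_mul _), integral_const_mul]
      simp only [integral_const, probReal_univ, one_smul]
      have := inner (c.X t ω)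
      have h1 := mul_le_mul_of_nonneg_left this (Real.exp_pos (-(lam * t))).le
      have e : (c.X t ⁻¹' Sᶜ).indicator (fun _ => KK + KU) ω = Sᶜ.indicator (fun _ => KK + KU) (c.X t ω) := rfl
      have i0 : 0 ≤ Sᶜ.indicator (fun _ => KK + KU) (c.X t ω) := indicator_nonneg (fun _ _ => by positivity) _
      have h2 := mul_le_mul_of_nonneg_right e0 i0
      rw [e]
      unfold pf at *
      linarith
    refine step.trans ?_
    rw [integral_add iU iI, integral_indicator mI]
    refine add_le_add le_rfl ?_
    simp only [integral_const, smul_eq_mul, measureReal_restrict_apply_univ]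
    have : c.P.real (c.X t ⁻¹' Sᶜ) ≤ δ' := by
      rw [Measure.real]
      refine ENNReal.toReal_le_of_le_ofReal δ'0.le ?_
      rwa [Measure.map_apply hY mS.compl] at μS
    have h3 := mul_le_mul_of_nonneg_right this (by positivity : 0 ≤ KK + KU)
    refine h3.trans ?_
    rw [hδ', div_mul_eq_mul_div, div_le_iff₀ (by positivity)]
    nlinarith
end catpf

section fin

variable {N M : ℕ} {A : Set (EN M)} {f : EN N → EN M → EN N}
    {σ : EN N → EN M → Matrix (Fin N) (Fin M) ℝ}
    {a : EN N → EN M → Matrix (Fin N) (Fin N) ℝ} {lam : ℝ} {V l : EN N → ℝ}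

lemma small_time (H : Hyp A f σ a) (hlam : 0 < lam) (hV : Continuous V) (hl : Continuous l)
    {KV Kl : ℝ} (hVb : ∀ x, |V x| ≤ KV) (hlb : ∀ x, |l x| ≤ Kl) (hV0 : ∀ x, 0 ≤ V x) (x : EN N) {g : ℝ} (hg : 0 < g) :
    ∃ ε : ℝ, 0 < ε ∧ ∀ y, ‖y - x‖ ≤ ε → ∀ c : Control N M A f a y, ∀ s, 0 ≤ s → s ≤ ε →
      ∫ ω, pf lam V l c.X s ω ∂c.P ≤ V x + g := by
  obtain ⟨r, r0, hr⟩ := Metric.continuous_iff.1 hV x (g / 2) (by positivity)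
  let χ : ContDiffBump x := ⟨r / 2, r, by positivity, by linarith⟩
  have χc : ContDiff ℝ 2 χ := χ.contDiff
  have χs : HasCompactSupport χ := χ.hasCompactSupport
  obtain ⟨C, C0, hC⟩ := gen_bdd H χc χs
  have KV0 := (abs_nonneg _).trans (hVb 0)
  have Kl0 := (abs_nonneg _).trans (hlb 0)
  refine ⟨min (r / 2) ((g / 2) / (KV * C + Kl + 1)), by positivity, fun y hy c s s0 hs => ?_⟩
  have hP := c.pathC
  have hVz : ∀ z, V z ≤ V x + g / 2 + KV * (1 - χ z) := by
    intro z
    by_cases hz : dist z x < r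
    · have h1 := hr z hz
      rw [Real.dist_eq, abs_lt] at h1
      have h2 : 0 ≤ KV * (1 - χ z) := mul_nonneg KV0 (by linarith [χ.le_one (x := z)])
      linarith
    · have h1 : χ z = 0 := χ.zero_of_le_dist (not_lt.1 hz)
      rw [h1]
      have := (le_abs_self _).trans (hVb z)
      have := hV0 x
      linarith
  have mX : Measurable (c.X s) := (hP.X_meas s).mono (c.F.le s) le_rfl
  have iχ : Integrable (fun ω => χ (c.X s ω)) c.P :=
    Integrable.of_bound (χc.continuous.measurable.comp mX).aestronglyMeasurable 1 (ae_of_all _ fun ω => by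
      rw [Real.norm_eq_abs, abs_of_nonneg χ.nonneg]; exact χ.le_one)
  have E1 : 1 - C * s ≤ ∫ ω, χ (c.X s ω) ∂c.P := by
    have h1 := c.martC χ χc χs 0 s le_rfl s0 univ MeasurableSet.univ
    simp only [Measure.restrict_univ] at h1
    have h2 : ∫ ω, Mp f a χ c.X c.α 0 ω ∂c.P = 1 := by
      have : ∫ ω, Mp f a χ c.X c.α 0 ω ∂c.P = ∫ ω, (1:ℝ) ∂c.P := by
        refine integral_congr_ae ?_
        filter_upwards [c.init] with ω hω
        rw [Mp_zero', hω]
        refine χ.one_of_mem_closedBall ?_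
        rw [Metric.mem_closedBall, dist_eq_norm]
        exact hy.trans (min_le_left _ _)
      rw [this]; simp
    have h3 : ∫ ω, (Mp f a χ c.X c.α s ω - C * s) ∂c.P ≤ ∫ ω, χ (c.X s ω) ∂c.P := by
      refine integral_mono ((hP.Mp_int H χc χs s0).sub (integrable_const _)) iχ fun ω => ?_
      have := Ip_bdd (X := c.X) c.α_mem hC ω s0
      rw [sub_zero, abs_le] at this
      show Mp f a χ c.X c.α s ω - C * s ≤ _
      unfold Mp
      linarith [this.1]
    rw [integral_sub (hP.Mp_int H χc χs s0) (integrable_const _), h1, h2] at h3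
    simpa using h3
  have step : ∫ ω, pf lam V l c.X s ω ∂c.P ≤ ∫ ω, ((V x + g / 2 + KV + Kl * s) - KV * χ (c.X s ω)) ∂c.P := by
    refine integral_mono ?_ ((integrable_const _).sub (iχ.const_mul _)) fun ω => ?_
    · exact Integrable.of_bound (hP.pf_meas H hV.measurable hl s).aestronglyMeasurable _ (ae_of_all _ fun p => pf_bdd hlam hVb hlb s0 p)
    · have h1 : Real.exp (-(lam * s)) * V (c.X s ω) ≤ V (c.X s ω) :=
        mul_le_of_le_one_left (hV0 _) (Real.exp_le_one_iff.2 (by nlinarith))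
      have h2 : ‖∫ r in Ioc (0:ℝ) s, Real.exp (-(lam * r)) * l (c.X r ω)‖ ≤ Kl * s := by
        have := norm_setIntegral_le_of_norm_le_const (μ := volume) (s := Ioc (0:ℝ) s) (C := Kl)
          (f := fun r => Real.exp (-(lam * r)) * l (c.X r ω)) (by simp) (fun r hr => by
            rw [norm_mul, Real.norm_eq_abs, Real.norm_eq_abs, Real.abs_exp]
            calc _ ≤ 1 * Kl := mul_le_mul (Real.exp_le_one_iff.2 (by nlinarith [hr.1])) (hlb _) (abs_nonneg _) zero_le_one
              _ = Kl := one_mul _)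
        simpa [Measure.real, ENNReal.toReal_ofReal s0] using this
      have h3 := hVz (c.X s ω)
      have h4 := (le_abs_self _).trans h2
      unfold pf
      simp only []
      linarith
  rw [integral_sub (integrable_const _) (iχ.const_mul _), integral_const_mul] at step
  simp only [integral_const, probReal_univ, one_smul] at step
  have h5 := mul_le_mul_of_nonneg_left E1 KV0
  have h6 : s * (KV * C + Kl + 1) ≤ g / 2 := by
    rw [← le_div_iff₀ (by positivity)]
    exact hs.trans (min_le_right _ _)
  nlinarith

lemma stmt_aux (hA : IsCompact A)
    (hf : ContinuousOn (fun p : EN N × EN M => f p.1 p.2) (univ ×ˢ A))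
    (hσ : ContinuousOn (fun p : EN N × EN M => σ p.1 p.2) (univ ×ˢ A))
    (hlip : LipCoeff A f σ)
    (ha : ∀ y β, a y β = (2⁻¹ : ℝ) • (σ y β * (σ y β).transpose))
    (hlam : 0 < lam)
    (Vk : EN N → ℝ) (hVkc : Continuous Vk) (hVkb : ∃ K, ∀ y, |Vk y| ≤ K) (hVk0 : ∀ y, 0 ≤ Vk y)
    (l : EN N → ℝ) (hlc : Continuous l) (hlb : ∃ K, ∀ y, |l y| ≤ K) (hl0 : ∀ y, 0 ≤ l y)
    (L : EN N → ℝ)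
    (hL : ∀ y : EN N, L y = ⨅ c : Control N M A f a y, ⨆ t : Ici (0:ℝ), ∫ ω, pf lam Vk l c.X t ω ∂c.P)
    (Lstar : EN N → ℝ) (hLstar : ∀ y : EN N, Lstar y = limsup L (𝓝 y))
    (x : EN N) (hgt : Vk x < Lstar x) :
    ∃ (xs : ℕ → EN N) (ε : ℝ), 0 < ε ∧
      Tendsto xs atTop (𝓝 x) ∧
      Tendsto (fun n => L (xs n)) atTop (𝓝 (Lstar x)) ∧
      (∀ n, Vk (xs n) < L (xs n)) ∧
      ∀ n, ‖xs n - x‖ ≤ ε → ∀ t : ℝ, 0 ≤ t → t ≤ ε →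
        L (xs n) ≤ ⨅ c : Control N M A f a (xs n), ∫ ω, pf lam Lstar l c.X t ω ∂c.P := by
  have H : Hyp A f σ a := ⟨hA, hf, hσ, hlip, ha⟩
  obtain ⟨KV, hVb⟩ := hVkb
  obtain ⟨Kl, hlb⟩ := hlb
  have KV0 := (abs_nonneg _).trans (hVb 0)
  have Kl0 := (abs_nonneg _).trans (hlb 0)
  set K : ℝ := KV + Kl / lam with hK
  have K0 : 0 ≤ K := by positivity
  have J0 : ∀ {y} (c : Control N M A f a y) (s : ℝ), 0 ≤ ∫ ω, pf lam Vk l c.X s ω ∂c.P := by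
    intro y c s
    refine integral_nonneg fun ω => ?_
    refine add_nonneg (mul_nonneg (Real.exp_pos _).le (hVk0 _)) (integral_nonneg fun r => mul_nonneg (Real.exp_pos _).le (hl0 _))
  have JK : ∀ {y} (c : Control N M A f a y) (s : ℝ), 0 ≤ s → ∫ ω, pf lam Vk l c.X s ω ∂c.P ≤ K := by
    intro y c s s0
    have := norm_integral_le_of_norm_le_const (μ := c.P) (f := fun ω => pf lam Vk l c.X s ω) (ae_of_all _ fun ω => pf_bdd hlam hVb hlb s0 ω)
    rw [probReal_univ, mul_one] at this
    exact (le_abs_self _).trans this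
  have Jbdd : ∀ {y} (c : Control N M A f a y), BddAbove (range fun t : Ici (0:ℝ) => ∫ ω, pf lam Vk l c.X t ω ∂c.P) := by
    intro y c
    exact ⟨K, by rintro _ ⟨t, rfl⟩; exact JK c t t.2⟩
  have S0 : ∀ {y} (c : Control N M A f a y), 0 ≤ ⨆ t : Ici (0:ℝ), ∫ ω, pf lam Vk l c.X t ω ∂c.P := fun c =>
    Real.iSup_nonneg fun t => J0 c t
  have Ble : ∀ y, BddBelow (range fun c : Control N M A f a y => ⨆ t : Ici (0:ℝ), ∫ ω, pf lam Vk l c.X t ω ∂c.P) := fun y =>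
    ⟨0, by rintro _ ⟨c, rfl⟩; exact S0 c⟩
  have Lc : ∀ {y} (c : Control N M A f a y) (B : ℝ), (∀ s, 0 ≤ s → ∫ ω, pf lam Vk l c.X s ω ∂c.P ≤ B) → L y ≤ B := by
    intro y c B hB
    rw [hL]
    exact (ciInf_le (Ble y) c).trans (ciSup_le fun t => hB t t.2)
  have L0 : ∀ y, 0 ≤ L y := fun y => by
    rw [hL]; exact Real.iInf_nonneg fun c => S0 c
  have LK : ∀ y, L y ≤ K := fun y => by
    rcases isEmpty_or_nonempty (Control N M A f a y) with h | ⟨⟨c⟩⟩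
    · rw [hL, Real.iInf_of_isEmpty]; exact K0
    · exact Lc c K fun s s0 => JK c s s0
  have near : ∀ y, Nonempty (Control N M A f a y) → ∀ δ, 0 < δ → ∃ c : Control N M A f a y, ∀ s, 0 ≤ s → ∫ ω, pf lam Vk l c.X s ω ∂c.P ≤ L y + δ := by
    intro y hy δ hδ
    have : (⨅ c : Control N M A f a y, ⨆ t : Ici (0:ℝ), ∫ ω, pf lam Vk l c.X t ω ∂c.P) < L y + δ := by
      rw [← hL]; linarith
    obtain ⟨c, hc⟩ := exists_lt_of_ciInf_lt this
    exact ⟨c, fun s s0 => (le_ciSup (Jbdd c) ⟨s, s0⟩).trans hc.le⟩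
  have bu : ∀ y, IsBoundedUnder (· ≤ ·) (𝓝 y) L := fun y => ⟨K, by simpa using Eventually.of_forall LK⟩
  have bl : ∀ y, IsBoundedUnder (· ≥ ·) (𝓝 y) L := fun y => ⟨0, by simpa using Eventually.of_forall L0⟩
  have lt_ev : ∀ y b, Lstar y < b → ∀ᶠ z in 𝓝 y, L z < b := fun y b hb => by
    rw [hLstar] at hb; exact eventually_lt_of_limsup_lt hb (bu y)
  have Lle : ∀ y, L y ≤ Lstar y := fun y => le_of_forall_gt fun b hb => (lt_ev y b hb).self_of_nhds
  have LsK : ∀ y b, (∀ᶠ z in 𝓝 y, L z ≤ b) → Lstar y ≤ b := fun y b hb => by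
    rw [hLstar]; exact limsup_le_of_le (bl y).isCoboundedUnder_le hb
  have Ls_bdd : ∀ y, |Lstar y| ≤ K := fun y => by
    rw [abs_of_nonneg ((L0 y).trans (Lle y))]
    exact LsK y K (Eventually.of_forall LK)
  have usc : UpperSemicontinuous Lstar := by
    intro y b hb
    obtain ⟨b', h1, h2⟩ := exists_between hb
    filter_upwards [eventually_eventually_nhds.2 (lt_ev y b' h1)] with w hw
    exact (LsK w b' (hw.mono fun z hz => hz.le)).trans_lt h2
  have mLs : Measurable Lstar := usc.measurable
  set g : ℝ := Lstar x - Vk x with hg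
  have g0 : 0 < g := by linarith
  have seq : ∀ n : ℕ, ∃ y, dist y x < 1 / ((n:ℝ) + 1) ∧ |L y - Lstar x| < 1 / ((n:ℝ) + 1) ∧ Lstar x - g / 4 < L y ∧ Vk y < Vk x + g / 4 := by
    intro n
    have n0 : 0 < 1 / ((n:ℝ) + 1) := by positivity
    have h1 : ∃ᶠ y in 𝓝 x, Lstar x - min (g / 4) (1 / ((n:ℝ) + 1)) < L y := by
      refine frequently_lt_of_lt_limsup (bl x).isCoboundedUnder_le ?_
      rw [← hLstar]
      have : 0 < min (g / 4) (1 / ((n:ℝ) + 1)) := lt_min (by positivity) n0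
      linarith
    have h2 := lt_ev x (Lstar x + 1 / ((n:ℝ) + 1)) (by linarith)
    have h3 : ∀ᶠ y in 𝓝 x, Vk y < Vk x + g / 4 := hVkc.continuousAt.eventually_lt continuousAt_const (by linarith)
    have h4 : ∀ᶠ y in 𝓝 x, dist y x < 1 / ((n:ℝ) + 1) := Metric.ball_mem_nhds x n0
    obtain ⟨y, q1, q2, q3, q4⟩ := (h1.and_eventually (h2.and (h3.and h4))).exists
    have m1 := min_le_left (g / 4) (1 / ((n:ℝ) + 1))
    have m2 := min_le_right (g / 4) (1 / ((n:ℝ) + 1))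
    exact ⟨y, q4, by rw [abs_lt]; constructor <;> linarith, by linarith, q3⟩
  choose xs x1 x2 x3 x4 using seq
  obtain ⟨ε, ε0, hε⟩ := small_time (lam := lam) H hlam hVkc hlc hVb hlb hVk0 x (g := g / 2) (by positivity)
  have VL : ∀ n, Vk (xs n) < L (xs n) := fun n => by linarith [x3 n, x4 n]
  refine ⟨xs, ε, ε0, ?_, ?_, VL, ?_⟩
  · rw [tendsto_iff_dist_tendsto_zero]
    exact squeeze_zero (fun _ => dist_nonneg) (fun n => (x1 n).le) tendsto_one_div_add_atTop_nhds_zero_nat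
  · rw [tendsto_iff_dist_tendsto_zero]
    exact squeeze_zero (fun _ => dist_nonneg) (fun n => by rw [Real.dist_eq]; exact (x2 n).le) tendsto_one_div_add_atTop_nhds_zero_nat
  intro n hn t t0 tε
  have ne : Nonempty (Control N M A f a (xs n)) := by
    by_contra h
    rw [not_nonempty_iff] at h
    have h1 := hL (xs n)
    rw [Real.iInf_of_isEmpty] at h1
    linarith [VL n, hVk0 (xs n)]
  refine le_ciInf fun c => ?_
  refine le_of_forall_pos_le_add fun δ hδ => ?_
  have hUb : ∀ y, |Lstar y + δ / 2| ≤ K + δ / 2 := fun y => by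
    refine (abs_add_le _ _).trans (add_le_add (Ls_bdd y) (le_of_eq (abs_of_pos (by positivity))))
  obtain ⟨c', h1, h2⟩ := concat c H hlam hVkc hlc hVb hlb (U := fun y => Lstar y + δ / 2) (mLs.add_const _) hUb
    (fun y hy => by
      obtain ⟨c', hc'⟩ := near y hy (δ / 2) (by positivity)
      exact ⟨c', fun s s0 => (hc' s s0).trans (by linarith [Lle y])⟩) t0 (δ := δ / 2) (by positivity)
  have iL : Integrable (pf lam Lstar l c.X t) c.P :=
    Integrable.of_bound (c.pathC.pf_meas H mLs hlc t).aestronglyMeasurable _ (ae_of_all _ fun p => pf_bdd hlam Ls_bdd hlb t0 p)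
  have iU : Integrable (pf lam (fun y => Lstar y + δ / 2) l c.X t) c.P :=
    Integrable.of_bound (c.pathC.pf_meas H (mLs.add_const _) hlc t).aestronglyMeasurable _ (ae_of_all _ fun p => pf_bdd hlam hUb hlb t0 p)
  have h3 : ∫ ω, pf lam (fun y => Lstar y + δ / 2) l c.X t ω ∂c.P ≤ ∫ ω, pf lam Lstar l c.X t ω ∂c.P + δ / 2 := by
    have : ∫ ω, pf lam (fun y => Lstar y + δ / 2) l c.X t ω ∂c.P ≤ ∫ ω, (pf lam Lstar l c.X t ω + δ / 2) ∂c.P := by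
      refine integral_mono iU (iL.add (integrable_const _)) fun ω => ?_
      have e0 : Real.exp (-(lam * t)) ≤ 1 := Real.exp_le_one_iff.2 (by nlinarith)
      have := mul_le_mul_of_nonneg_right e0 (by positivity : 0 ≤ δ / 2)
      simp only [pf]
      linarith
    rw [integral_add iL (integrable_const _)] at this
    simpa using this
  by_contra hcon
  push Not at hcon
  have hB := Lc c' (max (Vk x + g / 2) (∫ ω, pf lam Lstar l c.X t ω ∂c.P + δ)) fun s s0 => by
    rcases le_total s t with h | h
    · rw [h1 s s0 h]
      exact (hε _ hn c s s0 (h.trans tε)).trans (le_max_left _ _)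
    · exact ((h2 s h).trans (by linarith)).trans (le_max_right _ _)
  rcases le_max_iff.1 hB with h | h
  · linarith [x3 n]
  · linarith
end fin
set_option maxSynthPendingDepth 1
/-- Lemma 3.2: a local suboptimality principle at points where the upper
semicontinuous envelope `L*` of the discounted value function `L` lies above the obstacle. -/
theorem stmt1 {N M : ℕ} (hN : 1 ≤ N) (hM : 1 ≤ M)
    (A : Set (EN M)) (hA : IsCompact A)
    (f : EN N → EN M → EN N) (σ : EN N → EN M → Matrix (Fin N) (Fin M) ℝ)
    (hf : ContinuousOn (fun p : EN N × EN M => f p.1 p.2) (univ ×ˢ A))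
    (hσ : ContinuousOn (fun p : EN N × EN M => σ p.1 p.2) (univ ×ˢ A))
    (hlip : LipCoeff A f σ)
    (a : EN N → EN M → Matrix (Fin N) (Fin N) ℝ)
    (ha : ∀ y β, a y β = (2⁻¹ : ℝ) • (σ y β * (σ y β).transpose))
    (hconv : ConvexCoeff A f a)
    (lam : ℝ) (hlam : 0 < lam)
    (Vk : EN N → ℝ) (hVkc : Continuous Vk) (hVkb : ∃ K, ∀ y, |Vk y| ≤ K) (hVk0 : ∀ y, 0 ≤ Vk y)
    (l : EN N → ℝ) (hlc : Continuous l) (hlb : ∃ K, ∀ y, |l y| ≤ K) (hl0 : ∀ y, 0 ≤ l y)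
    (L : EN N → ℝ)
    (hL : ∀ y : EN N, L y = ⨅ c : Control N M A f a y, ⨆ t : Ici (0:ℝ),
      ∫ ω, (Real.exp (-(lam * (t : ℝ))) * Vk (c.X (t : ℝ) ω)
        + ∫ s in Ioc (0:ℝ) (t : ℝ), Real.exp (-(lam * s)) * l (c.X s ω)) ∂c.P)
    (Lstar : EN N → ℝ) (hLstar : ∀ y : EN N, Lstar y = limsup L (𝓝 y))
    (x : EN N) (hgt : Vk x < Lstar x) :
    ∃ (xs : ℕ → EN N) (ε : ℝ), 0 < ε ∧
      Tendsto xs atTop (𝓝 x) ∧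
      Tendsto (fun n => L (xs n)) atTop (𝓝 (Lstar x)) ∧
      (∀ n, Vk (xs n) < L (xs n)) ∧
      ∀ n, ‖xs n - x‖ ≤ ε → ∀ t : ℝ, 0 ≤ t → t ≤ ε →
        L (xs n) ≤ ⨅ c : Control N M A f a (xs n),
          ∫ ω, (Real.exp (-(lam * t)) * Lstar (c.X t ω)
            + ∫ s in Ioc (0:ℝ) t, Real.exp (-(lam * s)) * l (c.X s ω)) ∂c.P := by
  exact stmt_aux hA hf hσ hlip ha hlam Vk hVkc hVkb hVk0 l hlc hlb hl0 L hL Lstar hLstar x hgt
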